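/- Fix a real number ρ with 0 < ρ < 1/2. There exists a constant C > 0 and x_0 such that for every real x ≥ x_0 there is a prime q with x^ρ / log x < q < x^ρ satisfying both |L(x,q) − x/(φ(q) log x)| ≤ C·x/(φ(q)(log x)^2) and |M(x,q) − x/φ(q)| ≤ C·x/(φ(q)(log x)^2), where L(x,q) is the number of primes p ≤ x with p ≡ 1 (mod q) and M(x,q) = ∑ log p, the sum over primes p ≤ x with p ≡ 1 (mod q). -/

import Mathlib

/-- `L(x,q)`: the number of primes `p ≤ x` with `p ≡ 1 (mod q)`. -/
noncomputable def Lfun (x : ℝ) (q : ℕ) : ℕ :=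
  ((Finset.range (⌊x⌋₊ + 1)).filter fun p => p.Prime ∧ p % q = 1).card

/-- `M(x,q) = ∑ log p`, the sum over primes `p ≤ x` with `p ≡ 1 (mod q)`. -/
noncomputable def Mfun (x : ℝ) (q : ℕ) : ℝ :=
  ∑ p ∈ (Finset.range (⌊x⌋₊ + 1)).filter fun p => p.Prime ∧ p % q = 1, Real.log p

namespace BVC
open Finset MeasureTheory

/-- trigonometric polynomial -/
noncomputable def trig (N : ℕ) (c : ℕ → ℂ) (α : ℝ) : ℂ :=
  ∑ n ∈ range (N + 1), c n * Complex.exp (2 * Real.pi * Complex.I * n * α)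

lemma int_exp (n m : ℕ) :
    ∫ α in (0:ℝ)..1, Complex.exp (2 * Real.pi * Complex.I * n * α) *
      (starRingEnd ℂ) (Complex.exp (2 * Real.pi * Complex.I * m * α)) = if n = m then 1 else 0 := by
  have h1 : ∀ α : ℝ, Complex.exp (2 * Real.pi * Complex.I * n * α) *
      (starRingEnd ℂ) (Complex.exp (2 * Real.pi * Complex.I * m * α)) =
      Complex.exp ((2 * Real.pi * Complex.I * ((n:ℂ) - m)) * α) := by
    intro α
    rw [← Complex.exp_conj, ← Complex.exp_add]
    congr 1
    simp only [map_mul, Complex.conj_I, Complex.conj_ofReal, map_ofNat, Complex.conj_natCast]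
    ring
  simp_rw [h1]
  split_ifs with h
  · subst h; simp
  · have hne : (2 * Real.pi * Complex.I * ((n:ℂ) - m)) ≠ 0 := by
      have : ((n:ℂ) - m) ≠ 0 := by
        rw [sub_ne_zero]; exact_mod_cast h
      have h2 := Complex.two_pi_I_ne_zero
      exact mul_ne_zero h2 this
    rw [integral_exp_mul_complex hne]
    have : Complex.exp ((2 * Real.pi * Complex.I * ((n:ℂ) - m)) * (1:ℝ)) = 1 := by
      rw [Complex.exp_eq_one_iff]
      exact ⟨(n:ℤ) - m, by push_cast; ring⟩
    rw [this]; simp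

lemma trig_cont (N : ℕ) (c : ℕ → ℂ) : Continuous (trig N c) := by
  unfold trig; fun_prop

lemma parseval (N : ℕ) (c : ℕ → ℂ) :
    ∫ α in (0:ℝ)..1, ‖trig N c α‖ ^ 2 = ∑ n ∈ range (N + 1), ‖c n‖ ^ 2 := by
  have h : ((∫ α in (0:ℝ)..1, ‖trig N c α‖ ^ 2 : ℝ) : ℂ) =
      ((∑ n ∈ range (N + 1), ‖c n‖ ^ 2 : ℝ) : ℂ) := by
    rw [← intervalIntegral.integral_ofReal]
    have h1 : ∀ α : ℝ, ((‖trig N c α‖ ^ 2 : ℝ) : ℂ) = ∑ n ∈ range (N + 1), ∑ m ∈ range (N + 1),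
        (c n * (starRingEnd ℂ) (c m)) * (Complex.exp (2 * Real.pi * Complex.I * n * α) *
      (starRingEnd ℂ) (Complex.exp (2 * Real.pi * Complex.I * m * α))) := by
      intro α
      push_cast
      rw [← Complex.mul_conj', trig, map_sum, Finset.sum_mul_sum]
      refine sum_congr rfl fun n _ => sum_congr rfl fun m _ => ?_
      rw [map_mul]; ring
    simp_rw [h1]
    rw [intervalIntegral.integral_finsetSum]
    · push_cast
      refine sum_congr rfl fun n hn => ?_
      rw [intervalIntegral.integral_finsetSum]
      · simp_rw [intervalIntegral.integral_const_mul, int_exp]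
        rw [Finset.sum_eq_single n]
        · simp [Complex.mul_conj']
        · intro b _ hb; simp [hb.symm]
        · intro h; exact absurd hn h
      · intro m _
        apply Continuous.intervalIntegrable
        fun_prop
    · intro n _
      apply Continuous.intervalIntegrable
      fun_prop
  exact_mod_cast h

lemma cs_interval {a b : ℝ} (hab : a ≤ b) {g : ℝ → ℝ} (hg : Continuous g) :
    (∫ t in a..b, g t) ^ 2 ≤ (b - a) * ∫ t in a..b, g t ^ 2 := by
  rcases hab.eq_or_lt with rfl | hlt
  · simp
  have hd : 0 < b - a := sub_pos.2 hlt
  set D := ∫ t in a..b, g t with hD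
  have h0 : 0 ≤ ∫ t in a..b, ((b - a) * g t - D) ^ 2 :=
    intervalIntegral.integral_nonneg hab fun t _ => sq_nonneg _
  have h1 : ∫ t in a..b, ((b - a) * g t - D) ^ 2 =
      (b - a) ^ 2 * (∫ t in a..b, g t ^ 2) - 2 * (b - a) * D * D + D ^ 2 * (b - a) := by
    have : ∀ t, ((b - a) * g t - D) ^ 2 =
      ((b - a) ^ 2 * g t ^ 2 - (2 * (b - a) * D) * g t) + D ^ 2 := fun t => by ring
    simp_rw [this]
    rw [intervalIntegral.integral_add, intervalIntegral.integral_sub,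
      intervalIntegral.integral_const_mul, intervalIntegral.integral_const_mul,
      intervalIntegral.integral_const]
    · rw [← hD]; simp only [smul_eq_mul]; ring
    all_goals apply Continuous.intervalIntegrable; fun_prop
  rw [h1] at h0
  have h2 : 0 ≤ (b - a) * ((b - a) * (∫ t in a..b, g t ^ 2) - D ^ 2) := by nlinarith
  have := (mul_nonneg_iff_of_pos_left hd).1 h2
  linarith

lemma gallagher {f f' : ℝ → ℂ} (hf : ∀ t, HasDerivAt f (f' t) t) (hf' : Continuous f')
    (hfc : Continuous f) {δ : ℝ} (hδ : 0 < δ) (α : ℝ) :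
    ‖f α‖ ^ 2 ≤ (2 / δ) * (∫ t in (α - δ / 2)..(α + δ / 2), ‖f t‖ ^ 2) +
      2 * δ * ∫ t in (α - δ / 2)..(α + δ / 2), ‖f' t‖ ^ 2 := by
  set a := α - δ / 2
  set b := α + δ / 2
  have hba : b - a = δ := by simp only [a, b]; ring
  have hab : a ≤ b := by linarith
  set D := ∫ t in a..b, ‖f' t‖
  have hDs : D ^ 2 ≤ δ * ∫ t in a..b, ‖f' t‖ ^ 2 := by
    have := cs_interval hab (g := fun t => ‖f' t‖) (by fun_prop)
    rwa [hba] at this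
  have hpt : ∀ β ∈ Set.Icc a b, ‖f α‖ ^ 2 ≤ 2 * ‖f β‖ ^ 2 + 2 * D ^ 2 := by
    intro β hβ
    have hα : α ∈ Set.Icc a b := ⟨by simp only [a]; linarith, by simp only [b]; linarith⟩
    have h1 : f α - f β = ∫ t in β..α, f' t := by
      rw [intervalIntegral.integral_eq_sub_of_hasDerivAt (fun t _ => hf t)
        (hf'.intervalIntegrable _ _)]
    have h2 : ‖f α - f β‖ ≤ D := by
      rw [h1]
      refine (intervalIntegral.norm_integral_le_abs_integral_norm).trans ?_
      have hnn : ∀ t, 0 ≤ ‖f' t‖ := fun t => norm_nonneg _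
      rw [abs_le]
      have key : ∀ u ∈ Set.Icc a b, ∀ v ∈ Set.Icc a b, u ≤ v → ∫ t in u..v, ‖f' t‖ ≤ D := by
        intro u hu v hv huv
        apply intervalIntegral.integral_mono_interval hu.1 huv hv.2
        · exact Filter.Eventually.of_forall fun t => hnn t
        · exact (hf'.norm).intervalIntegrable _ _
      rcases le_total β α with h | h
      · have := key β hβ α hα h
        have h0 : 0 ≤ ∫ t in β..α, ‖f' t‖ := intervalIntegral.integral_nonneg h fun t _ => hnn t
        constructor <;> linarith
      · have := key α hα β hβ h
        have h0 : 0 ≤ ∫ t in α..β, ‖f' t‖ := intervalIntegral.integral_nonneg h fun t _ => hnn t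
        rw [intervalIntegral.integral_symm]
        constructor <;> linarith
    have h3 : ‖f α‖ ≤ ‖f β‖ + D := by
      calc ‖f α‖ = ‖f β + (f α - f β)‖ := by congr 1; ring
        _ ≤ _ := (norm_add_le _ _).trans (by linarith)
    have h4 := norm_nonneg (f α)
    nlinarith [sq_nonneg (‖f β‖ - D), norm_nonneg (f β)]
  have hIntg : ∫ β in a..b, ‖f α‖ ^ 2 ≤ ∫ β in a..b, (2 * ‖f β‖ ^ 2 + 2 * D ^ 2) := by
    apply intervalIntegral.integral_mono_on hab
    · simp
    · apply Continuous.intervalIntegrable; fun_prop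
    · exact hpt
  rw [intervalIntegral.integral_const, intervalIntegral.integral_add,
      intervalIntegral.integral_const_mul, intervalIntegral.integral_const, hba] at hIntg
  · simp only [smul_eq_mul] at hIntg
    have : ‖f α‖ ^ 2 ≤ (2 / δ) * (∫ t in a..b, ‖f t‖ ^ 2) + 2 * D ^ 2 := by
      rw [← mul_le_mul_iff_right₀ hδ]
      refine hIntg.trans (le_of_eq ?_)
      field_simp
    linarith
  all_goals apply Continuous.intervalIntegrable; fun_prop

lemma trig_deriv (N : ℕ) (c : ℕ → ℂ) (t : ℝ) :
    HasDerivAt (trig N c) (trig N (fun n => 2 * Real.pi * Complex.I * n * c n) t) t := by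
  unfold trig
  apply HasDerivAt.fun_sum
  intro n _
  have h1 : HasDerivAt (fun α : ℝ => 2 * Real.pi * Complex.I * n * (α:ℂ))
      (2 * Real.pi * Complex.I * n * 1) t := (HasDerivAt.ofReal_comp (hasDerivAt_id t)).const_mul _
  have := (h1.cexp).const_mul (c n)
  refine HasDerivAt.congr_deriv this ?_
  ring

lemma additive_ls {ι : Type*} (s : Finset ι) (α : ι → ℝ) (N : ℕ) (c : ℕ → ℂ) {δ : ℝ} (hδ : 0 < δ)
    (h0 : ∀ i ∈ s, δ / 2 ≤ α i) (h1 : ∀ i ∈ s, α i ≤ 1 - δ / 2)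
    (hsp : ∀ i ∈ s, ∀ j ∈ s, i ≠ j → δ ≤ |α i - α j|) :
    ∑ i ∈ s, ‖trig N c (α i)‖ ^ 2 ≤
      (2 / δ + 8 * Real.pi ^ 2 * δ * N ^ 2) * ∑ n ∈ range (N + 1), ‖c n‖ ^ 2 := by
  set c' : ℕ → ℂ := fun n => 2 * Real.pi * Complex.I * n * c n
  have key : ∀ g : ℝ → ℝ, Continuous g → (∀ t, 0 ≤ g t) →
      ∑ i ∈ s, ∫ t in (α i - δ / 2)..(α i + δ / 2), g t ≤ ∫ t in (0:ℝ)..1, g t := by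
    intro g hg hg0
    have e1 : ∀ i, ∫ t in (α i - δ / 2)..(α i + δ / 2), g t =
        ∫ t in Set.Ioc (α i - δ / 2) (α i + δ / 2), g t := fun i =>
      intervalIntegral.integral_of_le (by linarith)
    simp_rw [e1]
    rw [← integral_biUnion_finset, intervalIntegral.integral_of_le zero_le_one]
    · apply setIntegral_mono_set
      · exact (hg.integrableOn_Icc).mono_set Set.Ioc_subset_Icc_self
      · exact Filter.Eventually.of_forall fun t => hg0 t
      · apply LE.le.eventuallyLE
        apply Set.iUnion₂_subset
        intro i hi
        exact Set.Ioc_subset_Ioc (by linarith [h0 i hi]) (by linarith [h1 i hi])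
    · intro i _; exact measurableSet_Ioc
    · intro i hi j hj hij
      have := hsp i hi j hj hij
      rw [Function.onFun, Set.disjoint_left]
      intro t ht ht'
      simp only [Set.mem_Ioc] at ht ht'
      rw [le_abs] at this
      rcases this with h | h <;> linarith [ht.1, ht.2, ht'.1, ht'.2]
    · intro i _
      exact (hg.integrableOn_Icc).mono_set Set.Ioc_subset_Icc_self
  have hb : ∑ i ∈ s, ‖trig N c (α i)‖ ^ 2 ≤ ∑ i ∈ s,
      ((2 / δ) * (∫ t in (α i - δ / 2)..(α i + δ / 2), ‖trig N c t‖ ^ 2) +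
      2 * δ * ∫ t in (α i - δ / 2)..(α i + δ / 2), ‖trig N c' t‖ ^ 2) :=
    sum_le_sum fun i _ => gallagher (trig_deriv N c) (trig_cont N _) (trig_cont N _) hδ _
  refine hb.trans ?_
  rw [sum_add_distrib, ← mul_sum, ← mul_sum]
  have k1 := key (fun t => ‖trig N c t‖ ^ 2) (by have := trig_cont N c; fun_prop)
    (fun t => by positivity)
  have k2 := key (fun t => ‖trig N c' t‖ ^ 2) (by have := trig_cont N c'; fun_prop)
    (fun t => by positivity)
  rw [parseval] at k1 k2
  have k3 : ∑ n ∈ range (N + 1), ‖c' n‖ ^ 2 ≤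
      (4 * Real.pi ^ 2 * N ^ 2) * ∑ n ∈ range (N + 1), ‖c n‖ ^ 2 := by
    rw [mul_sum]
    apply sum_le_sum
    intro n hn
    have hn' : (n:ℝ) ≤ N := by exact_mod_cast Nat.lt_succ_iff.1 (mem_range.1 hn)
    have : ‖c' n‖ = 2 * Real.pi * n * ‖c n‖ := by
      simp [c', abs_of_pos Real.pi_pos]
    rw [this]
    have e : (2 * Real.pi * n * ‖c n‖) ^ 2 = (4 * Real.pi ^ 2 * ‖c n‖ ^ 2) * (n:ℝ) ^ 2 := by ring
    rw [e]
    have : (n:ℝ) ^ 2 ≤ (N:ℝ) ^ 2 := by gcongr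
    calc _ ≤ (4 * Real.pi ^ 2 * ‖c n‖ ^ 2) * (N:ℝ) ^ 2 := by gcongr
      _ = _ := by ring
  have p1 : 0 ≤ 2 / δ := by positivity
  have p2 : 0 ≤ 2 * δ := by positivity
  have := mul_le_mul_of_nonneg_left k1 p1
  have := mul_le_mul_of_nonneg_left (k2.trans k3) p2
  nlinarith

end BVC

namespace BVC
open Finset MeasureTheory

open Classical in
/-- nontrivial characters mod q -/
noncomputable def nt (q : ℕ) : Finset (DirichletCharacter ℂ q) :=
  if h : q ≠ 0 then haveI : NeZero q := ⟨h⟩; Finset.univ.erase 1 else ∅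

lemma nt_eq (q : ℕ) [NeZero q] [DecidableEq (DirichletCharacter ℂ q)] :
    nt q = Finset.univ.erase 1 := by
  unfold nt
  rw [dif_pos (NeZero.ne q)]
  ext; simp

lemma mem_nt {q : ℕ} (hq : q ≠ 0) (χ : DirichletCharacter ℂ q) : χ ∈ nt q ↔ χ ≠ 1 := by
  classical
  have : NeZero q := ⟨hq⟩
  rw [nt_eq]; simp

lemma ne_one_of_mem_nt {q : ℕ} {χ : DirichletCharacter ℂ q} (h : χ ∈ nt q) : χ ≠ 1 := by
  by_cases hq : q ≠ 0
  · exact (mem_nt hq χ).1 h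
  · unfold nt at h; rw [dif_neg hq] at h; simp at h

lemma card_nt_le {q : ℕ} (hq : q ≠ 0) : (nt q).card ≤ q := by
  classical
  have : NeZero q := ⟨hq⟩
  rw [nt_eq]
  refine (card_erase_le).trans ?_
  rw [card_univ, ← Nat.card_eq_fintype_card, DirichletCharacter.card_eq_totient_of_hasEnoughRootsOfUnity]
  exact Nat.totient_le q

section
variable {q : ℕ} [hq : Fact q.Prime]

noncomputable def FF (N : ℕ) (c : ℕ → ℂ) (a : ZMod q) : ℂ :=
  ∑ n ∈ range (N + 1), c n * ZMod.stdAddChar (a * (n : ZMod q))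

lemma FF_eq_trig (N : ℕ) (c : ℕ → ℂ) (a : ℕ) :
    FF (q := q) N c (a : ZMod q) = trig N c ((a : ℝ) / q) := by
  unfold FF trig
  refine sum_congr rfl fun n _ => ?_
  congr 1
  have : ((a : ZMod q) * (n : ZMod q)) = (((a * n : ℕ) : ℤ) : ZMod q) := by push_cast; rfl
  rw [this, ZMod.stdAddChar_coe]
  congr 1
  push_cast
  ring

lemma gauss_shift {χ : DirichletCharacter ℂ q} (hχ : χ ≠ 1) (n : ZMod q) :
    gaussSum χ⁻¹ ((ZMod.stdAddChar (N := q)).mulShift n) = χ n * gaussSum χ⁻¹ ZMod.stdAddChar := by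
  have hχ' : χ⁻¹ ≠ 1 := by simpa using hχ
  by_cases hn : n = 0
  · subst hn
    rw [AddChar.mulShift_zero, gaussSum_one_right hχ']
    rw [MulChar.map_zero, zero_mul]
  · have := gaussSum_mulShift_eq χ⁻¹ (ZMod.stdAddChar (N := q)) (Units.mk0 n hn)
    simpa using this

lemma gauss_norm {χ : DirichletCharacter ℂ q} (hχ : χ ≠ 1) :
    ‖gaussSum χ (ZMod.stdAddChar (N := q))‖ ^ 2 = q := by
  have h := gaussSum_mul_gaussSum_eq_card hχ (ZMod.isPrimitive_stdAddChar q)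
  rw [← star_gaussSum_eq, ZMod.card] at h
  have h2 : ((‖gaussSum χ (ZMod.stdAddChar (N := q))‖ ^ 2 : ℝ) : ℂ) = ((q:ℝ):ℂ) := by
    push_cast
    rw [← Complex.mul_conj']
    exact h
  exact_mod_cast h2

lemma char_sum_eq {χ : DirichletCharacter ℂ q} (hχ : χ ≠ 1) (N : ℕ) (c : ℕ → ℂ) :
    (q:ℝ) * ‖∑ n ∈ range (N + 1), c n * χ (n : ZMod q)‖ ^ 2 = ‖∑ a : ZMod q, χ⁻¹ a * FF N c a‖ ^ 2 := by
  have hχ' : χ⁻¹ ≠ 1 := by simpa using hχ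
  rw [← gauss_norm hχ', ← mul_pow, ← norm_mul]
  congr 2
  unfold FF
  simp_rw [mul_sum]
  rw [sum_comm]
  refine sum_congr rfl fun n _ => ?_
  have := gauss_shift hχ (n : ZMod q)
  calc _ = c n * (χ n * gaussSum χ⁻¹ ZMod.stdAddChar) := by ring
    _ = c n * gaussSum χ⁻¹ ((ZMod.stdAddChar (N := q)).mulShift n) := by rw [this]
    _ = _ := by
      rw [gaussSum, mul_sum]
      refine sum_congr rfl fun a _ => ?_
      rw [AddChar.mulShift_apply, mul_comm (n : ZMod q) a]
      ring

lemma char_parseval (F : ZMod q → ℂ) :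
    ∑ χ : DirichletCharacter ℂ q, ‖∑ a : ZMod q, χ⁻¹ a * F a‖ ^ 2 =
      (q.totient : ℝ) * ∑ a ∈ univ.filter (fun a : ZMod q => a ≠ 0), ‖F a‖ ^ 2 := by
  have h : ((∑ χ : DirichletCharacter ℂ q, ‖∑ a : ZMod q, χ⁻¹ a * F a‖ ^ 2 : ℝ) : ℂ) =
      (((q.totient : ℝ) * ∑ a ∈ univ.filter (fun a : ZMod q => a ≠ 0), ‖F a‖ ^ 2 : ℝ) : ℂ) := by
    push_cast
    have h1 : ∀ χ : DirichletCharacter ℂ q, (‖∑ a : ZMod q, χ⁻¹ a * F a‖ : ℂ) ^ 2 =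
        ∑ a : ZMod q, ∑ b : ZMod q, (F a * (starRingEnd ℂ) (F b)) * (χ a⁻¹ * χ b) := by
      intro χ
      rw [← Complex.mul_conj', map_sum, sum_mul_sum]
      refine sum_congr rfl fun a _ => sum_congr rfl fun b _ => ?_
      rw [map_mul]
      have e1 : χ⁻¹ a = χ a⁻¹ := MulChar.inv_apply' χ a
      have e2 : (starRingEnd ℂ) (χ⁻¹ b) = χ b := by
        have := MulChar.star_apply χ⁻¹ b
        rw [MulChar.star_eq_inv, inv_inv] at this
        exact this.symm
      rw [e1, e2]; ring
    simp_rw [h1]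
    rw [sum_comm]
    simp_rw [sum_comm (s := (univ : Finset (DirichletCharacter ℂ q))), ← mul_sum]
    rw [mul_sum, sum_filter]
    refine sum_congr rfl fun a _ => ?_
    split_ifs with ha
    · have hu : IsUnit a := isUnit_iff_ne_zero.2 ha
      simp_rw [DirichletCharacter.sum_char_inv_mul_char_eq ℂ hu]
      rw [sum_eq_single a]
      · rw [if_pos rfl, ← Complex.mul_conj']; ring
      · intro b _ hb; rw [if_neg hb.symm, mul_zero]
      · simp
    · have : a = 0 := by simpa using ha
      subst this
      have h0 : ∀ χ : DirichletCharacter ℂ q, χ (0:ZMod q) = 0 := fun χ => MulChar.map_zero χ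
      simp [h0]
  exact_mod_cast h

lemma one_mod (N : ℕ) (c : ℕ → ℂ) :
    ∑ χ ∈ nt q, ‖∑ n ∈ range (N + 1), c n * χ (n : ZMod q)‖ ^ 2 ≤
      ∑ a ∈ Ico 1 q, ‖trig N c ((a:ℝ) / q)‖ ^ 2 := by
  classical
  have hq0 : 0 < (q:ℝ) := by exact_mod_cast hq.out.pos
  have h1 : (q:ℝ) * ∑ χ ∈ nt q, ‖∑ n ∈ range (N + 1), c n * χ (n : ZMod q)‖ ^ 2 ≤
      (q:ℝ) * ∑ a ∈ univ.filter (fun a : ZMod q => a ≠ 0), ‖FF N c a‖ ^ 2 := by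
    rw [mul_sum]
    calc _ = ∑ χ ∈ nt q, ‖∑ a : ZMod q, χ⁻¹ a * FF N c a‖ ^ 2 :=
          sum_congr rfl fun χ hχ => char_sum_eq (ne_one_of_mem_nt hχ) N c
      _ ≤ ∑ χ : DirichletCharacter ℂ q, ‖∑ a : ZMod q, χ⁻¹ a * FF N c a‖ ^ 2 :=
          sum_le_sum_of_subset_of_nonneg (subset_univ _) fun _ _ _ => by positivity
      _ = _ := char_parseval _
      _ ≤ _ := by
          gcongr
          exact_mod_cast Nat.totient_le q
  have h2 := le_of_mul_le_mul_left h1 hq0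
  refine h2.trans (le_of_eq ?_)
  symm
  refine sum_bij (fun a _ => (a : ZMod q)) ?_ ?_ ?_ ?_
  · intro a ha
    rw [mem_Ico] at ha
    rw [mem_filter]
    refine ⟨mem_univ _, ?_⟩
    rw [Ne, ZMod.natCast_eq_zero_iff]
    exact Nat.not_dvd_of_pos_of_lt ha.1 ha.2
  · intro a ha b hb hab
    rw [mem_Ico] at ha hb
    rw [ZMod.natCast_eq_natCast_iff] at hab
    exact Nat.ModEq.eq_of_lt_of_lt hab ha.2 hb.2
  · intro a ha
    rw [mem_filter] at ha
    refine ⟨a.val, ?_, ?_⟩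
    · rw [mem_Ico]
      refine ⟨Nat.pos_of_ne_zero ?_, ZMod.val_lt a⟩
      rw [Ne, ZMod.val_eq_zero]; exact ha.2
    · simp
  · intro a _
    rw [FF_eq_trig]

end

lemma mult_ls (S : Finset ℕ) (Q : ℕ) (hS : ∀ q ∈ S, q.Prime ∧ q ≤ Q) (N : ℕ) (c : ℕ → ℂ) :
    ∑ q ∈ S, ∑ χ ∈ nt q, ‖∑ n ∈ range (N + 1), c n * χ (n : ZMod q)‖ ^ 2 ≤
      100 * ((N:ℝ) + (Q:ℝ) ^ 2) * ∑ n ∈ range (N + 1), ‖c n‖ ^ 2 := by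
  rcases S.eq_empty_or_nonempty with rfl | ⟨q0, hq0⟩
  · simp only [sum_empty]; positivity
  have hQ : 2 ≤ Q := (hS q0 hq0).1.two_le.trans (hS q0 hq0).2
  have hQr : (2:ℝ) ≤ Q := by exact_mod_cast hQ
  have h1 : ∑ q ∈ S, ∑ χ ∈ nt q, ‖∑ n ∈ range (N + 1), c n * χ (n : ZMod q)‖ ^ 2 ≤
      ∑ q ∈ S, ∑ a ∈ Ico 1 q, ‖trig N c ((a:ℝ) / q)‖ ^ 2 := by
    refine sum_le_sum fun q hq => ?_
    have : Fact q.Prime := ⟨(hS q hq).1⟩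
    exact one_mod N c
  refine h1.trans ?_
  rw [sum_sigma']
  set δ : ℝ := 1 / ((N:ℝ) + (Q:ℝ) ^ 2) with hδdef
  have hNQ : 0 < (N:ℝ) + (Q:ℝ) ^ 2 := by positivity
  have hδ : 0 < δ := by positivity
  have hδQ : δ ≤ 1 / (Q:ℝ) ^ 2 := by
    apply one_div_le_one_div_of_le (by positivity); linarith [Nat.cast_nonneg (α := ℝ) N]
  have hδQ' : δ / 2 ≤ 1 / (Q:ℝ) := by
    have : 1 / (Q:ℝ) ^ 2 ≤ 1 / (Q:ℝ) := by
      apply one_div_le_one_div_of_le (by positivity); nlinarith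
    linarith
  have := additive_ls (S.sigma fun q => Ico 1 q) (fun p => (p.2:ℝ) / p.1) N c hδ ?_ ?_ ?_
  · refine this.trans ?_
    gcongr
    have e : 2 / δ = 2 * ((N:ℝ) + (Q:ℝ) ^ 2) := by rw [hδdef]; field_simp
    rw [e]
    have hpi : Real.pi ^ 2 ≤ 10 := by nlinarith [Real.pi_lt_d2, Real.pi_pos]
    have h3 : δ * (N:ℝ) ^ 2 ≤ (N:ℝ) + (Q:ℝ) ^ 2 := by
      rw [hδdef, div_mul_eq_mul_div, one_mul, div_le_iff₀ hNQ]
      have : (0:ℝ) ≤ N := Nat.cast_nonneg _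
      nlinarith [sq_nonneg (Q:ℝ)]
    have h4 : 0 ≤ δ * (N:ℝ) ^ 2 := by positivity
    nlinarith
  · rintro ⟨q, a⟩ h
    simp only [mem_sigma, mem_Ico] at h
    obtain ⟨hq, ha1, ha2⟩ := h
    have hqQ : (q:ℝ) ≤ Q := by exact_mod_cast (hS q hq).2
    have hqp : (0:ℝ) < q := by exact_mod_cast (hS q hq).1.pos
    have : 1 / (Q:ℝ) ≤ 1 / q := one_div_le_one_div_of_le hqp hqQ
    have h5 : 1 / (q:ℝ) ≤ a / q := by gcongr; exact_mod_cast ha1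
    simp only
    linarith
  · rintro ⟨q, a⟩ h
    simp only [mem_sigma, mem_Ico] at h
    obtain ⟨hq, ha1, ha2⟩ := h
    have hqQ : (q:ℝ) ≤ Q := by exact_mod_cast (hS q hq).2
    have hqp : (0:ℝ) < q := by exact_mod_cast (hS q hq).1.pos
    have : 1 / (Q:ℝ) ≤ 1 / q := one_div_le_one_div_of_le hqp hqQ
    have h5 : (a:ℝ) / q ≤ 1 - 1 / q := by
      have : (a:ℝ) + 1 ≤ q := by exact_mod_cast ha2
      rw [div_le_iff₀ hqp, sub_mul, div_mul_cancel₀ _ hqp.ne']; linarith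
    simp only
    linarith
  · rintro ⟨q, a⟩ h ⟨q', a'⟩ h' hne
    simp only [mem_sigma, mem_Ico] at h h'
    obtain ⟨hq, ha1, ha2⟩ := h
    obtain ⟨hq', ha1', ha2'⟩ := h'
    have hqQ : (q:ℝ) ≤ Q := by exact_mod_cast (hS q hq).2
    have hqp : (0:ℝ) < q := by exact_mod_cast (hS q hq).1.pos
    have hqQ' : (q':ℝ) ≤ Q := by exact_mod_cast (hS q' hq').2
    have hqp' : (0:ℝ) < q' := by exact_mod_cast (hS q' hq').1.pos
    simp only
    have e : (a:ℝ) / q - a' / q' = (((a:ℤ) * q' - a' * q : ℤ) : ℝ) / (q * q') := by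
      push_cast; field_simp
    rw [e, abs_div, abs_of_pos (mul_pos hqp hqp')]
    have hz : ((a:ℤ) * q' - a' * q : ℤ) ≠ 0 := by
      intro hz
      have hz' : a * q' = a' * q := by
        have : (a:ℤ) * q' = a' * q := by linarith
        exact_mod_cast this
      by_cases hqq : q = q'
      · subst hqq
        have := Nat.eq_of_mul_eq_mul_right (hS q hq).1.pos hz'
        subst this
        exact hne rfl
      · have hcop : Nat.Coprime q q' := (Nat.coprime_primes (hS q hq).1 (hS q' hq').1).2 hqq
        have : q ∣ a * q' := ⟨a', by rw [hz']; ring⟩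
        have := hcop.dvd_of_dvd_mul_right this
        exact Nat.not_dvd_of_pos_of_lt ha1 ha2 this
    have hab : (1:ℝ) ≤ |(((a:ℤ) * q' - a' * q : ℤ) : ℝ)| := by
      exact_mod_cast Int.one_le_abs hz
    calc δ ≤ 1 / (Q:ℝ) ^ 2 := hδQ
      _ ≤ 1 / (q * q') := by
        apply one_div_le_one_div_of_le (by positivity)
        rw [sq]; gcongr
      _ ≤ _ := by gcongr

end BVC

namespace BVC
open Finset MeasureTheory

lemma conv_sum {E : Type*} [AddCommMonoid E] [Module ℝ E] (f g : ArithmeticFunction ℝ) (Y : ℕ)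
    (h : ℕ → E) (hh : ∀ n, Y < n → h n = 0) :
    ∑ n ∈ Ioc 0 Y, (f * g) n • h n = ∑ d ∈ Ioc 0 Y, ∑ k ∈ Ioc 0 Y, (f d * g k) • h (d * k) := by
  have h1 : ∀ n ∈ Ioc 0 Y, (f * g) n • h n =
      ∑ p ∈ Ioc 0 Y ×ˢ Ioc 0 Y, if p.1 * p.2 = n then (f p.1 * g p.2) • h (p.1 * p.2) else 0 := by
    intro n hn
    rw [mem_Ioc] at hn
    rw [ArithmeticFunction.mul_apply, sum_smul, ← sum_filter]
    have : n.divisorsAntidiagonal = (Ioc 0 Y ×ˢ Ioc 0 Y).filter (fun x ↦ x.1 * x.2 = n) :=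
      Nat.divisorsAntidiagonal_eq_prod_filter_of_le (by omega) hn.2
    rw [← this]
    refine sum_congr rfl fun p hp => ?_
    rw [(Nat.mem_divisorsAntidiagonal.1 hp).1]
  rw [sum_congr rfl h1, sum_comm, sum_product]
  refine sum_congr rfl fun d hd => sum_congr rfl fun k hk => ?_
  rw [mem_Ioc] at hd hk
  simp only
  by_cases hdk : d * k ≤ Y
  · rw [sum_ite_eq, if_pos]
    rw [mem_Ioc]
    exact ⟨Nat.mul_pos hd.1 hk.1, hdk⟩
  · rw [hh _ (not_le.1 hdk), smul_zero]
    simp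

/-- harmonic bound -/
lemma harm_le (M : ℕ) : ∑ i ∈ Ioc 0 M, (1:ℝ) / i ≤ 1 + Real.log M := by
  have h := harmonic_le_one_add_log M
  rw [harmonic_eq_sum_Icc] at h
  push_cast at h
  have e : Ioc 0 M = Icc 1 M := by ext; simp [Nat.succ_le_iff]
  rw [e]
  simpa [one_div] using h

noncomputable def zR : ArithmeticFunction ℝ := (ArithmeticFunction.zeta : ArithmeticFunction ℝ)

lemma zR_apply {n : ℕ} (hn : n ≠ 0) : zR n = 1 := by
  simp [zR, ArithmeticFunction.natCoe_apply, ArithmeticFunction.zeta_apply, hn]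

lemma zz_apply (n : ℕ) : (zR * zR) n = (n.divisors.card : ℝ) := by
  rw [zR, ArithmeticFunction.coe_mul_zeta_apply]
  rw [card_eq_sum_ones, Nat.cast_sum]
  refine sum_congr rfl fun d hd => ?_
  have : d ≠ 0 := (Nat.pos_of_mem_divisors hd).ne'
  simp [ArithmeticFunction.zeta_apply, this]

lemma card_div_mul_le (m n : ℕ) : (m * n).divisors.card ≤ m.divisors.card * n.divisors.card := by
  classical
  rw [Nat.divisors_mul]
  exact Finset.card_mul_le

lemma div_sq (M : ℕ) : ∑ m ∈ Ioc 0 M, ((m.divisors.card : ℝ)) ^ 2 ≤ M * (1 + Real.log M) ^ 3 := by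
  set d : ℕ → ℝ := fun m => (m.divisors.card : ℝ) with hd
  have hd0 : ∀ m, 0 ≤ d m := fun m => Nat.cast_nonneg _
  set H := ∑ i ∈ Ioc 0 M, (1:ℝ) / i with hH
  have hH0 : 0 ≤ H := sum_nonneg fun i _ => by positivity
  have hHl := harm_le M
  have key : ∀ h : ℕ → ℝ, (∀ n, M < n → h n = 0) → ∑ n ∈ Ioc 0 M, d n * h n =
      ∑ a ∈ Ioc 0 M, ∑ k ∈ Ioc 0 M, h (a * k) := by
    intro h hh
    have := conv_sum zR zR M h hh
    simp_rw [zz_apply, smul_eq_mul] at this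
    rw [this]
    refine sum_congr rfl fun a ha => sum_congr rfl fun k hk => ?_
    rw [mem_Ioc] at ha hk
    rw [zR_apply (by omega), zR_apply (by omega)]; ring
  have s1 : ∑ m ∈ Ioc 0 M, d m ^ 2 = ∑ a ∈ Ioc 0 M, ∑ k ∈ Ioc 0 M, (if a * k ≤ M then d (a * k) else 0) := by
    rw [← key (fun n => if n ≤ M then d n else 0) (fun n hn => if_neg (by omega))]
    refine sum_congr rfl fun m hm => ?_
    rw [mem_Ioc] at hm
    rw [if_pos hm.2, sq]
  have s2 : ∀ a ∈ Ioc 0 M, ∑ k ∈ Ioc 0 M, (if a * k ≤ M then d (a * k) else 0) ≤ d a * (M / a * H) := by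
    intro a ha
    rw [mem_Ioc] at ha
    have hapos : (0:ℝ) < a := by exact_mod_cast ha.1
    calc _ ≤ ∑ k ∈ Ioc 0 M, d a * (d k * (if a * k ≤ M then 1 else 0)) := by
          refine sum_le_sum fun k _ => ?_
          split_ifs
          · have := card_div_mul_le a k
            simp only [mul_one]
            show ((a * k).divisors.card : ℝ) ≤ (a.divisors.card : ℝ) * (k.divisors.card : ℝ)
            exact_mod_cast this
          · simp
      _ = d a * ∑ i ∈ Ioc 0 M, ∑ j ∈ Ioc 0 M, (if a * (i * j) ≤ M then 1 else 0) := by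
          rw [← mul_sum, key]
          intro n hn
          rw [if_neg]
          have : n ≤ a * n := Nat.le_mul_of_pos_left _ ha.1
          omega
      _ ≤ _ := by
          gcongr
          rw [hH, mul_sum]
          refine sum_le_sum fun i hi => ?_
          rw [mem_Ioc] at hi
          have hipos : (0:ℝ) < i := by exact_mod_cast hi.1
          rw [← sum_filter, sum_const, nsmul_eq_mul, mul_one]
          have sub : (Ioc 0 M).filter (fun j => a * (i * j) ≤ M) ⊆ Ioc 0 (M / (a * i)) := by
            intro j hj
            rw [mem_filter, mem_Ioc] at hj
            rw [mem_Ioc]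
            refine ⟨hj.1.1, ?_⟩
            rw [Nat.le_div_iff_mul_le (Nat.mul_pos ha.1 hi.1)]
            calc j * (a * i) = a * (i * j) := by ring
              _ ≤ M := hj.2
          have := card_le_card sub
          rw [Nat.card_Ioc, Nat.sub_zero] at this
          calc _ ≤ ((M / (a * i) : ℕ) : ℝ) := by exact_mod_cast this
            _ ≤ (M:ℝ) / ((a * i : ℕ) : ℝ) := Nat.cast_div_le
            _ = _ := by push_cast; field_simp
  have s3 : ∑ a ∈ Ioc 0 M, d a * (1 / a) ≤ H * H := by
    calc _ = ∑ a ∈ Ioc 0 M, d a * (if a ≤ M then 1 / (a:ℝ) else 0) := by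
          refine sum_congr rfl fun m hm => ?_
          rw [mem_Ioc] at hm
          rw [if_pos hm.2]
      _ = ∑ b ∈ Ioc 0 M, ∑ c ∈ Ioc 0 M, (if b * c ≤ M then 1 / ((b * c : ℕ):ℝ) else 0) :=
          key (fun a => if a ≤ M then 1 / (a:ℝ) else 0) (fun n hn => if_neg (by omega))
      _ ≤ ∑ b ∈ Ioc 0 M, ∑ c ∈ Ioc 0 M, (1 / (b:ℝ)) * (1 / c) := by
          refine sum_le_sum fun b _ => sum_le_sum fun c _ => ?_
          split_ifs
          · push_cast; apply le_of_eq; rw [div_mul_div_comm, one_mul]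
          · positivity
      _ = H * H := by rw [sum_mul_sum]
  calc ∑ m ∈ Ioc 0 M, d m ^ 2 ≤ ∑ a ∈ Ioc 0 M, d a * (M / a * H) := by rw [s1]; exact sum_le_sum s2
    _ = M * H * ∑ a ∈ Ioc 0 M, d a * (1 / a) := by
        rw [mul_sum]; refine sum_congr rfl fun a _ => by ring
    _ ≤ M * H * (H * H) := by gcongr
    _ = M * H ^ 3 := by ring
    _ ≤ _ := by gcongr

lemma abel_id (f : ℕ → ℝ) (c : ℕ → ℂ) (n : ℕ) :
    ∑ k ∈ Ioc 0 (n + 1), (f k : ℂ) * c k = f (n + 1) * ∑ k ∈ Ioc 0 (n + 1), c k +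
      ∑ k ∈ Ioc 0 n, ((f k - f (k + 1) : ℝ) : ℂ) * ∑ j ∈ Ioc 0 k, c j := by
  induction n with
  | zero => simp
  | succ n ih =>
    have e1 : ∀ g : ℕ → ℂ, ∀ m : ℕ, ∑ k ∈ Ioc 0 (m + 1), g k = ∑ k ∈ Ioc 0 m, g k + g (m + 1) :=
      fun g m => sum_Ioc_succ_top (Nat.zero_le m) g
    rw [e1 (fun k => (f k : ℂ) * c k) (n + 1), ih, e1 c (n + 1),
      e1 (fun k => ((f k - f (k + 1) : ℝ) : ℂ) * ∑ j ∈ Ioc 0 k, c j) n]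
    push_cast
    ring

lemma abel_anti (f : ℕ → ℝ) (c : ℕ → ℂ) (B : ℝ) (hB : ∀ n, ‖∑ k ∈ Ioc 0 n, c k‖ ≤ B)
    (hf0 : ∀ n, 0 ≤ f n) (hf : ∀ n, 0 < n → f (n + 1) ≤ f n) (n : ℕ) :
    ‖∑ k ∈ Ioc 0 n, (f k : ℂ) * c k‖ ≤ B * f 1 := by
  have hB0 : 0 ≤ B := (norm_nonneg _).trans (hB 0)
  rcases n with _ | n
  · simp only [Ioc_self, sum_empty, norm_zero]; exact mul_nonneg hB0 (hf0 1)
  rw [abel_id]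
  have tel : ∀ n, ∑ k ∈ Ioc 0 n, (f k - f (k + 1)) = f 1 - f (n + 1) := by
    intro n
    induction n with
    | zero => simp
    | succ n ih => rw [sum_Ioc_succ_top (by omega), ih]; ring
  calc _ ≤ f (n + 1) * B + ∑ k ∈ Ioc 0 n, (f k - f (k + 1)) * B := by
        refine (norm_add_le _ _).trans (add_le_add ?_ ?_)
        · rw [norm_mul, Complex.norm_real, Real.norm_of_nonneg (hf0 _)]
          exact mul_le_mul_of_nonneg_left (hB _) (hf0 _)
        · refine norm_sum_le_of_le _ fun k hk => ?_
          rw [mem_Ioc] at hk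
          have := sub_nonneg.2 (hf k hk.1)
          rw [norm_mul, Complex.norm_real, Real.norm_of_nonneg this]
          exact mul_le_mul_of_nonneg_left (hB _) this
    _ = B * f 1 := by rw [← sum_mul, tel]; ring

lemma abel_mono (f : ℕ → ℝ) (c : ℕ → ℂ) (B : ℝ) (hB : ∀ n, ‖∑ k ∈ Ioc 0 n, c k‖ ≤ B)
    (hf0 : ∀ n, 0 ≤ f n) (hf : ∀ n, f n ≤ f (n + 1)) (n : ℕ) :
    ‖∑ k ∈ Ioc 0 n, (f k : ℂ) * c k‖ ≤ 2 * B * f n := by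
  have hB0 : 0 ≤ B := (norm_nonneg _).trans (hB 0)
  rcases n with _ | n
  · simp only [Ioc_self, sum_empty, norm_zero]; have := hf0 0; positivity
  rw [abel_id]
  have tel : ∀ n, ∑ k ∈ Ioc 0 n, (f (k + 1) - f k) = f (n + 1) - f 1 := by
    intro n
    induction n with
    | zero => simp
    | succ n ih => rw [sum_Ioc_succ_top (by omega), ih]; ring
  calc _ ≤ f (n + 1) * B + ∑ k ∈ Ioc 0 n, (f (k + 1) - f k) * B := by
        refine (norm_add_le _ _).trans (add_le_add ?_ ?_)
        · rw [norm_mul, Complex.norm_real, Real.norm_of_nonneg (hf0 _)]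
          exact mul_le_mul_of_nonneg_left (hB _) (hf0 _)
        · refine norm_sum_le_of_le _ fun k hk => ?_
          have := sub_nonneg.2 (hf k)
          rw [norm_mul, Complex.norm_real, Real.norm_eq_abs, abs_sub_comm, abs_of_nonneg this]
          exact mul_le_mul_of_nonneg_left (hB _) this
    _ = B * (f (n + 1) + (f (n + 1) - f 1)) := by rw [← sum_mul, tel]; ring
    _ ≤ _ := by nlinarith [mul_nonneg hB0 (hf0 1)]

lemma char_partial {q : ℕ} [hq : NeZero q] {χ : DirichletCharacter ℂ q} (hχ : χ ≠ 1) (n : ℕ) :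
    ‖∑ k ∈ range n, χ (k : ZMod q)‖ ≤ q := by
  have hfull : ∑ k ∈ range q, χ (k : ZMod q) = 0 := by
    rw [← MulChar.sum_eq_zero_of_ne_one hχ]
    refine sum_bij (fun a _ => (a : ZMod q)) (fun _ _ => mem_univ _) ?_ ?_ (fun _ _ => rfl)
    · intro a ha b hb hab
      rw [mem_range] at ha hb
      rw [ZMod.natCast_eq_natCast_iff] at hab
      exact Nat.ModEq.eq_of_lt_of_lt hab ha hb
    · intro a _
      exact ⟨a.val, mem_range.2 (ZMod.val_lt a), by simp⟩
  induction n using Nat.strong_induction_on with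
  | _ n ih =>
    by_cases h : n < q
    · refine (norm_sum_le _ _).trans ?_
      refine (sum_le_sum fun k _ => DirichletCharacter.norm_le_one χ _).trans ?_
      simp only [sum_const, card_range, nsmul_eq_mul, mul_one]
      exact_mod_cast h.le
    · obtain ⟨m, rfl⟩ := Nat.exists_eq_add_of_le (not_lt.1 h)
      rw [sum_range_add, hfull, zero_add]
      have := ih m (by have := Nat.pos_of_ne_zero hq.out; omega)
      simpa using this

lemma char_partial' {q : ℕ} (hq : 1 < q) {χ : DirichletCharacter ℂ q} (hχ : χ ≠ 1) (n : ℕ) :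
    ‖∑ k ∈ Ioc 0 n, χ (k : ZMod q)‖ ≤ q := by
  have : NeZero q := ⟨by omega⟩
  have h := char_partial hχ (n + 1)
  have : Nontrivial (ZMod q) := by have : Fact (1 < q) := ⟨hq⟩; infer_instance
  have e : ∑ k ∈ range (n + 1), χ (k : ZMod q) = ∑ k ∈ Ioc 0 n, χ (k : ZMod q) := by
    clear h
    induction n with
    | zero => simpa using χ.map_nonunit (by simp)
    | succ n ih => rw [sum_range_succ, ih, sum_Ioc_succ_top (Nat.zero_le n)]
  rwa [e] at h

end BVC

namespace BVC
open Finset MeasureTheory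

/-- truncation to arguments at most `U` -/
noncomputable def cutLow (f : ArithmeticFunction ℝ) (U : ℕ) : ArithmeticFunction ℝ :=
  ⟨fun n => if n ≤ U then f n else 0, by simp⟩

noncomputable def cutHigh (f : ArithmeticFunction ℝ) (U : ℕ) : ArithmeticFunction ℝ :=
  ⟨fun n => if n ≤ U then 0 else f n, by simp⟩

lemma cutLow_apply (f : ArithmeticFunction ℝ) (U n : ℕ) : cutLow f U n = if n ≤ U then f n else 0 := rfl
lemma cutHigh_apply (f : ArithmeticFunction ℝ) (U n : ℕ) : cutHigh f U n = if n ≤ U then 0 else f n := rfl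

lemma cut_add (f : ArithmeticFunction ℝ) (U : ℕ) : f = cutLow f U + cutHigh f U := by
  ext n
  rw [ArithmeticFunction.add_apply, cutLow_apply, cutHigh_apply]
  split_ifs <;> simp

noncomputable def muR : ArithmeticFunction ℝ := (ArithmeticFunction.moebius : ArithmeticFunction ℝ)

lemma muR_abs (n : ℕ) : |muR n| ≤ 1 := by
  rw [muR, ArithmeticFunction.intCoe_apply]
  have := ArithmeticFunction.abs_moebius_le_one (n := n)
  exact_mod_cast this

noncomputable abbrev vM : ArithmeticFunction ℝ := ArithmeticFunction.vonMangoldt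

lemma vaughan (U : ℕ) : vM = cutLow vM U + cutLow muR U * ArithmeticFunction.log
    - cutLow vM U * (cutLow muR U * zR) + (zR * cutHigh muR U) * cutHigh vM U := by
  have h1 : vM * zR = ArithmeticFunction.log := ArithmeticFunction.vonMangoldt_mul_zeta
  have h2 : zR * muR = 1 := ArithmeticFunction.coe_zeta_mul_coe_moebius
  have h3 := cut_add vM U
  have h4 := cut_add muR U
  rw [← h1]
  calc vM = cutLow vM U + cutHigh vM U * 1 := by rw [mul_one, ← h3]
    _ = cutLow vM U + cutHigh vM U * (zR * (cutLow muR U + cutHigh muR U)) := by rw [← h4, h2]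
    _ = cutLow vM U + cutLow muR U * ((cutLow vM U + cutHigh vM U) * zR)
    - cutLow vM U * (cutLow muR U * zR) + (zR * cutHigh muR U) * cutHigh vM U := by ring
    _ = _ := by rw [← h3]

lemma pl_le_log {y : ℝ} (hy : 1 ≤ y) (n : ℕ) : Real.posLog (y / n) ≤ Real.log y := by
  rw [Real.posLog, max_le_iff]
  refine ⟨Real.log_nonneg hy, ?_⟩
  rcases Nat.eq_zero_or_pos n with rfl | hn
  · simpa using Real.log_nonneg hy
  · have : (1:ℝ) ≤ n := by exact_mod_cast hn
    apply Real.log_le_log (by positivity)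
    exact div_le_self (by linarith) this

lemma pl_anti {y : ℝ} (hy : 0 < y) {m n : ℕ} (hm : 0 < m) (hmn : m ≤ n) :
    Real.posLog (y / n) ≤ Real.posLog (y / m) := by
  have : (0:ℝ) < m := by exact_mod_cast hm
  have h2 : (m:ℝ) ≤ n := by exact_mod_cast hmn
  rw [Real.posLog, Real.posLog]
  apply max_le_max le_rfl
  have h3 : (0:ℝ) < n := lt_of_lt_of_le this h2
  apply Real.log_le_log (by positivity)
  gcongr

lemma pl_zero {y : ℝ} (hy : 0 ≤ y) {n : ℕ} (hn : ⌊y⌋₊ < n) : Real.posLog (y / n) = 0 := by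
  rw [Real.posLog_eq_zero_iff]
  have hn0 : (0:ℝ) < n := by exact_mod_cast (Nat.zero_le _).trans_lt hn
  rw [abs_of_nonneg (by positivity), div_le_one hn0]
  exact ((Nat.floor_lt hy).1 hn).le

/-- the smoothed character sum -/
noncomputable def W {q : ℕ} (y : ℝ) (χ : DirichletCharacter ℂ q) : ℂ :=
  ∑ n ∈ Ioc 0 ⌊y⌋₊, vM n • (χ (n : ZMod q) * (Real.posLog (y / n) : ℂ))

section typeI
variable {q : ℕ} (χ : DirichletCharacter ℂ q)

noncomputable def hh (y : ℝ) (n : ℕ) : ℂ := χ (n : ZMod q) * (Real.posLog (y / n) : ℂ)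

lemma hh_zero {y : ℝ} (hy : 0 ≤ y) (n : ℕ) (hn : ⌊y⌋₊ < n) : hh χ y n = 0 := by
  rw [hh, pl_zero hy hn]; simp

lemma hh_norm {y : ℝ} (hy : 1 ≤ y) (n : ℕ) : ‖hh χ y n‖ ≤ Real.log y := by
  rw [hh, norm_mul, Complex.norm_real, Real.norm_of_nonneg Real.posLog_nonneg]
  have h1 := DirichletCharacter.norm_le_one χ (n : ZMod q)
  have h2 := pl_le_log hy n
  have h3 : 0 ≤ Real.posLog (y / n) := Real.posLog_nonneg
  nlinarith [norm_nonneg (χ (n : ZMod q))]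

lemma hh_mul (y : ℝ) (d k : ℕ) : hh χ y (d * k) = χ (d : ZMod q) * hh χ (y / d) k := by
  rw [hh, hh]
  push_cast
  rw [map_mul, div_div]
  ring

variable {χ}

lemma inner_partial (hq : 1 < q) (hχ : χ ≠ 1) {y : ℝ} (hy : 1 ≤ y) {d : ℕ} (hd : 0 < d) (n : ℕ) :
    ‖∑ k ∈ Ioc 0 n, hh χ (y / d) k‖ ≤ q * Real.log y := by
  have hd' : (0:ℝ) < d := by exact_mod_cast hd
  have h := abel_anti (fun k => Real.posLog (y / d / k)) (fun k => χ (k : ZMod q)) q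
    (char_partial' hq hχ) (fun _ => Real.posLog_nonneg)
    (fun m hm => pl_anti (by positivity) hm (Nat.le_succ m)) n
  have e : ∑ k ∈ Ioc 0 n, hh χ (y / d) k = ∑ k ∈ Ioc 0 n, (Real.posLog (y / d / k) : ℂ) * χ (k : ZMod q) :=
    sum_congr rfl fun k _ => mul_comm _ _
  rw [e]
  refine h.trans ?_
  have := pl_le_log hy d
  simp only [Nat.cast_one, div_one]
  gcongr

lemma vM_le {y : ℝ} (hy : 1 ≤ y) {n : ℕ} (hn : n ∈ Ioc 0 ⌊y⌋₊) : vM n ≤ Real.log y := by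
  rw [mem_Ioc] at hn
  have h1 : (n:ℝ) ≤ y := (Nat.le_floor_iff (by linarith)).1 hn.2
  have h0 : (0:ℝ) < n := by exact_mod_cast hn.1
  exact (ArithmeticFunction.vonMangoldt_le_log).trans (Real.log_le_log h0 h1)

lemma sum_ite_le (s U : ℕ) (B : ℝ) (hB : 0 ≤ B) : ∑ n ∈ Ioc 0 s, (if n ≤ U then B else 0) ≤ U * B := by
  rw [← sum_filter, sum_const, nsmul_eq_mul]
  gcongr
  have : (Ioc 0 s).filter (fun n => n ≤ U) ⊆ Ioc 0 U := by
    intro n; simp; tauto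
  simpa using card_le_card this

lemma norm_ite_le (s U : ℕ) (B : ℝ) (hB : 0 ≤ B) (f : ℕ → ℂ)
    (hf : ∀ n ∈ Ioc 0 s, ‖f n‖ ≤ if n ≤ U then B else 0) : ‖∑ n ∈ Ioc 0 s, f n‖ ≤ U * B :=
  ((norm_sum_le _ _).trans (sum_le_sum hf)).trans (sum_ite_le s U B hB)

lemma T0_bound {y : ℝ} (hy : 1 ≤ y) (U : ℕ) :
    ‖∑ n ∈ Ioc 0 ⌊y⌋₊, cutLow vM U n • hh χ y n‖ ≤ U * (Real.log y * Real.log y) := by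
  have hl := Real.log_nonneg hy
  refine norm_ite_le _ U _ (by positivity) _ fun n hn => ?_
  rw [cutLow_apply]
  split_ifs
  · rw [norm_smul, Real.norm_of_nonneg ArithmeticFunction.vonMangoldt_nonneg]
    exact mul_le_mul (vM_le hy hn) (hh_norm χ hy n) (norm_nonneg _) hl
  · simp

lemma T1_bound (hq : 1 < q) (hχ : χ ≠ 1) {y : ℝ} (hy : 1 ≤ y) (U : ℕ) :
    ‖∑ n ∈ Ioc 0 ⌊y⌋₊, (cutLow muR U * ArithmeticFunction.log) n • hh χ y n‖ ≤
      U * (2 * (q * Real.log y) * Real.log y) := by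
  have hl := Real.log_nonneg hy
  rw [conv_sum _ _ _ _ (hh_zero χ (by linarith))]
  refine norm_ite_le _ U _ (by positivity) _ fun d hd => ?_
  rw [mem_Ioc] at hd
  rw [cutLow_apply]
  split_ifs with h
  · have e : ∑ k ∈ Ioc 0 ⌊y⌋₊, (muR d * ArithmeticFunction.log k) • hh χ y (d * k) =
        (muR d * χ (d : ZMod q)) * ∑ k ∈ Ioc 0 ⌊y⌋₊, (Real.log k : ℂ) * hh χ (y / d) k := by
      rw [mul_sum]
      refine sum_congr rfl fun k _ => ?_
      rw [hh_mul, ArithmeticFunction.log_apply, Complex.real_smul]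
      push_cast; ring
    rw [e, norm_mul, norm_mul, Complex.norm_real, Real.norm_eq_abs]
    have h1 := abel_mono (fun k => Real.log k) (fun k => hh χ (y / d) k) _
      (inner_partial hq hχ hy hd.1) (fun n => Real.log_natCast_nonneg n) (fun n => by
        rcases Nat.eq_zero_or_pos n with rfl | hn
        · simp
        · exact Real.log_le_log (by exact_mod_cast hn) (by push_cast; linarith)) ⌊y⌋₊
    have h2 : Real.log (⌊y⌋₊ : ℝ) ≤ Real.log y :=
      Real.log_le_log (by exact_mod_cast Nat.floor_pos.2 hy) (Nat.floor_le (by linarith))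
    have h3 : |muR d| * ‖χ (d : ZMod q)‖ ≤ 1 := mul_le_one₀ (muR_abs d) (norm_nonneg _) (DirichletCharacter.norm_le_one χ _)
    calc _ ≤ 1 * (2 * (q * Real.log y) * Real.log (⌊y⌋₊ : ℝ)) := mul_le_mul h3 h1 (norm_nonneg _) zero_le_one
      _ ≤ _ := by rw [one_mul]; gcongr
  · simp

lemma T2_bound (hq : 1 < q) (hχ : χ ≠ 1) {y : ℝ} (hy : 1 ≤ y) (U : ℕ) :
    ‖∑ n ∈ Ioc 0 ⌊y⌋₊, (cutLow vM U * (cutLow muR U * zR)) n • hh χ y n‖ ≤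
      U * (U * (Real.log y * (q * Real.log y))) := by
  have hl := Real.log_nonneg hy
  rw [conv_sum _ _ _ _ (hh_zero χ (by linarith))]
  refine norm_ite_le _ U _ (by positivity) _ fun d hd => ?_
  have hd' := hd
  rw [mem_Ioc] at hd
  have e : ∑ k ∈ Ioc 0 ⌊y⌋₊, (cutLow vM U d * (cutLow muR U * zR) k) • hh χ y (d * k) =
      cutLow vM U d • ∑ k ∈ Ioc 0 ⌊y⌋₊, (cutLow muR U * zR) k • hh χ y (d * k) := by
    rw [smul_sum]
    exact sum_congr rfl fun k _ => mul_smul _ _ _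
  rw [e, conv_sum _ _ _ _ (fun n hn => hh_zero χ (by linarith) _ (hn.trans_le (Nat.le_mul_of_pos_left _ hd.1))), cutLow_apply]
  split_ifs with h
  swap
  · simp
  rw [norm_smul, Real.norm_of_nonneg ArithmeticFunction.vonMangoldt_nonneg]
  have h0 : ‖∑ a ∈ Ioc 0 ⌊y⌋₊, ∑ k ∈ Ioc 0 ⌊y⌋₊, (cutLow muR U a * zR k) • hh χ y (d * (a * k))‖ ≤ U * (q * Real.log y) := by
    refine norm_ite_le _ U _ (by positivity) _ fun a ha => ?_
    rw [mem_Ioc] at ha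
    rw [cutLow_apply]
    split_ifs with h
    swap
    · simp
    have e : ∑ k ∈ Ioc 0 ⌊y⌋₊, (muR a * zR k) • hh χ y (d * (a * k)) =
        (muR a * χ ((d * a : ℕ) : ZMod q)) * ∑ k ∈ Ioc 0 ⌊y⌋₊, hh χ (y / (d * a : ℕ)) k := by
      rw [mul_sum]
      refine sum_congr rfl fun k hk => ?_
      rw [mem_Ioc] at hk
      rw [← mul_assoc, hh_mul, zR_apply (by omega), Complex.real_smul]
      push_cast; ring
    rw [e, norm_mul, norm_mul, Complex.norm_real, Real.norm_eq_abs]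
    have h3 : |muR a| * ‖χ ((d * a : ℕ) : ZMod q)‖ ≤ 1 := mul_le_one₀ (muR_abs a) (norm_nonneg _) (DirichletCharacter.norm_le_one χ _)
    calc _ ≤ 1 * (q * Real.log y) := mul_le_mul h3 (inner_partial hq hχ hy (Nat.mul_pos hd.1 ha.1) _) (norm_nonneg _) zero_le_one
      _ = _ := one_mul _
  calc _ ≤ Real.log y * (U * (q * Real.log y)) := mul_le_mul (vM_le hy hd') h0 (norm_nonneg _) hl
    _ = _ := by ring

end typeI
end BVC

namespace BVC
open Finset MeasureTheory

lemma posLog_integral {y : ℝ} (hy : 1 ≤ y) {m n : ℕ} (hm : 0 < m) (hn : 0 < n) :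
    IntervalIntegrable (fun u : ℝ => if (m:ℝ) ≤ u ∧ n * u ≤ y then u⁻¹ else 0) volume 1 y ∧
    ∫ u in (1:ℝ)..y, (if (m:ℝ) ≤ u ∧ n * u ≤ y then u⁻¹ else 0) = Real.posLog (y / (m * n)) := by
  have hm' : (1:ℝ) ≤ m := by exact_mod_cast hm
  have hn' : (1:ℝ) ≤ n := by exact_mod_cast hn
  have hn0 : (0:ℝ) < n := by linarith
  have e : (fun u : ℝ => if (m:ℝ) ≤ u ∧ n * u ≤ y then u⁻¹ else 0) =
      (Set.Icc (m:ℝ) (y / n)).indicator (fun u => u⁻¹) := by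
    funext u
    rw [Set.indicator_apply]
    congr 1
    rw [Set.mem_Icc, le_div_iff₀ hn0, mul_comm]
  rw [e]
  have hyn : y / n ≤ y := div_le_self (by linarith) hn'
  have hIntg : IntegrableOn (fun u : ℝ => u⁻¹) (Set.Icc (m:ℝ) (y / n)) := by
    apply ContinuousOn.integrableOn_Icc
    apply ContinuousOn.inv₀ continuousOn_id
    intro u hu; have := hu.1; simp only [id]; linarith
  constructor
  · rw [intervalIntegrable_iff]
    exact ((integrable_indicator_iff measurableSet_Icc).2 hIntg).integrableOn
  · have hnn : (Set.Icc (m:ℝ) (y/n)) \ {1} ⊆ Set.Ioc 1 y := by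
      intro u hu
      rcases hu with ⟨⟨h1, h2⟩, h3⟩
      refine ⟨lt_of_le_of_ne (by linarith) (fun h => h3 h.symm), by linarith⟩
    rw [intervalIntegral.integral_of_le hy]
    have : ∫ u in Set.Ioc 1 y, (Set.Icc (m:ℝ) (y / n)).indicator (fun u => u⁻¹) u =
        ∫ u in Set.Icc 1 y, (Set.Icc (m:ℝ) (y / n)).indicator (fun u => u⁻¹) u :=
      (integral_Icc_eq_integral_Ioc).symm
    rw [this, setIntegral_indicator measurableSet_Icc]
    have e2 : Set.Icc 1 y ∩ Set.Icc (m:ℝ) (y/n) = Set.Icc (m:ℝ) (y/n) := by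
      apply Set.inter_eq_right.2
      exact Set.Icc_subset_Icc hm' hyn
    rw [e2]
    by_cases h : (m:ℝ) ≤ y / n
    · rw [integral_Icc_eq_integral_Ioc, ← intervalIntegral.integral_of_le h,
        integral_inv_of_pos (by linarith) (by linarith), Real.posLog, max_eq_right]
      · congr 1; field_simp
      · apply Real.log_nonneg
        rw [le_div_iff₀ (by positivity), one_mul]
        rwa [le_div_iff₀ hn0] at h
    · rw [Set.Icc_eq_empty h, setIntegral_empty, eq_comm, Real.posLog_eq_zero_iff, abs_of_nonneg (by positivity)]
      rw [div_le_one (by positivity)]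
      rw [not_le, div_lt_iff₀ hn0] at h
      exact h.le

/-- truncated character sum -/
noncomputable def SA {q : ℕ} (a : ArithmeticFunction ℝ) (χ : DirichletCharacter ℂ q) (u : ℝ) : ℂ :=
  ∑ m ∈ range (⌊u⌋₊ + 1), (a m : ℂ) * χ (m : ZMod q)

lemma SA_eq {q : ℕ} (a : ArithmeticFunction ℝ) (χ : DirichletCharacter ℂ q) {u : ℝ} (hu : 0 ≤ u) {Y : ℕ}
    (hY : ⌊u⌋₊ ≤ Y) : SA a χ u = ∑ m ∈ Ioc 0 Y, if (m:ℝ) ≤ u then (a m : ℂ) * χ (m : ZMod q) else 0 := by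
  rw [SA, ← sum_filter]
  symm
  apply sum_subset
  · intro m hm
    rw [mem_filter, mem_Ioc] at hm
    rw [mem_range, Nat.lt_succ_iff]
    exact Nat.le_floor hm.2
  · intro m hm hm2
    rw [mem_range, Nat.lt_succ_iff] at hm
    rw [mem_filter, mem_Ioc] at hm2
    have hmu := (Nat.le_floor_iff hu).1 hm
    have : m = 0 := by
      by_contra h
      exact hm2 ⟨⟨Nat.pos_of_ne_zero h, hm.trans hY⟩, hmu⟩
    simp [this]

lemma T3_eq {q : ℕ} (a b : ArithmeticFunction ℝ) (χ : DirichletCharacter ℂ q) {y : ℝ} (hy : 1 ≤ y) :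
    IntervalIntegrable (fun u : ℝ => (u⁻¹ : ℝ) • (SA a χ u * SA b χ (y / u))) volume 1 y ∧
    ∑ n ∈ Ioc 0 ⌊y⌋₊, (a * b) n • hh χ y n = ∫ u in (1:ℝ)..y, (u⁻¹ : ℝ) • (SA a χ u * SA b χ (y / u)) := by
  set Y := ⌊y⌋₊
  set F : ℝ → ℂ := fun u => ∑ m ∈ Ioc 0 Y, ∑ n ∈ Ioc 0 Y,
      (if (m:ℝ) ≤ u ∧ n * u ≤ y then u⁻¹ else 0 : ℝ) • ((a m * b n : ℂ) * (χ (m : ZMod q) * χ (n : ZMod q))) with hF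
  have hcongr : ∀ u ∈ Set.uIcc 1 y, (u⁻¹ : ℝ) • (SA a χ u * SA b χ (y / u)) = F u := by
    intro u hu
    rw [Set.uIcc_of_le hy] at hu
    have hu1 := hu.1
    rw [SA_eq a χ (by linarith) (Nat.floor_le_floor hu.2), SA_eq b χ (by positivity)
      (Nat.floor_le_floor (div_le_self (by linarith) hu1)), sum_mul_sum, smul_sum]
    refine sum_congr rfl fun m _ => ?_
    rw [smul_sum]
    refine sum_congr rfl fun n _ => ?_
    have : (n:ℝ) ≤ y / u ↔ n * u ≤ y := le_div_iff₀ (by linarith)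
    simp only [this]
    by_cases h1 : (m:ℝ) ≤ u <;> by_cases h2 : n * u ≤ y <;> simp [h1, h2]
    left; ring
  have hInt : ∀ m ∈ Ioc 0 Y, ∀ n ∈ Ioc 0 Y, IntervalIntegrable (fun u : ℝ => 
      (if (m:ℝ) ≤ u ∧ n * u ≤ y then u⁻¹ else 0 : ℝ) • ((a m * b n : ℂ) * (χ (m : ZMod q) * χ (n : ZMod q)))) volume 1 y := by
    intro m hm n hn
    rw [mem_Ioc] at hm hn
    have h := (posLog_integral hy hm.1 hn.1).1
    rw [intervalIntegrable_iff] at h ⊢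
    exact h.smul_const _
  have hFint : IntervalIntegrable F volume 1 y := by
    have : F = ∑ m ∈ Ioc 0 Y, ∑ n ∈ Ioc 0 Y, fun u : ℝ => 
      (if (m:ℝ) ≤ u ∧ n * u ≤ y then u⁻¹ else 0 : ℝ) • ((a m * b n : ℂ) * (χ (m : ZMod q) * χ (n : ZMod q))) := by
      funext u; simp only [hF, Finset.sum_apply]
    rw [this]
    exact IntervalIntegrable.sum _ fun m hm => IntervalIntegrable.sum _ fun n hn => hInt m hm n hn
  constructor
  · refine (intervalIntegrable_congr ?_).2 hFint
    intro u hu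
    exact hcongr u (Set.uIoc_subset_uIcc hu)
  · rw [intervalIntegral.integral_congr hcongr, conv_sum _ _ _ _ (hh_zero χ (by linarith)), hF,
      intervalIntegral.integral_finsetSum fun m hm => ?_]
    swap
    · have : (fun u : ℝ => ∑ n ∈ Ioc 0 Y, (if (m:ℝ) ≤ u ∧ n * u ≤ y then u⁻¹ else 0 : ℝ) • ((a m * b n : ℂ) * (χ (m : ZMod q) * χ (n : ZMod q)))) =
         ∑ n ∈ Ioc 0 Y, fun u : ℝ => (if (m:ℝ) ≤ u ∧ n * u ≤ y then u⁻¹ else 0 : ℝ) • ((a m * b n : ℂ) * (χ (m : ZMod q) * χ (n : ZMod q))) := by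
        funext u; simp only [Finset.sum_apply]
      rw [this]
      exact IntervalIntegrable.sum _ fun n hn => hInt m hm n hn
    refine sum_congr rfl fun m hm => ?_
    rw [intervalIntegral.integral_finsetSum fun n hn => hInt m hm n hn]
    refine sum_congr rfl fun n hn => ?_
    rw [mem_Ioc] at hm hn
    rw [intervalIntegral.integral_smul_const, (posLog_integral hy hm.1 hn.1).2, hh, Complex.real_smul, Complex.real_smul]
    push_cast
    rw [map_mul]
    ring

lemma SA_zero {q : ℕ} (a : ArithmeticFunction ℝ) (χ : DirichletCharacter ℂ q) {u : ℝ} {U : ℕ} (hu : u < U + 1)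
    (h0 : 0 ≤ u) (ha : ∀ m ≤ U, a m = 0) : SA a χ u = 0 := by
  apply sum_eq_zero
  intro m hm
  rw [mem_range, Nat.lt_succ_iff] at hm
  have := (Nat.le_floor_iff h0).1 hm
  have : (m:ℝ) < U + 1 := by linarith
  have : m < U + 1 := by exact_mod_cast this
  rw [ha m (by omega)]
  simp

lemma SA_ls (S : Finset ℕ) (Q : ℕ) (hS : ∀ q ∈ S, q.Prime ∧ q ≤ Q) (a : ArithmeticFunction ℝ) {u : ℝ} (hu : 0 ≤ u) (E : ℝ)
    (hE : ∑ n ∈ Ioc 0 ⌊u⌋₊, a n ^ 2 ≤ E) :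
    ∑ q ∈ S, ∑ χ ∈ nt q, ‖SA a χ u‖ ^ 2 ≤ 100 * (u + (Q:ℝ) ^ 2) * E := by
  refine (mult_ls S Q hS ⌊u⌋₊ (fun n => (a n : ℂ))).trans ?_
  have e : ∑ n ∈ range (⌊u⌋₊ + 1), ‖(a n : ℂ)‖ ^ 2 = ∑ n ∈ Ioc 0 ⌊u⌋₊, a n ^ 2 := by
    have : range (⌊u⌋₊ + 1) = insert 0 (Ioc 0 ⌊u⌋₊) := by ext; simp
    rw [this, sum_insert (by simp)]
    simp
  rw [e]
  have h1 : (⌊u⌋₊:ℝ) ≤ u := Nat.floor_le hu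
  have h2 : 0 ≤ ∑ n ∈ Ioc 0 ⌊u⌋₊, a n ^ 2 := sum_nonneg fun _ _ => sq_nonneg _
  gcongr

end BVC

namespace BVC
open Finset MeasureTheory

lemma aa_bound (U m : ℕ) : |(zR * cutHigh muR U) m| ≤ m.divisors.card := by
  rw [zR, ArithmeticFunction.coe_zeta_mul_apply]
  refine (abs_sum_le_sum_abs _ _).trans ?_
  rw [card_eq_sum_ones, Nat.cast_sum]
  refine sum_le_sum fun d _ => ?_
  rw [cutHigh_apply]
  split_ifs
  · simp
  · simpa using muR_abs d

lemma aa_zero (U m : ℕ) (hm : m ≤ U) : (zR * cutHigh muR U) m = 0 := by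
  rw [zR, ArithmeticFunction.coe_zeta_mul_apply]
  refine sum_eq_zero fun d hd => ?_
  rw [cutHigh_apply, if_pos ((Nat.divisor_le hd).trans hm)]

lemma bb_zero (U m : ℕ) (hm : m ≤ U) : cutHigh vM U m = 0 := by
  rw [cutHigh_apply, if_pos hm]

lemma aa_sq (U : ℕ) {u y : ℝ} (hu : 1 ≤ u) (huy : u ≤ y) :
    ∑ n ∈ Ioc 0 ⌊u⌋₊, (zR * cutHigh muR U) n ^ 2 ≤ u * (1 + Real.log y) ^ 3 := by
  calc _ ≤ ∑ n ∈ Ioc 0 ⌊u⌋₊, ((n.divisors.card : ℝ)) ^ 2 :=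
        sum_le_sum fun n _ => by rw [← sq_abs]; exact pow_le_pow_left₀ (abs_nonneg _) (aa_bound U n) 2
    _ ≤ ⌊u⌋₊ * (1 + Real.log ⌊u⌋₊) ^ 3 := div_sq _
    _ ≤ _ := by
      have h1 : (⌊u⌋₊:ℝ) ≤ u := Nat.floor_le (by linarith)
      have h2 : (0:ℝ) < ⌊u⌋₊ := by exact_mod_cast Nat.floor_pos.2 hu
      have h3 : Real.log ⌊u⌋₊ ≤ Real.log y := Real.log_le_log h2 (by linarith)
      have h4 : 0 ≤ Real.log (⌊u⌋₊ : ℝ) := Real.log_natCast_nonneg _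
      gcongr

lemma bb_sq (U : ℕ) {u y : ℝ} (hu : 1 ≤ u) (huy : u ≤ y) :
    ∑ n ∈ Ioc 0 ⌊u⌋₊, (cutHigh vM U) n ^ 2 ≤ u * (1 + Real.log y) ^ 2 := by
  have h1 : (⌊u⌋₊:ℝ) ≤ u := Nat.floor_le (by linarith)
  have hl : Real.log u ≤ Real.log y := Real.log_le_log (by linarith) huy
  have hl0 : 0 ≤ Real.log u := Real.log_nonneg hu
  calc _ ≤ ∑ n ∈ Ioc 0 ⌊u⌋₊, (1 + Real.log y) ^ 2 := by
        refine sum_le_sum fun n hn => ?_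
        rw [cutHigh_apply]
        split_ifs
        · simpa using sq_nonneg (1 + Real.log y)
        · have := vM_le hu hn
          have h0 : 0 ≤ vM n := ArithmeticFunction.vonMangoldt_nonneg
          gcongr
          linarith
    _ = ⌊u⌋₊ * (1 + Real.log y) ^ 2 := by simp
    _ ≤ _ := by gcongr

lemma typeII_point (S : Finset ℕ) (Q : ℕ) (hS : ∀ q ∈ S, q.Prime ∧ q ≤ Q) (U : ℕ) (hU : 1 ≤ U) {y u : ℝ}
    (hu : 1 ≤ u) (huy : u ≤ y) :
    ∑ q ∈ S, ∑ χ ∈ nt q, ‖SA (zR * cutHigh muR U) χ u‖ * ‖SA (cutHigh vM U) χ (y / u)‖ ≤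
      100 * (1 + Real.log y) ^ 3 * (y + 2 * Q * y / √U + Q ^ 2 * √y) := by
  have hy : 1 ≤ y := hu.trans huy
  have hl := Real.log_nonneg hy
  have hU' : (1:ℝ) ≤ U := by exact_mod_cast hU
  have hKnn : 0 ≤ 100 * (1 + Real.log y) ^ 3 * (y + 2 * Q * y / √U + Q ^ 2 * √y) := by positivity
  by_cases h1 : u < U + 1
  · refine le_trans (le_of_eq ?_) hKnn
    refine sum_eq_zero fun q _ => sum_eq_zero fun χ _ => ?_
    rw [SA_zero _ χ h1 (by linarith) (aa_zero U)]; simp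
  by_cases h2 : y / u < U + 1
  · refine le_trans (le_of_eq ?_) hKnn
    refine sum_eq_zero fun q _ => sum_eq_zero fun χ _ => ?_
    rw [SA_zero _ χ h2 (by positivity) (bb_zero U)]; simp
  rw [not_lt] at h1 h2
  have hu0 : 0 < u := by linarith
  have hv1 : 1 ≤ y / u := by linarith
  have hvy : y / u ≤ y := div_le_self (by linarith) hu
  have A := SA_ls S Q hS (zR * cutHigh muR U) (by linarith : 0 ≤ u) _ (aa_sq U hu huy)
  have B := SA_ls S Q hS (cutHigh vM U) (by linarith : 0 ≤ y / u) _ (bb_sq U hv1 hvy)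
  have sg : ∀ f : (q : ℕ) → DirichletCharacter ℂ q → ℝ, ∑ q ∈ S, ∑ χ ∈ nt q, f q χ = ∑ p ∈ S.sigma nt, f p.1 p.2 :=
    fun f => (sum_sigma S nt (fun p => f p.1 p.2)).symm
  rw [sg] at A B ⊢
  refine (Real.sum_mul_le_sqrt_mul_sqrt _ _ _).trans ?_
  rw [← Real.sqrt_mul (sum_nonneg fun _ _ => sq_nonneg _)]
  apply Real.sqrt_le_iff.2
  refine ⟨hKnn, (mul_le_mul A B (sum_nonneg fun _ _ => sq_nonneg _) (by positivity)).trans ?_⟩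
  set v := y / u with hv
  have huv : u * v = y := by rw [hv]; field_simp
  have h3 : u ≤ y / U := by rw [le_div_iff₀ (by linarith)]; nlinarith
  have h4 : v ≤ y / U := by rw [le_div_iff₀ (by linarith)]; nlinarith
  set L := 1 + Real.log y
  have hL : 1 ≤ L := by simp only [L]; linarith
  have hsU : √(U:ℝ) ^ 2 = U := Real.sq_sqrt (by linarith)
  have hsy : √y ^ 2 = y := Real.sq_sqrt (by linarith)
  calc 100 * (u + (Q:ℝ) ^ 2) * (u * L ^ 3) * (100 * (v + (Q:ℝ) ^ 2) * (v * L ^ 2))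
      = 10000 * L ^ 5 * (u * v) * (u * v + Q ^ 2 * (u + v) + Q ^ 4) := by ring
    _ ≤ 10000 * L ^ 6 * y * (y + Q ^ 2 * (y / U + y / U) + Q ^ 4) := by
        rw [huv]
        have : L ^ 5 ≤ L ^ 6 := pow_le_pow_right₀ hL (by norm_num)
        gcongr
    _ = (100 * L ^ 3) ^ 2 * (y ^ 2 + 2 * Q ^ 2 * y ^ 2 / U + (Q ^ 2) ^ 2 * y) := by ring
    _ ≤ (100 * L ^ 3) ^ 2 * (y + 2 * Q * y / √U + Q ^ 2 * √y) ^ 2 := by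
        gcongr
        have e1 : 2 * Q ^ 2 * y ^ 2 / U ≤ (2 * Q * y / √U) ^ 2 := by
          rw [div_pow, hsU]
          gcongr
          nlinarith [mul_nonneg (sq_nonneg (Q:ℝ)) (sq_nonneg y)]
        have e2 : ((Q:ℝ) ^ 2) ^ 2 * y = (Q ^ 2 * √y) ^ 2 := by rw [mul_pow, hsy]
        have p1 : 0 ≤ 2 * Q * y / √U := by positivity
        have p2 : 0 ≤ (Q:ℝ) ^ 2 * √y := by positivity
        rw [e2]
        nlinarith [mul_nonneg p1 p2, mul_nonneg p1 (by linarith : 0 ≤ y), mul_nonneg p2 (by linarith : 0 ≤ y)]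
    _ = _ := by ring

lemma typeII (S : Finset ℕ) (Q : ℕ) (hS : ∀ q ∈ S, q.Prime ∧ q ≤ Q) (U : ℕ) (hU : 1 ≤ U) {y : ℝ} (hy : 1 ≤ y) :
    ∑ q ∈ S, ∑ χ ∈ nt q, ‖∑ n ∈ Ioc 0 ⌊y⌋₊, ((zR * cutHigh muR U) * cutHigh vM U) n • hh χ y n‖ ≤
      100 * (1 + Real.log y) ^ 4 * (y + 2 * Q * y / √U + Q ^ 2 * √y) := by
  set K := 100 * (1 + Real.log y) ^ 3 * (y + 2 * Q * y / √U + Q ^ 2 * √y) with hK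
  have hl := Real.log_nonneg hy
  have hK0 : 0 ≤ K := by positivity
  have hIntg : ∀ (q : ℕ) (χ : DirichletCharacter ℂ q), IntervalIntegrable (fun u : ℝ => ‖(u⁻¹ : ℝ) • (SA (zR * cutHigh muR U) χ u * SA (cutHigh vM U) χ (y / u))‖) volume 1 y :=
    fun q χ => (T3_eq _ _ χ hy).1.norm
  calc _ ≤ ∑ q ∈ S, ∑ χ ∈ nt q, ∫ u in (1:ℝ)..y, ‖(u⁻¹ : ℝ) • (SA (zR * cutHigh muR U) χ u * SA (cutHigh vM U) χ (y / u))‖ := by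
        refine sum_le_sum fun q _ => sum_le_sum fun χ _ => ?_
        rw [(T3_eq _ _ χ hy).2]
        exact intervalIntegral.norm_integral_le_integral_norm hy
    _ = ∫ u in (1:ℝ)..y, ∑ p ∈ S.sigma nt, ‖(u⁻¹ : ℝ) • (SA (zR * cutHigh muR U) p.2 u * SA (cutHigh vM U) p.2 (y / u))‖ := by
        rw [intervalIntegral.integral_finsetSum (fun p _ => hIntg p.1 p.2), sum_sigma]
    _ ≤ ∫ u in (1:ℝ)..y, K * u⁻¹ := by
        apply intervalIntegral.integral_mono_on hy
        · have := IntervalIntegrable.sum (S.sigma nt) (f := fun p u => ‖(u⁻¹ : ℝ) • (SA (zR * cutHigh muR U) p.2 u * SA (cutHigh vM U) p.2 (y / u))‖) (fun p _ => hIntg p.1 p.2)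
          have e : (∑ p ∈ S.sigma nt, fun u : ℝ => ‖(u⁻¹ : ℝ) • (SA (zR * cutHigh muR U) p.2 u * SA (cutHigh vM U) p.2 (y / u))‖) =
            fun u => ∑ p ∈ S.sigma nt, ‖(u⁻¹ : ℝ) • (SA (zR * cutHigh muR U) p.2 u * SA (cutHigh vM U) p.2 (y / u))‖ := by
            funext u
            rw [Finset.sum_apply]
          rw [e] at this
          exact this
        · apply IntervalIntegrable.const_mul
          apply intervalIntegrable_inv_iff.2
          right; rw [Set.uIcc_of_le hy]; intro h; have := h.1; linarith
        · intro u hu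
          have hu0 : 0 < u := by linarith [hu.1]
          have := typeII_point S Q hS U hU hu.1 hu.2
          rw [sum_sigma]
          have e : ∑ q ∈ S, ∑ χ ∈ nt q, ‖(u⁻¹ : ℝ) • (SA (zR * cutHigh muR U) χ u * SA (cutHigh vM U) χ (y / u))‖ =
            (∑ q ∈ S, ∑ χ ∈ nt q, ‖SA (zR * cutHigh muR U) χ u‖ * ‖SA (cutHigh vM U) χ (y / u)‖) * u⁻¹ := by
            rw [sum_mul]
            refine sum_congr rfl fun q _ => ?_
            rw [sum_mul]
            refine sum_congr rfl fun χ _ => ?_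
            rw [norm_smul, norm_mul, Real.norm_of_nonneg (by positivity)]; ring
          rw [e]
          gcongr
    _ = K * Real.log y := by
        rw [intervalIntegral.integral_const_mul, integral_inv_of_pos (by norm_num) (by linarith), div_one]
    _ ≤ K * (1 + Real.log y) := by gcongr; linarith
    _ = _ := by rw [hK]; ring

theorem bv_lite (S : Finset ℕ) (Q : ℕ) (hS : ∀ q ∈ S, q.Prime ∧ q ≤ Q) (U : ℕ) (hU : 1 ≤ U) {y : ℝ} (hy : 1 ≤ y) :
    ∑ q ∈ S, ∑ χ ∈ nt q, ‖W y χ‖ ≤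
      100 * (1 + Real.log y) ^ 4 * (Q ^ 3 * U ^ 2 + y + 2 * Q * y / √U + Q ^ 2 * √y) := by
  have hl := Real.log_nonneg hy
  set L := 1 + Real.log y with hL
  have hU' : (1:ℝ) ≤ U := by exact_mod_cast hU
  have h1 : ∀ q ∈ S, ∀ χ ∈ nt q, ‖W y χ‖ ≤ 4 * (Q * U ^ 2 * L ^ 2) + ‖∑ n ∈ Ioc 0 ⌊y⌋₊, ((zR * cutHigh muR U) * cutHigh vM U) n • hh χ y n‖ := by
    intro q hq χ hχ
    have hq1 := (hS q hq).1.one_lt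
    have hχ1 := ne_one_of_mem_nt hχ
    have hqQ : (q:ℝ) ≤ Q := by exact_mod_cast (hS q hq).2
    have hq1' : (1:ℝ) ≤ q := by exact_mod_cast hq1.le
    have hQ1 : (1:ℝ) ≤ Q := by linarith
    have e : W y χ = ∑ n ∈ Ioc 0 ⌊y⌋₊, cutLow vM U n • hh χ y n + ∑ n ∈ Ioc 0 ⌊y⌋₊, (cutLow muR U * ArithmeticFunction.log) n • hh χ y n
      - ∑ n ∈ Ioc 0 ⌊y⌋₊, (cutLow vM U * (cutLow muR U * zR)) n • hh χ y n + ∑ n ∈ Ioc 0 ⌊y⌋₊, ((zR * cutHigh muR U) * cutHigh vM U) n • hh χ y n := by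
      rw [← sum_add_distrib, ← sum_sub_distrib, ← sum_add_distrib]
      refine sum_congr rfl fun n _ => ?_
      rw [← add_smul, ← sub_smul, ← add_smul]
      have := congrArg (fun f : ArithmeticFunction ℝ => f n) (vaughan U)
      simp only [ArithmeticFunction.add_apply, sub_eq_add_neg, ArithmeticFunction.neg_apply] at this
      rw [sub_eq_add_neg, ← this, hh]
    have t0 := T0_bound (χ := χ) hy U
    have t1 := T1_bound hq1 hχ1 hy U
    have t2 := T2_bound hq1 hχ1 hy U
    rw [e]
    have hlL : Real.log y ≤ L := by rw [hL]; linarith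
    have b0 : (U:ℝ) * (Real.log y * Real.log y) ≤ Q * U ^ 2 * L ^ 2 := by
      have : (U:ℝ) ≤ Q * U ^ 2 := by nlinarith [mul_le_mul hQ1 (by nlinarith : (U:ℝ) ≤ U ^ 2) (by positivity) (by positivity)]
      calc (U:ℝ) * (Real.log y * Real.log y) ≤ (Q * U ^ 2) * (L * L) := by gcongr
        _ = _ := by ring
    have b1 : (U:ℝ) * (2 * (q * Real.log y) * Real.log y) ≤ 2 * (Q * U ^ 2 * L ^ 2) := by
      calc (U:ℝ) * (2 * (q * Real.log y) * Real.log y) ≤ (U ^ 2 : ℝ) * (2 * (Q * L) * L) := by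
            gcongr
            nlinarith
        _ = _ := by ring
    have b2 : (U:ℝ) * (U * (Real.log y * (q * Real.log y))) ≤ Q * U ^ 2 * L ^ 2 := by
      calc (U:ℝ) * (U * (Real.log y * (q * Real.log y))) ≤ U * (U * (L * (Q * L))) := by gcongr
        _ = _ := by ring
    refine (norm_add_le _ _).trans (add_le_add_left ?_ _)
    refine (norm_sub_le _ _).trans ?_
    have := norm_add_le (∑ n ∈ Ioc 0 ⌊y⌋₊, cutLow vM U n • hh χ y n) (∑ n ∈ Ioc 0 ⌊y⌋₊, (cutLow muR U * ArithmeticFunction.log) n • hh χ y n)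
    linarith
  calc _ ≤ ∑ q ∈ S, ∑ χ ∈ nt q, (4 * (Q * U ^ 2 * L ^ 2) + ‖∑ n ∈ Ioc 0 ⌊y⌋₊, ((zR * cutHigh muR U) * cutHigh vM U) n • hh χ y n‖) :=
        sum_le_sum fun q hq => sum_le_sum fun χ hχ => h1 q hq χ hχ
    _ = ∑ q ∈ S, (nt q).card * (4 * (Q * U ^ 2 * L ^ 2)) + ∑ q ∈ S, ∑ χ ∈ nt q, ‖∑ n ∈ Ioc 0 ⌊y⌋₊, ((zR * cutHigh muR U) * cutHigh vM U) n • hh χ y n‖ := by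
        simp_rw [sum_add_distrib, sum_const, nsmul_eq_mul]
    _ ≤ (Q:ℝ) * (Q * (4 * (Q * U ^ 2 * L ^ 2))) + 100 * L ^ 4 * (y + 2 * Q * y / √U + Q ^ 2 * √y) := by
        refine add_le_add ?_ (typeII S Q hS U hU hy)
        have : ∀ q ∈ S, ((nt q).card : ℝ) * (4 * (Q * U ^ 2 * L ^ 2)) ≤ Q * (4 * (Q * U ^ 2 * L ^ 2)) := by
          intro q hq
          have h := (card_nt_le (hS q hq).1.ne_zero).trans (hS q hq).2
          gcongr
        refine (sum_le_sum this).trans ?_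
        rw [sum_const, nsmul_eq_mul]
        have hc : S ⊆ Ioc 0 Q := fun q hq => mem_Ioc.2 ⟨(hS q hq).1.pos, (hS q hq).2⟩
        have := card_le_card hc
        rw [Nat.card_Ioc, Nat.sub_zero] at this
        gcongr
    _ ≤ _ := by
        have hL1 : 1 ≤ L := by rw [hL]; linarith
        have : L ^ 2 ≤ L ^ 4 := pow_le_pow_right₀ hL1 (by norm_num)
        have h2 : (Q:ℝ) ^ 3 * U ^ 2 * L ^ 2 ≤ Q ^ 3 * U ^ 2 * L ^ 4 := by gcongr
        have h3 : 0 ≤ (Q:ℝ) ^ 3 * U ^ 2 * L ^ 4 := by positivity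
        nlinarith

end BVC

namespace BVC
open Finset MeasureTheory Filter Topology Complex

noncomputable def rr (n : ℕ) (s : ℂ) : ℂ :=
  ((n + 1 : ℕ) : ℂ) ^ (-s) - (((n + 1 : ℕ) : ℂ) ^ (1 - s) - ((n + 1 + 1 : ℕ) : ℂ) ^ (1 - s)) / (s - 1)

lemma cpow_lip {m : ℝ} (hm : 0 < m) {s : ℂ} (hs : 0 < s.re) {u : ℝ} (hu : u ∈ Set.Icc m (m + 1)) :
    ‖(u : ℂ) ^ (-s) - (m : ℂ) ^ (-s)‖ ≤ ‖s‖ * m ^ (-s.re - 1) := by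
  have hs0 : s ≠ 0 := by rintro rfl; simp at hs
  have h := norm_image_sub_le_of_norm_deriv_le_segment' (f := fun u : ℝ => (u : ℂ) ^ (-s)) (f' := fun u : ℝ => -s * (u : ℂ) ^ (-s - 1))
    (a := m) (b := m + 1) (C := ‖s‖ * m ^ (-s.re - 1)) ?_ ?_ u hu
  · refine h.trans ?_
    have h1 : u - m ≤ 1 := by linarith [hu.2]
    have h2 : 0 ≤ ‖s‖ * m ^ (-s.re - 1) := by positivity
    nlinarith
  · intro x hx
    have hx0 : x ≠ 0 := by have := hx.1; linarith
    exact (hasDerivAt_ofReal_cpow_const hx0 (neg_ne_zero.2 hs0)).hasDerivWithinAt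
  · intro x hx
    have hx0 : 0 < x := by have := hx.1; linarith
    rw [norm_mul, norm_neg, norm_cpow_eq_rpow_re_of_pos hx0]
    gcongr
    simp only [sub_re, neg_re, one_re]
    exact Real.rpow_le_rpow_of_nonpos hm hx.1 (by linarith)

lemma rr_bound (n : ℕ) {s : ℂ} (hs : 0 < s.re) (hs1 : s ≠ 1) :
    ‖rr n s‖ ≤ ‖s‖ * ((n + 1 : ℕ) : ℝ) ^ (-s.re - 1) := by
  have hs1' : s - 1 ≠ 0 := sub_ne_zero.2 hs1
  have hs1'' : 1 - s ≠ 0 := sub_ne_zero.2 hs1.symm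
  set m : ℝ := ((n + 1 : ℕ) : ℝ) with hm
  have hm0 : 0 < m := by rw [hm]; positivity
  have h := norm_image_sub_le_of_norm_deriv_le_segment' (f := fun u : ℝ => (u : ℂ) * (m : ℂ) ^ (-s) - (u : ℂ) ^ (-s + 1) / (-s + 1))
    (f' := fun u : ℝ => (1 : ℂ) * (m : ℂ) ^ (-s) - (u : ℂ) ^ (-s))
    (a := m) (b := m + 1) (C := ‖s‖ * m ^ (-s.re - 1)) ?_ ?_ (m + 1) ⟨by linarith, le_rfl⟩
  · rw [add_sub_cancel_left, mul_one] at h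
    refine le_trans (le_of_eq ?_) h
    congr 1
    have e1 : -s + 1 = 1 - s := by ring
    rw [rr, hm, e1]
    push_cast
    have : s - 1 = -(1 - s) := by ring
    rw [this]
    field_simp
    ring
  · intro x hx
    have hx0 : x ≠ 0 := by have := hx.1; linarith
    refine HasDerivAt.hasDerivWithinAt ?_
    refine HasDerivAt.sub ?_ ?_
    · exact (ofRealCLM.hasDerivAt (x := x)).mul_const _
    · exact hasDerivAt_ofReal_cpow_const' hx0 (by intro h; apply hs1; linear_combination -h)
  · intro x hx
    rw [one_mul, norm_sub_rev]
    exact cpow_lip hm0 hs ⟨hx.1, hx.2.le⟩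

lemma rr_partial (M : ℕ) (s : ℂ) (hs1 : s ≠ 1) : ∑ n ∈ range M, rr n s =
    ∑ n ∈ range M, ((n + 1 : ℕ) : ℂ) ^ (-s) - (1 - ((M + 1 : ℕ) : ℂ) ^ (1 - s)) / (s - 1) := by
  have : s - 1 ≠ 0 := sub_ne_zero.2 hs1
  induction M with
  | zero => simp
  | succ M ih =>
    rw [sum_range_succ, ih, sum_range_succ, rr]
    field_simp
    ring

lemma rr_hasSum_right {s : ℂ} (hs : 1 < s.re) : HasSum (fun n => rr n s) (riemannZeta s - 1 / (s - 1)) := by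
  have hs1 : s ≠ 1 := by rintro rfl; simp at hs
  have hsum : Summable (fun n => rr n s) := by
    apply Summable.of_norm_bounded (g := fun n : ℕ => ‖s‖ * ((n + 1 : ℕ) : ℝ) ^ (-s.re - 1))
    · apply Summable.mul_left
      exact (summable_nat_add_iff 1).2 (Real.summable_nat_rpow.2 (by linarith))
    · intro n; exact rr_bound n (by linarith) hs1
  have h1 := hsum.hasSum.tendsto_sum_nat
  have h2 : Tendsto (fun M => ∑ n ∈ range M, rr n s) atTop (𝓝 (riemannZeta s - (1 - 0) / (s - 1))) := by
    simp_rw [rr_partial _ s hs1]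
    apply Tendsto.sub
    · have : HasSum (fun n : ℕ => ((n + 1 : ℕ) : ℂ) ^ (-s)) (riemannZeta s) := by
        have hS : Summable (fun n : ℕ => ((n + 1 : ℕ) : ℂ) ^ (-s)) := by
          have := (summable_nat_add_iff 1).2 (Complex.summable_one_div_nat_cpow.2 hs)
          refine this.congr fun n => ?_
          rw [cpow_neg, one_div]
        rw [zeta_eq_tsum_one_div_nat_add_one_cpow hs]
        convert hS.hasSum using 1
        refine tsum_congr fun n => ?_
        rw [cpow_neg, one_div]; push_cast; rfl
      exact this.tendsto_sum_nat
    · apply Tendsto.div_const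
      apply Tendsto.sub tendsto_const_nhds
      rw [tendsto_zero_iff_norm_tendsto_zero]
      have : Tendsto (fun M : ℕ => ((M + 1 : ℕ) : ℝ) ^ (-(s.re - 1))) atTop (𝓝 0) :=
        (tendsto_rpow_neg_atTop (by linarith)).comp (tendsto_natCast_atTop_atTop.comp (tendsto_add_atTop_nat 1))
      refine this.congr fun M => ?_
      rw [norm_natCast_cpow_of_pos (Nat.succ_pos M)]
      simp
  have := tendsto_nhds_unique h1 h2
  rw [sub_zero] at this
  rw [← this]
  exact hsum.hasSum

lemma rr_summable {s : ℂ} (hs : 0 < s.re) (hs1 : s ≠ 1) : Summable (fun n => rr n s) := by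
  apply Summable.of_norm_bounded (g := fun n : ℕ => ‖s‖ * ((n + 1 : ℕ) : ℝ) ^ (-s.re - 1))
  · apply Summable.mul_left
    exact (summable_nat_add_iff 1).2 (Real.summable_nat_rpow.2 (by linarith))
  · intro n; exact rr_bound n hs hs1

lemma rr_hasSum {s : ℂ} (h1 : 1 / 2 < s.re) (h2 : s.re < 7 / 2) (ht : 2 ≤ |s.im|) :
    HasSum (fun n => rr n s) (riemannZeta s - 1 / (s - 1)) := by
  set z0 : ℂ := ⟨2, s.im⟩ with hz0
  set D := Metric.ball z0 (3 / 2) with hD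
  have hDre : ∀ z ∈ D, 1 / 2 < z.re ∧ z ≠ 1 ∧ ‖z‖ ≤ ‖z0‖ + 3 / 2 := by
    intro z hz
    rw [hD, mem_ball_iff_norm] at hz
    have e1 := (abs_re_le_norm (z - z0)).trans_lt hz
    have e2 := (abs_im_le_norm (z - z0)).trans_lt hz
    simp only [sub_re, sub_im, hz0] at e1 e2
    refine ⟨by linarith [(abs_lt.1 e1).1], ?_, ?_⟩
    · rintro rfl
      simp only [one_im, zero_sub, abs_neg] at e2
      linarith
    · have := norm_add_le (z - z0) z0
      rw [sub_add_cancel] at this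
      linarith
  have hsD : s ∈ D := by
    rw [hD, mem_ball_iff_norm]
    have : s - z0 = ((s.re - 2 : ℝ) : ℂ) := by
      apply Complex.ext <;> simp [hz0]
    rw [this, norm_real, Real.norm_eq_abs, abs_lt]
    constructor <;> linarith
  have hdiff : DifferentiableOn ℂ (fun z => ∑' n, rr n z) D := by
    apply differentiableOn_tsum_of_summable_norm (u := fun n : ℕ => (‖z0‖ + 3 / 2) * ((n + 1 : ℕ) : ℝ) ^ (-(3 / 2) : ℝ))
    · apply Summable.mul_left
      exact (summable_nat_add_iff 1).2 (Real.summable_nat_rpow.2 (by norm_num))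
    · intro n z hz
      have hz1 := (hDre z hz).2.1
      apply DifferentiableAt.differentiableWithinAt
      unfold rr
      have hn1 : ((n + 1 : ℕ) : ℂ) ≠ 0 := by exact_mod_cast Nat.succ_ne_zero n
      have hn2 : ((n + 1 + 1 : ℕ) : ℂ) ≠ 0 := by exact_mod_cast Nat.succ_ne_zero (n + 1)
      refine DifferentiableAt.sub ?_ (DifferentiableAt.div (DifferentiableAt.sub ?_ ?_) (by fun_prop) (sub_ne_zero.2 hz1))
      · exact DifferentiableAt.const_cpow (by fun_prop) (Or.inl hn1)
      · exact DifferentiableAt.const_cpow (by fun_prop) (Or.inl hn1)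
      · exact DifferentiableAt.const_cpow (by fun_prop) (Or.inl hn2)
    · exact Metric.isOpen_ball
    · intro n z hz
      obtain ⟨a1, a2, a3⟩ := hDre z hz
      refine (rr_bound n (by linarith) a2).trans ?_
      have : (1:ℝ) ≤ ((n + 1 : ℕ) : ℝ) := by exact_mod_cast Nat.succ_le_succ (Nat.zero_le n)
      gcongr
      linarith
  have hdiff2 : DifferentiableOn ℂ (fun z => riemannZeta z - 1 / (z - 1)) D := by
    intro z hz
    have hz1 := (hDre z hz).2.1
    apply DifferentiableAt.differentiableWithinAt
    exact (differentiableAt_riemannZeta hz1).sub ((differentiableAt_const _).div (by fun_prop) (sub_ne_zero.2 hz1))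
  have hEq : Set.EqOn (fun z => ∑' n, rr n z) (fun z => riemannZeta z - 1 / (z - 1)) D := by
    apply (hdiff.analyticOnNhd Metric.isOpen_ball).eqOn_of_preconnected_of_eventuallyEq (hdiff2.analyticOnNhd Metric.isOpen_ball)
      (convex_ball _ _).isPreconnected (Metric.mem_ball_self (by norm_num : (0:ℝ) < 3 / 2))
    have : ∀ᶠ z in 𝓝 z0, 1 < z.re := by
      apply continuous_re.continuousAt.eventually_const_lt
      simp [hz0]
    filter_upwards [this] with z hz
    exact (rr_hasSum_right hz).tsum_eq
  have := hEq hsD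
  simp only at this
  rw [← this]
  exact (rr_summable (by linarith) (hDre s hsD).2.1).hasSum

theorem zeta_upper {e : ℝ} (he : 0 < e) (he1 : e ≤ 1 / 2) : ∃ C : ℝ, 0 < C ∧ ∀ s : ℂ, 1 - e / 2 ≤ s.re → s.re ≤ 3 →
    2 ≤ |s.im| → ‖riemannZeta s‖ ≤ C * |s.im| ^ e := by
  have hZ : Summable (fun n : ℕ => ((n + 1 : ℕ) : ℝ) ^ (-1 - e / 2)) :=
    (summable_nat_add_iff 1).2 (Real.summable_nat_rpow.2 (by linarith))
  set Z := ∑' n : ℕ, ((n + 1 : ℕ) : ℝ) ^ (-1 - e / 2) with hZd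
  have hZ0 : 0 ≤ Z := tsum_nonneg fun n => by positivity
  refine ⟨4 * Z + 1, by positivity, ?_⟩
  intro s hs1 hs3 ht
  set T := |s.im| with hT
  set M := ⌊T⌋₊ with hM
  have hMT : (M:ℝ) ≤ T := Nat.floor_le (by linarith)
  have hMT2 : T < M + 1 := Nat.lt_floor_add_one T
  have hT0 : 0 < T := by linarith
  have hne : s ≠ 1 := by
    intro h; rw [h] at hT; simp at hT; linarith
  have hsum := rr_hasSum (by linarith : 1 / 2 < s.re) (by linarith) ht
  have hsT : T ≤ ‖s - 1‖ := by
    have := abs_im_le_norm (s - 1); simpa using this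
  have hsn : ‖s‖ ≤ 3 * T := by
    have h1 := norm_le_abs_re_add_abs_im s
    have : |s.re| ≤ 3 := by rw [abs_of_nonneg (by linarith)]; exact hs3
    linarith
  have key : riemannZeta s = ∑ n ∈ range M, ((n + 1 : ℕ) : ℂ) ^ (-s) + ((M + 1 : ℕ) : ℂ) ^ (1 - s) / (s - 1) + ∑' n, rr (n + M) s := by
    have h1 := hsum.summable.sum_add_tsum_nat_add M
    rw [hsum.tsum_eq, rr_partial M s hne] at h1
    have : s - 1 ≠ 0 := sub_ne_zero.2 hne
    linear_combination -h1
  have b1 : ‖∑ n ∈ range M, ((n + 1 : ℕ) : ℂ) ^ (-s)‖ ≤ T ^ e * Z := by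
    calc _ ≤ ∑ n ∈ range M, T ^ e * ((n + 1 : ℕ) : ℝ) ^ (-1 - e / 2) := by
          refine norm_sum_le_of_le _ fun n hn => ?_
          rw [mem_range] at hn
          rw [norm_natCast_cpow_of_pos (Nat.succ_pos n)]
          have hn1 : (1:ℝ) ≤ ((n + 1 : ℕ) : ℝ) := by exact_mod_cast Nat.succ_le_succ (Nat.zero_le n)
          have hnT : ((n + 1 : ℕ) : ℝ) ≤ T := le_trans (by exact_mod_cast hn) hMT
          calc ((n + 1 : ℕ) : ℝ) ^ (-s).re ≤ ((n + 1 : ℕ) : ℝ) ^ (e + (-1 - e / 2)) := by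
                apply Real.rpow_le_rpow_of_exponent_le hn1
                simp only [neg_re]; linarith
            _ = ((n + 1 : ℕ) : ℝ) ^ e * ((n + 1 : ℕ) : ℝ) ^ (-1 - e / 2) := Real.rpow_add (by linarith) _ _
            _ ≤ _ := by gcongr
      _ = T ^ e * ∑ n ∈ range M, ((n + 1 : ℕ) : ℝ) ^ (-1 - e / 2) := by rw [mul_sum]
      _ ≤ _ := by
          gcongr
          exact hZ.sum_le_tsum _ (fun n _ => by positivity)
  have b2 : ‖((M + 1 : ℕ) : ℂ) ^ (1 - s) / (s - 1)‖ ≤ T ^ e := by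
    rw [norm_div, norm_natCast_cpow_of_pos (Nat.succ_pos M)]
    have hM1 : (1:ℝ) ≤ ((M + 1 : ℕ) : ℝ) := by exact_mod_cast Nat.succ_le_succ (Nat.zero_le M)
    have h2 : ((M + 1 : ℕ) : ℝ) ≤ T ^ (2:ℝ) := by
      push_cast; rw [Real.rpow_two]; nlinarith
    calc _ ≤ ((M + 1 : ℕ) : ℝ) ^ (1 - s).re / 1 := by
          gcongr; linarith
      _ ≤ ((M + 1 : ℕ) : ℝ) ^ (e / 2) := by
          rw [div_one]
          apply Real.rpow_le_rpow_of_exponent_le hM1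
          simp only [sub_re, one_re]; linarith
      _ ≤ (T ^ (2:ℝ)) ^ (e / 2) := by gcongr
      _ = T ^ e := by rw [← Real.rpow_mul hT0.le]; congr 1; ring
  have b3 : ‖∑' n, rr (n + M) s‖ ≤ 3 * T ^ e * Z := by
    have hs2 : Summable (fun n : ℕ => 3 * T ^ e * ((n + M + 1 : ℕ) : ℝ) ^ (-1 - e / 2)) := by
      apply Summable.mul_left
      exact (summable_nat_add_iff M).2 hZ
    have hb : ∀ n, ‖rr (n + M) s‖ ≤ 3 * T ^ e * ((n + M + 1 : ℕ) : ℝ) ^ (-1 - e / 2) := by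
      intro n
      refine (rr_bound (n + M) (by linarith) hne).trans ?_
      have hn1 : (1:ℝ) ≤ ((n + M + 1 : ℕ) : ℝ) := by exact_mod_cast Nat.succ_le_succ (Nat.zero_le _)
      have hnT : T ≤ ((n + M + 1 : ℕ) : ℝ) := by push_cast; linarith [(Nat.cast_nonneg n : (0:ℝ) ≤ n)]
      calc ‖s‖ * ((n + M + 1 : ℕ) : ℝ) ^ (-s.re - 1) ≤ (3 * T) * ((n + M + 1 : ℕ) : ℝ) ^ ((-1 + e) + (-1 - e / 2)) := by
            gcongr
            linarith
        _ = (3 * T) * (((n + M + 1 : ℕ) : ℝ) ^ (-1 + e) * ((n + M + 1 : ℕ) : ℝ) ^ (-1 - e / 2)) := by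
            rw [Real.rpow_add (by linarith)]
        _ ≤ (3 * T) * (T ^ (-1 + e) * ((n + M + 1 : ℕ) : ℝ) ^ (-1 - e / 2)) := by
            gcongr ?_ * (?_ * ?_)
            exact Real.rpow_le_rpow_of_nonpos hT0 hnT (by linarith)
        _ = 3 * (T ^ (1:ℝ) * T ^ (-1 + e)) * ((n + M + 1 : ℕ) : ℝ) ^ (-1 - e / 2) := by rw [Real.rpow_one]; ring
        _ = _ := by rw [← Real.rpow_add hT0]; congr 3; ring
    refine (tsum_of_norm_bounded hs2.hasSum hb).trans ?_
    rw [tsum_mul_left]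
    gcongr
    have h1 := hZ.sum_add_tsum_nat_add M
    have h2 : 0 ≤ ∑ i ∈ range M, ((i + 1 : ℕ) : ℝ) ^ (-1 - e / 2) := sum_nonneg fun _ _ => by positivity
    rw [← hZd] at h1
    linarith
  rw [key]
  refine (norm_add₃_le).trans ?_
  linarith

end BVC

namespace BVC
open Finset MeasureTheory Filter Topology Complex

noncomputable def ee : ℝ := 1 / 50

lemma zeta_diffCont {c : ℂ} {r : ℝ} (h : r < |c.im|) : DiffContOnCl ℂ riemannZeta (Metric.ball c r) := by
  have h1 : ∀ z ∈ Metric.closedBall c r, z ≠ 1 := by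
    rintro z hz rfl
    rw [mem_closedBall_iff_norm] at hz
    have := abs_im_le_norm (1 - c)
    simp at this
    linarith
  refine DifferentiableOn.diffContOnCl (fun z hz => ?_)
  exact (differentiableAt_riemannZeta (h1 z (Metric.closure_ball_subset_closedBall hz))).differentiableWithinAt

/-- coordinates in a closed ball -/
lemma ball_coords {c z : ℂ} {r : ℝ} (hz : ‖z - c‖ ≤ r) : c.re - r ≤ z.re ∧ z.re ≤ c.re + r ∧
    |c.im| - r ≤ |z.im| ∧ |z.im| ≤ |c.im| + r := by
  have h1 := (abs_re_le_norm (z - c)).trans hz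
  have h2 := (abs_im_le_norm (z - c)).trans hz
  simp only [sub_re, sub_im] at h1 h2
  have h3 := (abs_sub_abs_le_abs_sub z.im c.im).trans h2
  have h4 := (abs_sub_abs_le_abs_sub c.im z.im)
  rw [abs_sub_comm] at h4
  rw [abs_le] at h1
  refine ⟨by linarith, by linarith, by linarith, by linarith⟩

lemma zeta_deriv_upper : ∃ C : ℝ, 0 < C ∧ ∀ s : ℂ, 1 - ee / 4 ≤ s.re → s.re ≤ 2 →
    3 ≤ |s.im| → ‖deriv riemannZeta s‖ ≤ C * |s.im| ^ ee := by
  obtain ⟨C, hC, h⟩ := zeta_upper (e := ee) (by norm_num [ee]) (by norm_num [ee])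
  have he : 0 < ee := by norm_num [ee]
  have he1 : ee ≤ 1 := by norm_num [ee]
  refine ⟨C * 2 / (ee / 4), by positivity, ?_⟩
  intro s h1 h2 ht
  have := norm_deriv_le_of_forall_mem_sphere_norm_le (c := s) (R := ee / 4) (C := C * (2 * |s.im| ^ ee)) (by positivity)
    (zeta_diffCont (by linarith)) ?_
  · refine this.trans (le_of_eq ?_); ring
  intro z hz
  rw [mem_sphere_iff_norm] at hz
  obtain ⟨a, b, c, d⟩ := ball_coords hz.le
  refine (h z (by linarith) (by linarith) (by linarith)).trans ?_
  gcongr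
  calc |z.im| ^ ee ≤ (2 * |s.im|) ^ ee := by gcongr; linarith
    _ = 2 ^ ee * |s.im| ^ ee := Real.mul_rpow (by norm_num) (abs_nonneg _)
    _ ≤ 2 * |s.im| ^ ee := by
        gcongr
        calc (2:ℝ) ^ ee ≤ 2 ^ (1:ℝ) := Real.rpow_le_rpow_of_exponent_le (by norm_num) he1
          _ = 2 := Real.rpow_one 2

lemma zeta_real : ∃ A : ℝ, 0 < A ∧ ∀ x : ℝ, 0 < x → x ≤ 1 → ‖riemannZeta (1 + x)‖ ≤ A / x := by
  obtain ⟨A, hA⟩ := (isCompact_Icc (a := (0:ℝ)) (b := 1)).exists_bound_of_continuousOn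
    (f := fun x : ℝ => riemannZeta₁ (1 + x)) (by
      apply Continuous.continuousOn
      have := differentiable_riemannZeta₁.continuous
      fun_prop)
  refine ⟨max A 1, by positivity, fun x hx hx1 => ?_⟩
  have hx' : (x:ℂ) ≠ 0 := by exact_mod_cast hx.ne'
  rw [riemannZeta_eq_inv_sub_mul (by simpa using hx'), norm_mul]
  have := hA x ⟨hx.le, hx1⟩
  simp only [add_sub_cancel_left, norm_inv, norm_real, Real.norm_of_nonneg hx.le]
  rw [div_eq_inv_mul]
  gcongr
  exact this.trans (le_max_left _ _)

lemma zeta_product {x : ℝ} (hx : 0 < x) (t : ℝ) :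
    1 ≤ ‖riemannZeta (1 + x)‖ ^ 3 * ‖riemannZeta (1 + x + I * t)‖ ^ 4 * ‖riemannZeta (1 + x + 2 * I * t)‖ := by
  have := DirichletCharacter.norm_LFunction_product_ge_one (N := 1) (1 : DirichletCharacter ℂ 1) hx t
  rw [DirichletCharacter.LFunctionTrivChar, DirichletCharacter.LFunction_modOne_eq, norm_mul, norm_mul, norm_pow, norm_pow, one_pow,
    DirichletCharacter.LFunction_modOne_eq] at this
  exact this

lemma zeta_lower_right : ∃ c : ℝ, 0 < c ∧ ∀ s : ℂ, 1 < s.re → s.re ≤ 2 → 2 ≤ |s.im| →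
    c * (s.re - 1) ^ 3 * |s.im| ^ (-ee) ≤ ‖riemannZeta s‖ ^ 4 := by
  obtain ⟨A, hA, hA1⟩ := zeta_real
  obtain ⟨C, hC, hC1⟩ := zeta_upper (e := ee) (by norm_num [ee]) (by norm_num [ee])
  have he : 0 < ee := by norm_num [ee]
  have he1 : ee ≤ 1 := by norm_num [ee]
  refine ⟨(A ^ 3 * (C * 2))⁻¹, by positivity, fun s h1 h2 ht => ?_⟩
  set x := s.re - 1 with hx
  have hx0 : 0 < x := by rw [hx]; linarith
  have hp := zeta_product hx0 s.im
  have e1 : (1:ℂ) + x + I * s.im = s := by apply Complex.ext <;> simp [hx]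
  rw [e1] at hp
  have b1 := hA1 x hx0 (by rw [hx]; linarith)
  have b2 := hC1 (1 + x + 2 * I * s.im) (by simp; linarith) (by simp; linarith) (by simp; linarith)
  have e2 : |((1:ℂ) + x + 2 * I * s.im).im| = 2 * |s.im| := by simp [abs_mul]
  rw [e2] at b2
  have hT : 0 < |s.im| := by linarith
  have b3 : (2 * |s.im|) ^ ee ≤ 2 * |s.im| ^ ee := by
    calc _ = 2 ^ ee * |s.im| ^ ee := Real.mul_rpow (by norm_num) (abs_nonneg _)
    _ ≤ 2 * |s.im| ^ ee := by
        gcongr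
        calc (2:ℝ) ^ ee ≤ 2 ^ (1:ℝ) := Real.rpow_le_rpow_of_exponent_le (by norm_num) he1
          _ = 2 := Real.rpow_one 2
  have b4 : 1 ≤ (A / x) ^ 3 * ‖riemannZeta s‖ ^ 4 * (C * (2 * |s.im| ^ ee)) := by
    refine hp.trans ?_
    gcongr
    exact b2.trans (by gcongr)
  have hTe : 0 < |s.im| ^ ee := by positivity
  rw [Real.rpow_neg hT.le]
  calc (A ^ 3 * (C * 2))⁻¹ * x ^ 3 * (|s.im| ^ ee)⁻¹ = (A ^ 3 * (C * 2))⁻¹ * x ^ 3 * (|s.im| ^ ee)⁻¹ * 1 := by ring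
    _ ≤ (A ^ 3 * (C * 2))⁻¹ * x ^ 3 * (|s.im| ^ ee)⁻¹ * ((A / x) ^ 3 * ‖riemannZeta s‖ ^ 4 * (C * (2 * |s.im| ^ ee))) := by gcongr
    _ = _ := by field_simp

/-- zero-free strip with lower bound -/
lemma zeta_lower : ∃ c k : ℝ, 0 < c ∧ 0 < k ∧ k ≤ ee / 4 ∧ ∀ s : ℂ, 3 ≤ |s.im| → 1 - k * |s.im| ^ (-5 * ee) ≤ s.re → s.re ≤ 2 →
    c * |s.im| ^ (-4 * ee) ≤ ‖riemannZeta s‖ := by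
  obtain ⟨c0, hc0, hlow⟩ := zeta_lower_right
  obtain ⟨C1, hC1, hder⟩ := zeta_deriv_upper
  have he : 0 < ee := by norm_num [ee]
  have he1 : ee ≤ 1 := by norm_num [ee]
  set k := min (ee / 4) (c0 / (256 * C1 ^ 4)) with hk
  have hk0 : 0 < k := by rw [hk]; positivity
  set b := (c0 * k ^ 3) ^ (1 / 4 : ℝ) with hb
  have hb0 : 0 < b := by positivity
  have hb4 : b ^ 4 = c0 * k ^ 3 := by
    rw [hb, ← Real.rpow_natCast, ← Real.rpow_mul (by positivity)]; norm_num
  have hbk : 4 * C1 * k ≤ b := by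
    have : (4 * C1 * k) ^ 4 ≤ b ^ 4 := by
      rw [hb4]
      have h1 : k ≤ c0 / (256 * C1 ^ 4) := min_le_right _ _
      rw [le_div_iff₀ (by positivity)] at h1
      calc (4 * C1 * k) ^ 4 = (k * (256 * C1 ^ 4)) * k ^ 3 := by ring
        _ ≤ _ := by gcongr
    exact le_of_pow_le_pow_left₀ (by norm_num) hb0.le this
  refine ⟨b / 2, k, by positivity, hk0, min_le_left _ _, ?_⟩
  -- right part
  have hright : ∀ s : ℂ, 3 ≤ |s.im| → 1 + k * |s.im| ^ (-5 * ee) ≤ s.re → s.re ≤ 2 → b * |s.im| ^ (-4 * ee) ≤ ‖riemannZeta s‖ := by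
    intro s ht h1 h2
    have hT : 0 < |s.im| := by linarith
    have hd : 0 < k * |s.im| ^ (-5 * ee) := by positivity
    have h3 := hlow s (by linarith) h2 (by linarith)
    apply le_of_pow_le_pow_left₀ (n := 4) (by norm_num) (norm_nonneg _)
    refine le_trans ?_ h3
    have e0 : (|s.im| ^ (-4 * ee)) ^ 4 = (|s.im| ^ (-5 * ee)) ^ 3 * |s.im| ^ (-ee) := by
      rw [← Real.rpow_natCast, ← Real.rpow_natCast, ← Real.rpow_mul hT.le, ← Real.rpow_mul hT.le, ← Real.rpow_add hT]
      congr 1; push_cast; ring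
    calc (b * |s.im| ^ (-4 * ee)) ^ 4 = c0 * (k * |s.im| ^ (-5 * ee)) ^ 3 * |s.im| ^ (-ee) := by
          rw [mul_pow, hb4, e0]; ring
      _ ≤ _ := by
          gcongr
          linarith
  intro s ht h1 h2
  have hT : 0 < |s.im| := by linarith
  set δ := k * |s.im| ^ (-5 * ee) with hδ
  have hδ0 : 0 < δ := by positivity
  have hp1 : |s.im| ^ (-5 * ee) ≤ 1 := Real.rpow_le_one_of_one_le_of_nonpos (by linarith) (by linarith)
  have hδk : δ ≤ ee / 4 := by
    calc δ ≤ k * 1 := by rw [hδ]; gcongr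
      _ ≤ _ := by rw [mul_one]; exact min_le_left _ _
  have hX : 0 < |s.im| ^ (-4 * ee) := by positivity
  by_cases hs : 1 + δ ≤ s.re
  · refine le_trans ?_ (hright s ht hs h2)
    nlinarith [mul_pos hb0 hX]
  · rw [not_le] at hs
    set z : ℂ := ⟨1 + δ, s.im⟩ with hz
    have hz1 := hright z ht le_rfl (by simp [hz]; linarith)
    simp only [hz] at hz1
    rw [← hz] at hz1
    set K : Set ℂ := {w | w.im = s.im ∧ 1 - ee / 4 ≤ w.re ∧ w.re ≤ 2} with hK
    have hconv : Convex ℝ K := by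
      intro x hx y hy a b ha hb hab
      obtain ⟨x1, x2, x3⟩ := hx
      obtain ⟨y1, y2, y3⟩ := hy
      simp only [hK, Set.mem_ofPred_eq, add_im, add_re, real_smul, mul_im, mul_re, ofReal_re, ofReal_im, zero_mul, add_zero, sub_zero]
      refine ⟨?_, ?_, ?_⟩
      · rw [x1, y1, ← add_mul, hab, one_mul]
      · nlinarith
      · nlinarith
    have hmvt := hconv.norm_image_sub_le_of_norm_deriv_le (f := riemannZeta) (C := C1 * |s.im| ^ ee) (x := z) (y := s)
      (fun w hw => differentiableAt_riemannZeta (by rintro rfl; have := hw.1; rw [← this] at hT; simp at hT))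
      (fun w hw => by have := hder w hw.2.1 hw.2.2 (by rw [hw.1]; exact ht); rwa [hw.1] at this)
      ⟨rfl, by simp [hz]; linarith, by simp [hz]; linarith⟩ ⟨rfl, by linarith, h2⟩
    have hd : ‖s - z‖ ≤ 2 * δ := by
      have : s - z = ((s.re - (1 + δ) : ℝ) : ℂ) := by apply Complex.ext <;> simp [hz]
      rw [this, norm_real, Real.norm_eq_abs, abs_le]; constructor <;> linarith
    have hfin : C1 * |s.im| ^ ee * ‖s - z‖ ≤ 2 * C1 * k * |s.im| ^ (-4 * ee) := by
      calc _ ≤ C1 * |s.im| ^ ee * (2 * δ) := by gcongr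
        _ = 2 * C1 * k * (|s.im| ^ ee * |s.im| ^ (-5 * ee)) := by rw [hδ]; ring
        _ = _ := by rw [← Real.rpow_add hT]; congr 2; ring
    have htri : ‖riemannZeta z‖ - ‖riemannZeta s - riemannZeta z‖ ≤ ‖riemannZeta s‖ := by
      have := norm_sub_norm_le (riemannZeta z) (riemannZeta s)
      rw [norm_sub_rev] at this
      linarith
    nlinarith

noncomputable def G1 (s : ℂ) : ℂ := -deriv riemannZeta₁ s / riemannZeta₁ s - riemannZeta₀ s

lemma z1_eq {s : ℂ} (hs : s ≠ 1) : riemannZeta₁ s = (s - 1) * riemannZeta s := by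
  rw [riemannZeta_eq_inv_sub_mul hs]
  have := sub_ne_zero.2 hs
  field_simp

lemma G1_eq {s : ℂ} (hs : s ≠ 1) (hz : riemannZeta s ≠ 0) : G1 s = -deriv riemannZeta s / riemannZeta s - riemannZeta s := by
  have h1 : deriv riemannZeta₁ s = riemannZeta s + (s - 1) * deriv riemannZeta s := by
    have : riemannZeta₁ =ᶠ[𝓝 s] fun z => (z - 1) * riemannZeta z := by
      filter_upwards [compl_singleton_mem_nhds hs] with z hz
      exact z1_eq hz
    rw [this.deriv_eq, deriv_fun_mul (by fun_prop) (differentiableAt_riemannZeta hs)]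
    simp
  have h2 := riemannZeta_eq_inv_sub_add hs
  have h3 : riemannZeta₀ s = riemannZeta s - (s - 1)⁻¹ := by rw [h2]; ring
  have := sub_ne_zero.2 hs
  rw [G1, h1, z1_eq hs, h3]
  field_simp
  ring

lemma z1_ne {s : ℂ} (hs : 1 ≤ s.re) : riemannZeta₁ s ≠ 0 := by
  by_cases h : s = 1
  · rw [h]; simp
  · rw [z1_eq h]
    exact mul_ne_zero (sub_ne_zero.2 h) (riemannZeta_ne_zero_of_one_le_re hs)

lemma G1_analytic {s : ℂ} (hs : riemannZeta₁ s ≠ 0) : AnalyticAt ℂ G1 s := by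
  have h1 : AnalyticAt ℂ riemannZeta₁ s := differentiable_riemannZeta₁.analyticAt s
  have h0 : AnalyticAt ℂ riemannZeta₀ s := differentiable_riemannZeta₀.analyticAt s
  exact ((h1.deriv.neg).div h1 hs).sub h0

lemma G1_small (B : ℝ) : ∃ C : ℝ, ∀ s : ℂ, 1 ≤ s.re → s.re ≤ 2 → |s.im| ≤ B → ‖iteratedDeriv 4 G1 s‖ ≤ C := by
  have hc : IsCompact (Set.Icc (1:ℝ) 2 ×ℂ Set.Icc (-B) B) := isCompact_Icc.reProdIm isCompact_Icc
  obtain ⟨C, hC⟩ := hc.exists_bound_of_continuousOn (f := iteratedDeriv 4 G1) (by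
    intro s hs
    have : AnalyticAt ℂ G1 s := G1_analytic (z1_ne hs.1.1)
    have h2 := this.iterated_deriv 4
    rw [← iteratedDeriv_eq_iterate] at h2
    exact h2.continuousAt.continuousWithinAt)
  exact ⟨C, fun s h1 h2 h3 => hC s ⟨⟨h1, h2⟩, abs_le.1 h3⟩⟩

lemma G1_large : ∃ C : ℝ, 0 < C ∧ ∀ s : ℂ, 1 ≤ s.re → s.re ≤ 3 / 2 → 4 ≤ |s.im| → ‖iteratedDeriv 4 G1 s‖ ≤ C * |s.im| ^ (1 / 2 : ℝ) := by
  obtain ⟨c, k, hc, hk, hke, hlow⟩ := zeta_lower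
  obtain ⟨C0, hC0, hup⟩ := zeta_upper (e := ee) (by norm_num [ee]) (by norm_num [ee])
  obtain ⟨C1, hC1, hder⟩ := zeta_deriv_upper
  have he : 0 < ee := by norm_num [ee]
  have he1 : ee ≤ 1 / 50 := by norm_num [ee]
  set C5 := C1 / c + C0 with hC5
  have hG : ∀ s : ℂ, 3 ≤ |s.im| → 1 - k * |s.im| ^ (-5 * ee) ≤ s.re → s.re ≤ 2 → s ≠ 1 ∧ riemannZeta s ≠ 0 ∧ ‖G1 s‖ ≤ C5 * |s.im| ^ (5 * ee) := by
    intro s ht h1 h2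
    have hT : 0 < |s.im| := by linarith
    have hs1 : s ≠ 1 := by rintro rfl; simp at hT
    have hl := hlow s ht h1 h2
    have hl0 : 0 < c * |s.im| ^ (-4 * ee) := by positivity
    have hz : riemannZeta s ≠ 0 := norm_pos_iff.1 (hl0.trans_le hl)
    refine ⟨hs1, hz, ?_⟩
    have hp1 : |s.im| ^ (-5 * ee) ≤ 1 := Real.rpow_le_one_of_one_le_of_nonpos (by linarith) (by linarith)
    have hre : 1 - ee / 4 ≤ s.re := by nlinarith
    rw [G1_eq hs1 hz]
    refine (norm_sub_le _ _).trans ?_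
    rw [norm_div, norm_neg, hC5, add_mul]
    have a1 := hder s hre h2 ht
    have a2 := hup s (by linarith) (by linarith) (by linarith)
    refine add_le_add ?_ (a2.trans ?_)
    · calc _ ≤ C1 * |s.im| ^ ee / (c * |s.im| ^ (-4 * ee)) := by gcongr
        _ = C1 / c * (|s.im| ^ ee / |s.im| ^ (-4 * ee)) := by field_simp
        _ = _ := by rw [← Real.rpow_sub hT]; congr 2; ring
    · gcongr
      · linarith
      · linarith
  refine ⟨Nat.factorial 4 * (C5 * 2 ^ (5 * ee)) / (k * 2 ^ (-5 * ee)) ^ 4, by positivity, ?_⟩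
  intro s h1 h2 ht
  set T := |s.im| with hTd
  have hT : 0 < T := by linarith
  set r := k * (2 * T) ^ (-5 * ee) with hr
  have hr0 : 0 < r := by positivity
  have hp1 : (2 * T) ^ (-5 * ee) ≤ 1 := Real.rpow_le_one_of_one_le_of_nonpos (by linarith) (by linarith)
  have hr1 : r ≤ 1 / 2 := by nlinarith
  have hin : ∀ z ∈ Metric.closedBall s r, z ≠ 1 ∧ riemannZeta z ≠ 0 ∧ ‖G1 z‖ ≤ C5 * (2 * T) ^ (5 * ee) := by
    intro z hz
    rw [mem_closedBall_iff_norm] at hz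
    obtain ⟨a1, a2, a3, a4⟩ := ball_coords hz
    rw [← hTd] at a3 a4
    have hz0 : 0 < |z.im| := by linarith
    have hcmp : (2 * T) ^ (-5 * ee) ≤ |z.im| ^ (-5 * ee) :=
      Real.rpow_le_rpow_of_nonpos hz0 (by linarith) (by linarith)
    obtain ⟨g1, g2, g3⟩ := hG z (by linarith) (by
      have : r ≤ k * |z.im| ^ (-5 * ee) := by rw [hr]; gcongr
      linarith) (by linarith)
    refine ⟨g1, g2, g3.trans ?_⟩
    gcongr
    linarith
  have hcau := norm_iteratedDeriv_le_of_forall_mem_sphere_norm_le (c := s) (R := r) (f := G1) (C := C5 * (2 * T) ^ (5 * ee)) 4 hr0 ?_ ?_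
  · refine hcau.trans (le_of_eq ?_)
    rw [hr, Real.mul_rpow (by norm_num) hT.le, Real.mul_rpow (by norm_num) hT.le]
    have e1 : T ^ (5 * ee) = T ^ (1 / 2 : ℝ) * (T ^ (-5 * ee)) ^ 4 := by
      rw [← Real.rpow_natCast, ← Real.rpow_mul hT.le, ← Real.rpow_add hT]
      congr 1; norm_num [ee]
    rw [e1]
    have : T ^ (-5 * ee) ≠ 0 := by positivity
    field_simp
  · refine DifferentiableOn.diffContOnCl (fun z hz => ?_)
    obtain ⟨g1, g2, -⟩ := hin z (Metric.closure_ball_subset_closedBall hz)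
    refine (G1_analytic ?_).differentiableAt.differentiableWithinAt
    rw [z1_eq g1]
    exact mul_ne_zero (sub_ne_zero.2 g1) g2
  · intro z hz
    exact (hin z (Metric.sphere_subset_closedBall hz)).2.2

theorem G1_bound : ∃ C : ℝ, 0 < C ∧ ∀ s : ℂ, 1 ≤ s.re → s.re ≤ 3 / 2 → ‖iteratedDeriv 4 G1 s‖ ≤ C * (1 + |s.im|) ^ (1 / 2 : ℝ) := by
  obtain ⟨C, hC, h1⟩ := G1_large
  obtain ⟨D, h2⟩ := G1_small 4
  refine ⟨C + |D|, by positivity, fun s hs1 hs2 => ?_⟩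
  have h0 : (1:ℝ) ≤ (1 + |s.im|) ^ (1 / 2 : ℝ) := Real.one_le_rpow (by linarith [abs_nonneg s.im]) (by norm_num)
  rcases le_total 4 |s.im| with h | h
  · calc _ ≤ C * |s.im| ^ (1 / 2 : ℝ) := h1 s hs1 hs2 h
      _ ≤ (C + |D|) * (1 + |s.im|) ^ (1 / 2 : ℝ) := by
        gcongr
        · linarith [abs_nonneg D]
        · linarith
  · have a := h2 s hs1 (by linarith) h
    nlinarith [le_abs_self D, abs_nonneg D]

end BVC

namespace BVC
open Finset MeasureTheory Filter Topology Complex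

lemma mellin_lg {s : ℂ} (hs : 0 < s.re) :
    MellinConvergent (fun u : ℝ => Real.log u • Set.indicator (Set.Ioc 0 1) (fun _ => (1:ℂ)) u) s ∧
    mellin (fun u : ℝ => Real.log u • Set.indicator (Set.Ioc 0 1) (fun _ => (1:ℂ)) u) s = - (1 / s ^ 2) := by
  have h := mellin_hasDerivAt_of_isBigO_rpow (a := s.re + 1) (b := 0) (s := s)
    (f := Set.indicator (Set.Ioc 0 1) (fun _ => (1:ℂ))) ?_ ?_ (by linarith) ?_ hs
  · refine ⟨h.1, ?_⟩
    have h2 : mellin (Set.indicator (Set.Ioc 0 1) (fun _ => (1:ℂ))) =ᶠ[𝓝 s] fun z => 1 / z := by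
      filter_upwards [(isOpen_lt continuous_const continuous_re).mem_nhds hs] with z hz
      exact (hasMellin_one_Ioc hz).2
    have hs0 : s ≠ 0 := by rintro rfl; simp at hs
    have h3 : HasDerivAt (fun z : ℂ => 1 / z) (-(1 / s ^ 2)) s := by
      simp only [one_div]
      exact hasDerivAt_inv hs0
    exact h.2.unique (h3.congr_of_eventuallyEq h2)
  · apply LocallyIntegrable.locallyIntegrableOn
    exact (locallyIntegrable_const (1:ℂ)).indicator measurableSet_Ioc
  · apply Asymptotics.IsBigO.trans (g := fun _ : ℝ => (0:ℝ)) _ (Asymptotics.isBigO_zero _ _)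
    rw [Asymptotics.isBigO_zero_right_iff]
    filter_upwards [eventually_gt_atTop 1] with u hu
    simp [Set.indicator, hu]
  · simp only [neg_zero, Real.rpow_zero]
    apply Asymptotics.IsBigO.of_bound 1
    refine Eventually.of_forall fun u => ?_
    by_cases h : u ∈ Set.Ioc (0:ℝ) 1 <;> simp [Set.indicator, h] 

lemma nsq (σ t : ℝ) : ‖(σ + t * I : ℂ) ^ 2‖ = σ ^ 2 + t ^ 2 := by
  rw [norm_pow, Complex.sq_norm, Complex.normSq_apply]
  simp; ring

lemma int_inv_sq {σ : ℝ} (hσ : 1 ≤ σ) : Integrable (fun t : ℝ => (σ ^ 2 + t ^ 2)⁻¹) := by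
  refine integrable_inv_one_add_sq.mono' ?_ ?_
  · apply Continuous.aestronglyMeasurable
    apply Continuous.inv₀ (by fun_prop)
    intro t; positivity
  · refine Eventually.of_forall fun t => ?_
    rw [Real.norm_of_nonneg (by positivity)]
    gcongr
    nlinarith

lemma cne {σ : ℝ} (hσ : 1 ≤ σ) (t : ℝ) : (σ + t * I : ℂ) ≠ 0 := by
  intro h
  have := congrArg Complex.re h
  simp at this
  linarith

lemma perron {σ : ℝ} (hσ : 1 ≤ σ) {y : ℝ} (hy : 0 < y) :
    ((Real.posLog y : ℝ) : ℂ) = (1 / (2 * Real.pi) : ℝ) * ∫ t : ℝ, (y : ℂ) ^ (σ + t * I : ℂ) / (σ + t * I : ℂ) ^ 2 := by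
  set f : ℝ → ℂ := fun u : ℝ => Real.log u • Set.indicator (Set.Ioc 0 1) (fun _ => (1:ℂ)) u with hf
  have hfe : ∀ u : ℝ, 0 < u → f u = - (Real.posLog (u⁻¹) : ℂ) := by
    intro u hu
    by_cases h : u ≤ 1
    · simp only [hf, Set.indicator, Set.mem_Ioc, hu, h, and_self, if_true]
      rw [Real.posLog_eq_log]
      · simp
      · rw [abs_of_pos (by positivity)]; exact (one_le_inv₀ hu).2 h
    · simp only [hf, Set.indicator, Set.mem_Ioc, h, and_false, if_false]
      rw [(Real.posLog_eq_zero_iff _).2]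
      · simp
      · rw [abs_of_pos (by positivity)]; push Not at h; exact inv_le_one_of_one_le₀ h.le
  have hm : ∀ t : ℝ, mellin f (σ + t * I) = - (1 / (σ + t * I : ℂ) ^ 2) := fun t =>
    (mellin_lg (s := σ + t * I) (by simp; linarith)).2
  have key := mellinInv_mellin_eq σ f (x := y⁻¹) (by positivity) (mellin_lg (s := σ) (by simp; linarith)).1 ?_ ?_
  · rw [hfe _ (by positivity), inv_inv, mellinInv] at key
    simp only [hm, real_smul, smul_eq_mul] at key
    rw [← neg_inj, ← key, ← mul_neg, ← integral_neg]
    push_cast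
    congr 1
    apply integral_congr_ae
    refine Eventually.of_forall fun t => ?_
    simp only
    rw [cpow_neg, inv_cpow _ _ (by rw [arg_ofReal_of_nonneg hy.le]; exact Real.pi_ne_zero.symm), inv_inv]
    ring
  · unfold VerticalIntegrable
    simp only [hm]
    refine (int_inv_sq hσ).mono' ?_ ?_
    · apply Continuous.aestronglyMeasurable
      apply Continuous.neg
      apply Continuous.div (by fun_prop) (by fun_prop)
      intro t; exact pow_ne_zero _ (cne hσ t)
    · refine Eventually.of_forall fun t => ?_
      rw [norm_neg, norm_div, nsq]; simp
  · have : f =ᶠ[𝓝 y⁻¹] fun u => - (Real.posLog (u⁻¹) : ℂ) := by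
      filter_upwards [lt_mem_nhds (show 0 < y⁻¹ by positivity)] with u hu using hfe u hu
    refine ContinuousAt.congr ?_ this.symm
    have h1 : ContinuousAt (fun u : ℝ => u⁻¹) y⁻¹ := continuousAt_inv₀ (by positivity)
    have h2 : Continuous (fun u : ℝ => - (Real.posLog u : ℂ)) := by
      have := Real.continuous_posLog
      fun_prop
    exact ContinuousAt.comp (g := fun u : ℝ => - (Real.posLog u : ℂ)) h2.continuousAt h1

noncomputable def f0 : ℕ → ℂ := fun n => (vM n : ℂ) - 1
noncomputable def f4 : ℕ → ℂ := LSeries.logMul^[4] f0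

lemma f4_eq (n : ℕ) : f4 n = (((vM n - 1) * Real.log n ^ 4 : ℝ) : ℂ) := by
  simp only [f4, Function.iterate_succ, Function.iterate_zero, Function.comp, id, LSeries.logMul, f0]
  rw [← natCast_log]
  push_cast
  ring

lemma f0_summable {s : ℂ} (hs : 1 < s.re) : LSeriesSummable f0 s :=
  (ArithmeticFunction.LSeriesSummable_vonMangoldt hs).sub (LSeriesSummable_one_iff.2 hs)

lemma f0_LSeries {s : ℂ} (hs : 1 < s.re) : LSeries f0 s = G1 s := by
  have h1 := LSeries_sub (ArithmeticFunction.LSeriesSummable_vonMangoldt hs) (LSeriesSummable_one_iff.2 hs)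
  rw [ArithmeticFunction.LSeries_vonMangoldt_eq_deriv_riemannZeta_div hs, LSeries_one_eq_riemannZeta hs] at h1
  rw [G1_eq (by rintro rfl; simp at hs) (riemannZeta_ne_zero_of_one_lt_re hs), ← h1]
  rfl

lemma f0_abs {s : ℂ} (hs : 1 < s.re) : LSeries.abscissaOfAbsConv f0 < s.re := by
  obtain ⟨r, h1, h2⟩ := exists_between hs
  refine lt_of_le_of_lt (LSeriesSummable.abscissaOfAbsConv_le (s := (r:ℂ)) (f0_summable (by simpa using h1))) ?_
  simpa using h2

lemma f4_LSeries {s : ℂ} (hs : 1 < s.re) : LSeries f4 s = iteratedDeriv 4 G1 s := by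
  have h := LSeries_iteratedDeriv 4 (f0_abs hs)
  have h2 : LSeries f0 =ᶠ[𝓝 s] G1 := by
    filter_upwards [(isOpen_lt continuous_const continuous_re).mem_nhds hs] with z hz using f0_LSeries hz
  rw [← h2.iteratedDeriv_eq, h]
  rw [f4]
  norm_num

lemma f4_summable {s : ℂ} (hs : 1 < s.re) : LSeriesSummable f4 s := by
  apply LSeriesSummable_of_abscissaOfAbsConv_lt_re
  rw [f4, LSeries.absicssaOfAbsConv_logPowMul]
  exact f0_abs hs

noncomputable def R4 (x : ℝ) : ℝ := ∑ n ∈ Ioc 0 ⌊x⌋₊, (vM n - 1) * Real.log n ^ 4 * Real.posLog (x / n)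

lemma R4_eq {x : ℝ} (hx : 0 < x) {σ : ℝ} (hσ : 1 < σ) :
    (R4 x : ℂ) = (1 / (2 * Real.pi) : ℝ) * ∫ t : ℝ, (x : ℂ) ^ (σ + t * I : ℂ) / (σ + t * I : ℂ) ^ 2 * LSeries f4 (σ + t * I) := by
  set F : ℕ → ℝ → ℂ := fun n t => (x : ℂ) ^ (σ + t * I : ℂ) / (σ + t * I : ℂ) ^ 2 * LSeries.term f4 (σ + t * I) n with hF
  have hx0 : (x:ℂ) ≠ 0 := by exact_mod_cast hx.ne'
  have hFn : ∀ n t, ‖F n t‖ = x ^ σ * ‖LSeries.term f4 σ n‖ * (σ ^ 2 + t ^ 2)⁻¹ := by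
    intro n t
    simp only [hF]
    rw [norm_mul, norm_div, nsq, norm_cpow_eq_rpow_re_of_pos hx]
    rw [LSeries.norm_term_eq, LSeries.norm_term_eq]
    simp
    ring
  have hFi : ∀ n, Integrable (F n) := by
    intro n
    refine ((int_inv_sq hσ.le).const_mul (x ^ σ * ‖LSeries.term f4 σ n‖)).mono' ?_ (Eventually.of_forall fun t => (hFn n t).le)
    apply Continuous.aestronglyMeasurable
    simp only [hF]
    apply Continuous.mul
    · apply Continuous.div
      · exact Continuous.const_cpow (by fun_prop) (Or.inl hx0)
      · fun_prop
      · intro t; exact pow_ne_zero _ (cne hσ.le t)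
    · by_cases hn : n = 0
      · simp [hn, LSeries.term_zero]; fun_prop
      · simp only [LSeries.term_of_ne_zero hn]
        have : (n:ℂ) ≠ 0 := by exact_mod_cast hn
        apply Continuous.div (by fun_prop)
        · exact Continuous.const_cpow (by fun_prop) (Or.inl this)
        · intro t; simp [cpow_eq_zero_iff, this]
  have hS := hasSum_integral_of_summable_integral_norm hFi (by
    simp only [hFn, integral_const_mul]
    apply Summable.mul_right
    apply Summable.mul_left
    exact (f4_summable (s := σ) (by simpa using hσ)).norm)
  have e1 : ∀ t, ∑' n, F n t = (x : ℂ) ^ (σ + t * I : ℂ) / (σ + t * I : ℂ) ^ 2 * LSeries f4 (σ + t * I) := by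
    intro t
    simp only [hF, tsum_mul_left]; rfl
  simp only [e1] at hS
  have hS2 := hS.mul_left ((1 / (2 * Real.pi) : ℝ) : ℂ)
  have e2 : ∀ n : ℕ, ((1 / (2 * Real.pi) : ℝ) : ℂ) * ∫ t, F n t = (((vM n - 1) * Real.log n ^ 4 * Real.posLog (x / n) : ℝ) : ℂ) := by
    intro n
    by_cases hn : n = 0
    · subst hn
      simp [hF]
    · have hn' : (0:ℝ) < n := by exact_mod_cast Nat.pos_of_ne_zero hn
      have hp := perron hσ.le (y := x / n) (by positivity)
      rw [ofReal_mul, hp, ← f4_eq]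
      have : ∀ t, F n t = f4 n * (((x / n : ℝ) : ℂ) ^ (σ + t * I : ℂ) / (σ + t * I : ℂ) ^ 2) := by
        intro t
        simp only [hF, LSeries.term_of_ne_zero hn]
        rw [ofReal_div, div_cpow_ofReal_nonneg hx.le hn'.le, ofReal_natCast]
        ring
      simp only [this, integral_const_mul]
      ring
  simp only [e2] at hS2
  have h3 : HasSum (fun n : ℕ => (((vM n - 1) * Real.log n ^ 4 * Real.posLog (x / n) : ℝ) : ℂ)) (R4 x : ℂ) := by
    rw [R4, ofReal_sum]
    apply hasSum_sum_of_ne_finset_zero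
    intro n hn
    by_cases hn0 : n = 0
    · simp [hn0]
    · rw [pl_zero hx.le]
      · simp
      · simp at hn; omega
  exact h3.unique hS2

lemma R4_bound : ∃ C : ℝ, 0 < C ∧ ∀ x : ℝ, Real.exp 2 ≤ x → |R4 x| ≤ C * x := by
  obtain ⟨C, hC, hG⟩ := G1_bound
  set J := ∫ t : ℝ, 2 * (1 + ‖t‖) ^ (-(3/2:ℝ)) with hJ
  have hJi : Integrable (fun t : ℝ => 2 * (1 + ‖t‖) ^ (-(3/2:ℝ))) :=
    (integrable_one_add_norm (by simp; norm_num)).const_mul 2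
  have hJ0 : 0 ≤ J := integral_nonneg fun t => by positivity
  refine ⟨Real.exp 1 * C * (J + 1), by positivity, fun x hx => ?_⟩
  have hx0 : 0 < x := (Real.exp_pos 2).trans_le hx
  have hl : 2 ≤ Real.log x := by rwa [Real.le_log_iff_exp_le hx0]
  set σ := 1 + 1 / Real.log x with hσ
  have hσ1 : 1 < σ := by rw [hσ]; have : 0 < 1 / Real.log x := by positivity
                         linarith
  have hσ2 : σ ≤ 3 / 2 := by
    have : 1 / Real.log x ≤ 1 / 2 := by gcongr
    rw [hσ]; linarith
  have hxs : x ^ σ = Real.exp 1 * x := by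
    rw [hσ, Real.rpow_add hx0, Real.rpow_one, mul_comm, Real.rpow_def_of_pos hx0]
    congr 2; field_simp
  have h := R4_eq hx0 hσ1
  have h1 : |R4 x| = ‖(R4 x : ℂ)‖ := by simp
  rw [h1, h, norm_mul]
  have hpi : ‖((1 / (2 * Real.pi) : ℝ) : ℂ)‖ ≤ 1 := by
    rw [norm_real, Real.norm_of_nonneg (by positivity), div_le_one (by positivity)]
    linarith [Real.pi_gt_three]
  have hb : ∀ t : ℝ, ‖(x : ℂ) ^ (σ + t * I : ℂ) / (σ + t * I : ℂ) ^ 2 * LSeries f4 (σ + t * I)‖ ≤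
      Real.exp 1 * x * C * (2 * (1 + ‖t‖) ^ (-(3/2:ℝ))) := by
    intro t
    rw [norm_mul, norm_div, nsq, norm_cpow_eq_rpow_re_of_pos hx0, f4_LSeries (by simpa using hσ1)]
    have := hG (σ + t * I) (by simpa using hσ1.le) (by simpa using hσ2)
    simp only [add_re, ofReal_re, mul_re, I_re, mul_zero, ofReal_im, I_im, mul_one, sub_self, add_zero, add_im, mul_im, zero_add] at this ⊢
    rw [hxs]
    have hq : (0:ℝ) < 1 + |t| := by positivity
    have k1 : (σ ^ 2 + t ^ 2)⁻¹ ≤ 2 * (1 + |t|) ^ (-2:ℝ) := by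
      rw [Real.rpow_neg hq.le, Real.rpow_ofNat]
      rw [inv_le_comm₀ (by positivity) (by positivity)]
      rw [mul_inv, inv_inv]
      nlinarith [sq_nonneg (|t| - 1), sq_abs t]
    calc Real.exp 1 * x / (σ ^ 2 + t ^ 2) * ‖iteratedDeriv 4 G1 (σ + t * I)‖
        ≤ Real.exp 1 * x * (2 * (1 + |t|) ^ (-2:ℝ)) * (C * (1 + |t|) ^ (1/2:ℝ)) := by
          rw [div_eq_mul_inv]; gcongr
      _ = Real.exp 1 * x * C * (2 * ((1 + |t|) ^ (-2:ℝ) * (1 + |t|) ^ (1/2:ℝ))) := by ring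
      _ = _ := by rw [← Real.rpow_add hq, Real.norm_eq_abs]; norm_num
  have hI := norm_integral_le_of_norm_le (hJi.const_mul (Real.exp 1 * x * C)) (Eventually.of_forall hb)
  rw [integral_const_mul, ← hJ] at hI
  calc _ ≤ 1 * (Real.exp 1 * x * C * J) := by gcongr
    _ ≤ Real.exp 1 * x * C * (J + 1) := by rw [one_mul]; gcongr; linarith
    _ = _ := by ring

end BVC

namespace BVC
open Finset MeasureTheory Filter Topology Complex

noncomputable def sm (a : ℕ → ℝ) (y : ℝ) : ℝ := ∑ n ∈ Ioc 0 ⌊y⌋₊, a n * Real.posLog (y / n)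
noncomputable def su (a : ℕ → ℝ) (y : ℝ) : ℝ := ∑ n ∈ Ioc 0 ⌊y⌋₊, a n

lemma sm_ext (a : ℕ → ℝ) {x y : ℝ} (hx : 0 < x) (hxy : x ≤ y) :
    sm a x = ∑ n ∈ Ioc 0 ⌊y⌋₊, a n * Real.posLog (x / n) := by
  rw [sm]
  apply sum_subset (Ioc_subset_Ioc_right (Nat.floor_mono hxy))
  intro n hn hn'
  rw [pl_zero hx.le, mul_zero]
  simp at hn hn'
  omega

lemma pl_diff {x y : ℝ} (hx : 0 < x) (hxy : x ≤ y) {n : ℕ} (hn : 0 < n) :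
    0 ≤ Real.posLog (y / n) - Real.posLog (x / n) ∧
    Real.posLog (y / n) - Real.posLog (x / n) ≤ Real.log (y / x) ∧
    ((n:ℝ) ≤ x → Real.posLog (y / n) - Real.posLog (x / n) = Real.log (y / x)) := by
  have hn' : (0:ℝ) < n := by exact_mod_cast hn
  have hy : 0 < y := hx.trans_le hxy
  have h1 : Real.log x ≤ Real.log y := Real.log_le_log hx hxy
  rw [Real.posLog, Real.posLog, Real.log_div hy.ne' hn'.ne', Real.log_div hx.ne' hn'.ne', Real.log_div hy.ne' hx.ne']
  refine ⟨?_, ?_, fun h => ?_⟩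
  · have := max_le_max (le_refl 0) (show Real.log x - Real.log n ≤ Real.log y - Real.log n by linarith)
    linarith
  · have : max 0 (Real.log y - Real.log n) ≤ max 0 (Real.log x - Real.log n) + (Real.log y - Real.log x) := by
      apply max_le
      · have := le_max_left 0 (Real.log x - Real.log n); linarith
      · have := le_max_right 0 (Real.log x - Real.log n); linarith
    linarith
  · have := Real.log_le_log hn' h
    rw [max_eq_right (by linarith), max_eq_right (by linarith)]; ring

lemma sm_lower (a : ℕ → ℝ) (ha : ∀ n, 0 ≤ a n) {x y : ℝ} (hx : 0 < x) (hxy : x ≤ y) :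
    Real.log (y / x) * su a x ≤ sm a y - sm a x := by
  rw [sm_ext a hx hxy, sm, ← sum_sub_distrib, su, mul_sum]
  calc _ ≤ ∑ n ∈ Ioc 0 ⌊x⌋₊, (a n * Real.posLog (y / n) - a n * Real.posLog (x / n)) := by
        apply sum_le_sum
        intro n hn
        rw [mem_Ioc] at hn
        rw [← mul_sub, (pl_diff hx hxy hn.1).2.2 ((Nat.le_floor_iff hx.le).1 hn.2), mul_comm]
    _ ≤ _ := by
        apply sum_le_sum_of_subset_of_nonneg (Ioc_subset_Ioc_right (Nat.floor_mono hxy))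
        intro n hn _
        rw [← mul_sub]
        exact mul_nonneg (ha n) (pl_diff hx hxy (mem_Ioc.1 hn).1).1

lemma sm_upper (a : ℕ → ℝ) (ha : ∀ n, 0 ≤ a n) {x y : ℝ} (hx : 0 < x) (hxy : x ≤ y) :
    sm a y - sm a x ≤ Real.log (y / x) * su a y := by
  rw [sm_ext a hx hxy, sm, ← sum_sub_distrib, su, mul_sum]
  apply sum_le_sum
  intro n hn
  rw [← mul_sub, mul_comm]
  exact mul_le_mul_of_nonneg_right (pl_diff hx hxy (mem_Ioc.1 hn).1).2.1 (ha n)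

lemma su_mono (a : ℕ → ℝ) (ha : ∀ n, 0 ≤ a n) {x y : ℝ} (hxy : x ≤ y) : su a x ≤ su a y :=
  sum_le_sum_of_subset_of_nonneg (Ioc_subset_Ioc_right (Nat.floor_mono hxy)) (fun n _ _ => ha n)

lemma su_log4_diff {x y : ℝ} (hx : 1 ≤ x) (hxy : x ≤ y) :
    su (fun n => Real.log n ^ 4) y - su (fun n => Real.log n ^ 4) x ≤ (y - x + 1) * Real.log y ^ 4 := by
  have hf : ⌊x⌋₊ ≤ ⌊y⌋₊ := Nat.floor_mono hxy
  have : su (fun n => Real.log n ^ 4) y - su (fun n => Real.log n ^ 4) x = ∑ n ∈ Ioc ⌊x⌋₊ ⌊y⌋₊, Real.log n ^ 4 := by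
    rw [su, su, ← Finset.sum_Ioc_consecutive _ (Nat.zero_le _) hf]; ring
  rw [this]
  calc _ ≤ ∑ n ∈ Ioc ⌊x⌋₊ ⌊y⌋₊, Real.log y ^ 4 := by
        apply sum_le_sum
        intro n hn
        rw [mem_Ioc] at hn
        have h1 : (n:ℝ) ≤ y := (Nat.le_floor_iff (by linarith)).1 hn.2
        have h2 : (0:ℝ) < n := by exact_mod_cast (Nat.zero_le _).trans_lt hn.1
        have h3 : 0 ≤ Real.log n := Real.log_natCast_nonneg n
        gcongr
    _ = (⌊y⌋₊ - ⌊x⌋₊ : ℝ) * Real.log y ^ 4 := by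
        rw [sum_const, Nat.card_Ioc, nsmul_eq_mul, Nat.cast_sub hf]
    _ ≤ _ := by
        gcongr
        have := Nat.floor_le (show 0 ≤ y by linarith)
        have := Nat.lt_floor_add_one x
        linarith

lemma exp_h {h : ℝ} (h0 : 0 ≤ h) (h1 : h ≤ 1) : Real.exp h - 1 ≤ 2 * h ∧ 1 - Real.exp (-h) ≤ h := by
  refine ⟨?_, ?_⟩
  · have := Real.exp_bound_div_one_sub_of_interval h0
    have := Real.abs_exp_sub_one_le (x := h) (by rwa [abs_of_nonneg h0])
    rw [abs_of_nonneg h0] at this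
    exact (le_abs_self _).trans this
  · have := Real.add_one_le_exp (-h); linarith

noncomputable def S4 (x : ℝ) : ℝ := ∑ n ∈ Ioc 0 ⌊x⌋₊, (vM n - 1) * Real.log n ^ 4

lemma S4_eq (x : ℝ) : S4 x = su (fun n => vM n * Real.log n ^ 4) x - su (fun n => Real.log n ^ 4) x := by
  rw [S4, su, su, ← sum_sub_distrib]
  exact sum_congr rfl fun n _ => by ring

lemma R4_eq' (x : ℝ) : R4 x = sm (fun n => vM n * Real.log n ^ 4) x - sm (fun n => Real.log n ^ 4) x := by
  rw [R4, sm, sm, ← sum_sub_distrib]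
  exact sum_congr rfl fun n _ => by ring

lemma vM_nonneg (n : ℕ) : 0 ≤ vM n := ArithmeticFunction.vonMangoldt_nonneg

lemma S4_large : ∃ C : ℝ, 0 < C ∧ ∀ x : ℝ, Real.exp 4 ≤ x → |S4 x| ≤ C * x * Real.log x ^ 2 := by
  obtain ⟨C, hC, hR⟩ := R4_bound
  refine ⟨6 * C + 48, by positivity, fun x hx => ?_⟩
  have hx0 : 0 < x := (Real.exp_pos 4).trans_le hx
  have hl : 4 ≤ Real.log x := by rwa [Real.le_log_iff_exp_le hx0]
  set ℓ := Real.log x with hℓ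
  set h := 1 / ℓ ^ 2 with hh
  have hh0 : 0 < h := by positivity
  have hhl : h * ℓ ^ 2 = 1 := by rw [hh]; field_simp
  have hh1 : h ≤ 1 := by nlinarith
  obtain ⟨he1, he2⟩ := exp_h hh0.le hh1
  have hxl : ℓ ^ 2 ≤ x := by
    have := Real.quadratic_le_exp_of_nonneg (x := ℓ) (by linarith)
    rw [hℓ, Real.exp_log hx0, ← hℓ] at this
    have h3 := Real.add_one_le_exp (ℓ / 2)
    have h4 : Real.exp (ℓ / 2) ^ 2 = x := by rw [← Real.exp_nat_mul, ← Real.exp_log hx0]; congr 1; push_cast; ring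
    have h5 := Real.quadratic_le_exp_of_nonneg (x := ℓ / 2) (by linarith)
    have h6 : ℓ ≤ Real.exp (ℓ / 2) := by nlinarith
    rw [← h4]; gcongr
  set a : ℕ → ℝ := fun n => vM n * Real.log n ^ 4 with ha
  set b : ℕ → ℝ := fun n => Real.log n ^ 4 with hb
  have ha0 : ∀ n, 0 ≤ a n := fun n => by have := vM_nonneg n; simp only [ha]; positivity
  have hb0 : ∀ n, 0 ≤ b n := fun n => by simp only [hb]; positivity
  rw [abs_le, S4_eq]
  have hx1 : 1 ≤ x := by linarith [Real.add_one_le_exp 4]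
  constructor
  · set y := x * Real.exp (-h) with hy
    have hyx : y ≤ x := by rw [hy]; apply mul_le_of_le_one_right hx0.le; rw [Real.exp_le_one_iff]; linarith
    have hy2 : Real.exp 2 ≤ y := by
      calc Real.exp 2 ≤ Real.exp (4 + -h) := by gcongr; linarith
        _ = Real.exp 4 * Real.exp (-h) := Real.exp_add _ _
        _ ≤ _ := by rw [hy]; gcongr
    have hy0 : 0 < y := by positivity
    have hlog : Real.log (x / y) = h := by
      rw [hy, Real.log_div hx0.ne' (by positivity), Real.log_mul hx0.ne' (by positivity), Real.log_exp]; ring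
    have k1 := sm_upper a ha0 hy0 hyx
    have k2 := sm_lower b hb0 hy0 hyx
    rw [hlog] at k1 k2
    have r1 := R4_eq' x
    have r2 := R4_eq' y
    have r3 := (abs_le.1 (hR x (hy2.trans hyx))).1
    have r4 := (abs_le.1 (hR y hy2)).2
    have hCy : C * y ≤ C * x := by gcongr
    have k3 : h * su b y - 2 * (C * x) ≤ h * su a x := by linarith
    have k4 := su_log4_diff (by linarith [Real.add_one_le_exp 2]) hyx
    rw [← hℓ, ← hb] at k4
    have k5 : (x - y + 1) * ℓ ^ 4 ≤ 2 * (x * ℓ ^ 2) := by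
      have : x - y ≤ x * h := by rw [hy]; nlinarith
      calc (x - y + 1) * ℓ ^ 4 ≤ (x * h + 1) * ℓ ^ 4 := by gcongr
        _ = x * ℓ ^ 2 * (h * ℓ ^ 2) + ℓ ^ 2 * ℓ ^ 2 := by ring
        _ ≤ x * ℓ ^ 2 * (h * ℓ ^ 2) + x * ℓ ^ 2 := by gcongr
        _ = _ := by rw [hhl]; ring
    have k6 : su b y - 2 * (C * x) * ℓ ^ 2 ≤ su a x := by
      have := mul_le_mul_of_nonneg_right k3 (show 0 ≤ ℓ ^ 2 by positivity)
      have e1 : (h * su b y - 2 * (C * x)) * ℓ ^ 2 = su b y * (h * ℓ ^ 2) - 2 * (C * x) * ℓ ^ 2 := by ring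
      have e2 : h * su a x * ℓ ^ 2 = su a x * (h * ℓ ^ 2) := by ring
      rw [e1, e2, hhl] at this; linarith
    have : 0 ≤ C * x * ℓ ^ 2 := by positivity
    have : 0 ≤ x * ℓ ^ 2 := by positivity
    linarith
  · set y := x * Real.exp h with hy
    have hyx : x ≤ y := by rw [hy]; apply le_mul_of_one_le_right hx0.le; rw [Real.one_le_exp_iff]; linarith
    have hy3 : y ≤ 3 * x := by rw [hy]; nlinarith
    have hy0 : 0 < y := by positivity
    have hly : Real.log y = ℓ + h := by rw [hy, Real.log_mul hx0.ne' (by positivity), Real.log_exp]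
    have hlog : Real.log (y / x) = h := by
      rw [Real.log_div (by positivity) hx0.ne', hly]; ring
    have k1 := sm_lower a ha0 hx0 hyx
    have k2 := sm_upper b hb0 hx0 hyx
    rw [hlog] at k1 k2
    have r1 := R4_eq' x
    have r2 := R4_eq' y
    have hx2 : Real.exp 2 ≤ x := le_trans (by gcongr; norm_num) hx
    have r3 := (abs_le.1 (hR x hx2)).1
    have r4 := (abs_le.1 (hR y (hx2.trans hyx))).2
    have hCy : C * y ≤ C * (3 * x) := by gcongr
    have k3 : h * su a x ≤ h * su b y + 4 * (C * x) := by linarith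
    have k4 := su_log4_diff hx1 hyx
    rw [hly, ← hb] at k4
    have k5 : (y - x + 1) * (ℓ + h) ^ 4 ≤ 48 * (x * ℓ ^ 2) := by
      have : y - x ≤ x * (2 * h) := by rw [hy]; nlinarith
      have h16 : (ℓ + h) ^ 4 ≤ 16 * ℓ ^ 4 := by
        calc (ℓ + h) ^ 4 ≤ (2 * ℓ) ^ 4 := by gcongr; linarith
          _ = _ := by ring
      calc (y - x + 1) * (ℓ + h) ^ 4 ≤ (x * (2 * h) + 1) * (16 * ℓ ^ 4) := by gcongr
        _ = 32 * (x * ℓ ^ 2 * (h * ℓ ^ 2)) + 16 * (ℓ ^ 2 * ℓ ^ 2) := by ring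
        _ ≤ 32 * (x * ℓ ^ 2 * (h * ℓ ^ 2)) + 16 * (x * ℓ ^ 2) := by gcongr
        _ = _ := by rw [hhl]; ring
    have k6 : su a x ≤ su b y + 4 * (C * x) * ℓ ^ 2 := by
      have := mul_le_mul_of_nonneg_right k3 (show 0 ≤ ℓ ^ 2 by positivity)
      have e1 : (h * su b y + 4 * (C * x)) * ℓ ^ 2 = su b y * (h * ℓ ^ 2) + 4 * (C * x) * ℓ ^ 2 := by ring
      have e2 : h * su a x * ℓ ^ 2 = su a x * (h * ℓ ^ 2) := by ring
      rw [e1, e2, hhl] at this; linarith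
    have : 0 ≤ C * x * ℓ ^ 2 := by positivity
    have : 0 ≤ x * ℓ ^ 2 := by positivity
    linarith

lemma vM1_abs {y : ℝ} (hy : 1 ≤ y) {n : ℕ} (hn : n ∈ Ioc 0 ⌊y⌋₊) : |vM n - 1| ≤ 1 + Real.log y := by
  have h1 := vM_le hy hn
  have h2 := vM_nonneg n
  have h3 := Real.log_nonneg hy
  rw [abs_le]; constructor <;> linarith

lemma log_le_of_mem {y : ℝ} (hy : 1 ≤ y) {n : ℕ} (hn : n ∈ Ioc 0 ⌊y⌋₊) : Real.log n ≤ Real.log y := by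
  rw [mem_Ioc] at hn
  have h1 : (n:ℝ) ≤ y := (Nat.le_floor_iff (by linarith)).1 hn.2
  have h2 : (0:ℝ) < n := by exact_mod_cast hn.1
  exact Real.log_le_log h2 h1

lemma S4_bound : ∃ C : ℝ, 0 < C ∧ ∀ x : ℝ, 1 ≤ x → |S4 x| ≤ C * x * (1 + Real.log x) ^ 2 := by
  obtain ⟨C, hC, hS⟩ := S4_large
  refine ⟨C + 5 * 4 ^ 4, by positivity, fun x hx => ?_⟩
  have hl := Real.log_nonneg hx
  rcases le_or_gt (Real.exp 4) x with h | h
  · refine (hS x h).trans ?_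
    gcongr <;> linarith
  · have hl4 : Real.log x ≤ 4 := by
      rw [Real.log_le_iff_le_exp (by linarith)]; exact h.le
    rw [S4]
    calc _ ≤ ∑ n ∈ Ioc 0 ⌊x⌋₊, |(vM n - 1) * Real.log n ^ 4| := abs_sum_le_sum_abs _ _
      _ ≤ ∑ n ∈ Ioc 0 ⌊x⌋₊, (5 * 4 ^ 4 : ℝ) := by
          apply sum_le_sum
          intro n hn
          rw [abs_mul]
          have h1 := vM1_abs hx hn
          have h2 := log_le_of_mem hx hn
          have h3 : 0 ≤ Real.log n := Real.log_natCast_nonneg n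
          rw [abs_of_nonneg (show 0 ≤ Real.log n ^ 4 by positivity)]
          gcongr <;> linarith
      _ = ⌊x⌋₊ * (5 * 4 ^ 4) := by simp
      _ ≤ x * (5 * 4 ^ 4) := by gcongr; exact Nat.floor_le (by linarith)
      _ ≤ (C + 5 * 4 ^ 4) * x * 1 := by nlinarith
      _ ≤ _ := by gcongr; nlinarith

/-- The prime number theorem with a weak error term. -/
theorem pnt : ∃ C : ℝ, 0 < C ∧ ∀ x : ℝ, 1 < x → |Chebyshev.psi x - x| ≤ C * x * (1 + Real.log x) ^ 2 / Real.log x ^ 4 + 2 * √x * (1 + Real.log x) + 1 := by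
  obtain ⟨C, hC, hS⟩ := S4_bound
  refine ⟨16 * C, by positivity, fun x hx => ?_⟩
  have hl : 0 < Real.log x := Real.log_pos hx
  have hx0 : 0 < x := by linarith
  set ℓ := Real.log x / 2 with hℓ
  have hℓ0 : 0 < ℓ := by positivity
  set N := ⌊x⌋₊ with hN
  set c : ℕ → ℂ := fun k => if k ≤ N then (((vM k - 1) * Real.log k ^ 4 : ℝ) : ℂ) else 0 with hc
  set f : ℕ → ℝ := fun k => 1 / (max (Real.log k) ℓ) ^ 4 with hf
  have hAb := abel_anti f c (C * x * (1 + Real.log x) ^ 2) ?_ ?_ ?_ N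
  rotate_left
  · intro n
    have e1 : ∑ k ∈ Ioc 0 n, c k = ((S4 (min n N : ℕ) : ℝ) : ℂ) := by
      rw [S4, Nat.floor_natCast, ofReal_sum]
      simp only [hc]
      rw [← sum_filter]
      apply sum_congr _ (fun _ _ => rfl)
      ext k; simp; omega
    rw [e1, norm_real, Real.norm_eq_abs]
    rcases Nat.eq_zero_or_pos (min n N) with h0 | h0
    · rw [h0]
      simp only [S4]
      simp; positivity
    · have h1 : (1:ℝ) ≤ (min n N : ℕ) := by exact_mod_cast h0
      have h2 : ((min n N : ℕ) : ℝ) ≤ x := by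
        refine le_trans ?_ (Nat.floor_le hx0.le)
        exact_mod_cast min_le_right _ _
      refine (hS _ h1).trans ?_
      have := Real.log_nonneg h1
      gcongr
  · intro n; simp only [hf]; positivity
  · intro n hn
    simp only [hf]
    have : Real.log n ≤ Real.log (n + 1 : ℕ) := Real.log_le_log (by exact_mod_cast hn) (by push_cast; linarith)
    gcongr
  have hf1 : f 1 = 16 / Real.log x ^ 4 := by
    simp only [hf, Nat.cast_one, Real.log_one]
    rw [max_eq_right hℓ0.le, hℓ]
    field_simp; norm_num
  rw [hf1] at hAb
  have e2 : ∑ k ∈ Ioc 0 N, (f k : ℂ) * c k = ((∑ k ∈ Ioc 0 N, f k * ((vM k - 1) * Real.log k ^ 4) : ℝ) : ℂ) := by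
    rw [ofReal_sum]
    apply sum_congr rfl
    intro k hk
    simp only [hc, (mem_Ioc.1 hk).2, if_true]
    push_cast; ring
  rw [e2, norm_real, Real.norm_eq_abs] at hAb
  set D := ∑ k ∈ Ioc 0 N, f k * ((vM k - 1) * Real.log k ^ 4) with hD
  have hpsi : Chebyshev.psi x - N = ∑ k ∈ Ioc 0 N, (vM k - 1) := by
    rw [sum_sub_distrib, Chebyshev.psi]; simp [← hN]
  have hsx : 1 ≤ √x := Real.one_le_sqrt.2 hx.le
  have hdiff : |Chebyshev.psi x - N - D| ≤ √x * (1 + Real.log x) := by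
    rw [hpsi, hD, ← sum_sub_distrib]
    calc _ ≤ ∑ k ∈ Ioc 0 N, |(vM k - 1) - f k * ((vM k - 1) * Real.log k ^ 4)| := abs_sum_le_sum_abs _ _
      _ ≤ ∑ k ∈ Ioc 0 N, if k ≤ ⌊√x⌋₊ then (1 + Real.log x) else 0 := by
          apply sum_le_sum
          intro k hk
          have hk0 : (0:ℝ) < k := by exact_mod_cast (mem_Ioc.1 hk).1
          have hlk : 0 ≤ Real.log k := Real.log_natCast_nonneg k
          have e : (vM k - 1) - f k * ((vM k - 1) * Real.log k ^ 4) = (vM k - 1) * (1 - f k * Real.log k ^ 4) := by ring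
          rw [e]
          split_ifs with h
          · rw [abs_mul]
            have b1 := vM1_abs hx.le hk
            have b2 : |1 - f k * Real.log k ^ 4| ≤ 1 := by
              have : f k * Real.log k ^ 4 ≤ 1 := by
                simp only [hf]
                rw [one_div_mul_eq_div]
                apply div_le_one_of_le₀ _ (by positivity)
                gcongr
                exact le_max_left _ _
              have h0 : 0 ≤ f k * Real.log k ^ 4 := by simp only [hf]; positivity
              rw [abs_le]; constructor <;> linarith
            calc _ ≤ (1 + Real.log x) * 1 := by gcongr
              _ = _ := mul_one _
          · have h1 : √x < k := (Nat.floor_lt (by positivity)).1 (not_le.1 h)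
            have h2 : ℓ ≤ Real.log k := by
              rw [hℓ, ← Real.log_sqrt hx0.le]; exact Real.log_le_log (by positivity) h1.le
            have h3 : f k * Real.log k ^ 4 = 1 := by
              simp only [hf]; rw [max_eq_left h2]
              have : 0 < Real.log k := by linarith
              field_simp
            rw [h3]; simp
      _ = ∑ k ∈ (Ioc 0 N).filter (· ≤ ⌊√x⌋₊), (1 + Real.log x) := by rw [sum_filter]
      _ ≤ ∑ k ∈ Ioc 0 ⌊√x⌋₊, (1 + Real.log x) := by
          apply sum_le_sum_of_subset_of_nonneg
          · intro k hk; simp at hk ⊢; omega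
          · intro _ _ _; positivity
      _ = ⌊√x⌋₊ * (1 + Real.log x) := by simp; ring
      _ ≤ _ := by gcongr; exact Nat.floor_le (by positivity)
  have hNx : |(N:ℝ) - x| ≤ 1 := by
    have := Nat.floor_le hx0.le
    have := Nat.lt_floor_add_one x
    rw [abs_le]; constructor <;> linarith
  have e3 : Chebyshev.psi x - x = D + (Chebyshev.psi x - N - D) + (N - x) := by ring
  rw [e3]
  refine (abs_add_three _ _ _).trans ?_
  have e4 : C * x * (1 + Real.log x) ^ 2 * (16 / Real.log x ^ 4) = 16 * C * x * (1 + Real.log x) ^ 2 / Real.log x ^ 4 := by ring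
  rw [e4] at hAb
  have : 0 ≤ √x * (1 + Real.log x) := by positivity
  linarith

end BVC

namespace BVC
open Finset MeasureTheory Filter Topology Complex

noncomputable def aq (q : ℕ) (n : ℕ) : ℝ := if n % q = 1 then vM n else 0

lemma aq_nonneg (q n : ℕ) : 0 ≤ aq q n := by
  unfold aq; split_ifs
  · exact vM_nonneg n
  · exact le_rfl

lemma char_decomp {q : ℕ} (hq : q.Prime) {y : ℝ} (hy : 1 ≤ y) :
    |(q.totient : ℝ) * sm (aq q) y - sm vM y| ≤ y / q * Real.log y ^ 2 + ∑ χ ∈ nt q, ‖W y χ‖ := by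
  classical
  have : Fact q.Prime := ⟨hq⟩
  have hone : ∀ n : ℕ, (n : ZMod q) = 1 ↔ n % q = 1 := by
    intro n
    rw [← Nat.cast_one, ZMod.natCast_eq_natCast_iff, Nat.ModEq, Nat.mod_eq_of_lt hq.one_lt]
  have h1 : (((q.totient : ℝ) * sm (aq q) y : ℝ) : ℂ) = ∑ χ : DirichletCharacter ℂ q, W y χ := by
    simp only [W]
    rw [sum_comm, sm]
    push_cast
    rw [mul_sum]
    apply sum_congr rfl
    intro n _
    rw [← smul_sum, ← sum_mul, DirichletCharacter.sum_characters_eq]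
    simp only [hone, aq, real_smul]
    split_ifs
    · ring
    · simp
  have h2 : ∑ χ : DirichletCharacter ℂ q, W y χ = ∑ χ ∈ nt q, W y χ + W y (1 : DirichletCharacter ℂ q) := by
    rw [nt_eq, sum_erase_add _ _ (mem_univ _)]
  have h3 : ((sm vM y : ℝ) : ℂ) - W y (1 : DirichletCharacter ℂ q) =
      ((∑ n ∈ (Ioc 0 ⌊y⌋₊).filter (q ∣ ·), vM n * Real.posLog (y / n) : ℝ) : ℂ) := by
    rw [sm, W, sum_filter]
    push_cast
    rw [← sum_sub_distrib]
    apply sum_congr rfl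
    intro n _
    rw [real_smul]
    by_cases h : q ∣ n
    · have : (n : ZMod q) = 0 := (ZMod.natCast_eq_zero_iff n q).2 h
      rw [this, MulChar.map_zero]; simp [h]
    · have hu : IsUnit (n : ZMod q) := by
        rw [isUnit_iff_ne_zero]; intro h0; exact h ((ZMod.natCast_eq_zero_iff n q).1 h0)
      rw [MulChar.one_apply hu]; simp [h]
  have hl := Real.log_nonneg hy
  have h4 : |∑ n ∈ (Ioc 0 ⌊y⌋₊).filter (q ∣ ·), vM n * Real.posLog (y / n)| ≤ y / q * Real.log y ^ 2 := by
    rw [abs_of_nonneg (sum_nonneg fun n _ => mul_nonneg (vM_nonneg n) Real.posLog_nonneg)]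
    calc _ ≤ ∑ n ∈ (Ioc 0 ⌊y⌋₊).filter (q ∣ ·), Real.log y ^ 2 := by
          apply sum_le_sum
          intro n hn
          rw [sq]
          exact mul_le_mul (vM_le hy (mem_filter.1 hn).1) (pl_le_log hy n) Real.posLog_nonneg hl
      _ = ((⌊y⌋₊ / q : ℕ) : ℝ) * Real.log y ^ 2 := by
          rw [sum_const, Nat.Ioc_filter_dvd_card_eq_div, nsmul_eq_mul]
      _ ≤ _ := by
          gcongr
          refine Nat.cast_div_le.trans ?_
          gcongr
          exact Nat.floor_le (by linarith)
  have h5 : (((q.totient : ℝ) * sm (aq q) y - sm vM y : ℝ) : ℂ) =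
      ∑ χ ∈ nt q, W y χ - ((∑ n ∈ (Ioc 0 ⌊y⌋₊).filter (q ∣ ·), vM n * Real.posLog (y / n) : ℝ) : ℂ) := by
    rw [← h3, ofReal_sub, h1, h2]; ring
  rw [← Real.norm_eq_abs, ← norm_real, h5]
  refine (norm_sub_le _ _).trans ?_
  rw [norm_real, Real.norm_eq_abs, add_comm]
  gcongr
  exact norm_sum_le _ _

lemma sm_le : ∃ K : ℝ, 0 < K ∧ ∀ x : ℝ, 0 < x → sm vM x ≤ K * x := by
  set c := Real.log 4 + 4 with hc
  have hc0 : 0 < c := by have := Real.log_pos (show (1:ℝ) < 4 by norm_num); positivity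
  refine ⟨2 * c, by positivity, ?_⟩
  have key : ∀ k : ℕ, ∀ x : ℝ, 0 < x → x ≤ Real.exp k → sm vM x ≤ 2 * c * x := by
    intro k
    induction k with
    | zero =>
      intro x hx hx1
      simp at hx1
      have : sm vM x = 0 := by
        rw [sm]
        apply sum_eq_zero
        intro n hn
        have hn0 : (1:ℝ) ≤ n := by exact_mod_cast (mem_Ioc.1 hn).1
        rw [(Real.posLog_eq_zero_iff _).2, mul_zero]
        rw [abs_of_nonneg (by positivity), div_le_one (by linarith)]
        linarith
      rw [this]; positivity
    | succ k ih =>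
      intro x hx hx1
      have he := Real.exp_one_gt_d9
      have h0 : 0 < x / Real.exp 1 := by positivity
      have h1 := ih (x / Real.exp 1) h0 (by
        rw [div_le_iff₀ (by positivity), ← Real.exp_add]; exact_mod_cast hx1)
      have h2 := sm_upper vM vM_nonneg h0 (div_le_self hx.le (by linarith : 1 ≤ Real.exp 1))
      have h3 : Real.log (x / (x / Real.exp 1)) = 1 := by
        rw [div_div_cancel₀ hx.ne', Real.log_exp]
      have h4 : su vM x ≤ c * x := Chebyshev.psi_le_const_mul_self hx.le
      rw [h3, one_mul] at h2
      have h5 : x / Real.exp 1 ≤ x / 2 := by gcongr; linarith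
      have : 2 * c * (x / Real.exp 1) ≤ 2 * c * (x / 2) := by gcongr
      linarith
  intro x hx
  obtain ⟨k, hk⟩ := exists_nat_ge (Real.log x)
  exact key k x hx ((Real.log_le_iff_le_exp hx).1 hk)

lemma ev_log (A : ℝ) (k : ℕ) {s : ℝ} (hs : 0 < s) : ∀ᶠ x : ℝ in atTop, A * Real.log x ^ k ≤ x ^ s := by
  have h := (isLittleO_log_rpow_rpow_atTop (k:ℝ) hs).const_mul_left A
  filter_upwards [h.bound one_pos, eventually_gt_atTop 1] with x hx h1
  rw [one_mul, Real.rpow_natCast, Real.norm_of_nonneg (show 0 ≤ x ^ s by positivity)] at hx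
  exact (le_abs_self _).trans hx

lemma ev_loglow (A : ℝ) : ∀ᶠ x : ℝ in atTop, A ≤ Real.log x := Real.tendsto_log_atTop.eventually_ge_atTop A

noncomputable def PS (ρ x : ℝ) : Finset ℕ :=
  (range (⌊x ^ ρ⌋₊ + 1)).filter fun q => q.Prime ∧ x ^ ρ / Real.log x < q ∧ (q:ℝ) < x ^ ρ

lemma card_PS {ρ : ℝ} (h0 : 0 < ρ) (h1 : ρ < 1 / 2) :
    ∀ᶠ x : ℝ in atTop, x ^ ρ / (2 * Real.log x) ≤ (PS ρ x).card := by
  have hz : Tendsto (fun x : ℝ => x ^ ρ) atTop atTop := tendsto_rpow_atTop h0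
  have e1 := hz.eventually (ev_log 40 1 (show (0:ℝ) < 1/4 by norm_num))
  filter_upwards [e1, hz.eventually (ev_log 40 0 (show (0:ℝ) < 1/2 by norm_num)), hz.eventually (eventually_ge_atTop 1000), ev_loglow 100, eventually_gt_atTop 1] with x k1 k2 k3 k4 k5
  set z := x ^ ρ with hz'
  have hx0 : 0 < x := by linarith
  have hz0 : 0 < z := by linarith
  have hlz : 0 < Real.log z := Real.log_pos (by linarith)
  have hlzx : Real.log z ≤ Real.log x := by
    rw [hz', Real.log_rpow hx0]; nlinarith
  have hs4 : (z ^ (1/4:ℝ)) ^ 4 = z := by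
    rw [← Real.rpow_natCast, ← Real.rpow_mul hz0.le]; norm_num
  set w := z ^ (1/4:ℝ) with hw
  have hw0 : 0 < w := by positivity
  have hsz : √z = w ^ 2 := by
    rw [Real.sqrt_eq_iff_mul_self_eq hz0.le (by positivity)]; rw [← hs4]; ring
  simp only [pow_one] at k1
  have hth := Chebyshev.theta_ge' (x := z) (by linarith)
  have hw5 : 5 ≤ w := by
    by_contra! h
    have : w ^ 4 < 5 ^ 4 := by gcongr
    rw [hs4] at this; linarith
  have l2 : Real.log (z + 2) ≤ 2 * Real.log z := by
    rw [← Real.log_rpow hz0 2, Real.rpow_ofNat] 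
    apply Real.log_le_log (by linarith); nlinarith
  have hlw : Real.log z ≤ w / 40 := by linarith
  have hl2 := Real.log_two_gt_d9
  have hthz : 0.6 * z ≤ Chebyshev.theta z := by
    refine le_trans ?_ hth
    rw [hsz]
    have : 2 * w ^ 2 * Real.log z ≤ 2 * w ^ 2 * (w / 40) := by gcongr
    have h1 : w ^ 3 * 5 ≤ z := by rw [← hs4]; nlinarith [pow_pos hw0 3]
    have h2 : w * 125 ≤ z := by rw [← hs4]; nlinarith [pow_pos hw0 3, pow_pos hw0 2, mul_pos hw0 hw0]
    nlinarith
  have hlog4 : Real.log 4 ≤ 1.4 := by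
    have : Real.log 4 = 2 * Real.log 2 := by rw [show (4:ℝ) = 2 ^ 2 by norm_num, Real.log_pow]; norm_num
    have := Real.log_two_lt_d9
    linarith
  have hlow : Chebyshev.theta (z / Real.log x) ≤ 0.014 * z := by
    refine (Chebyshev.theta_le_log4_mul_x (by positivity)).trans ?_
    calc Real.log 4 * (z / Real.log x) ≤ 1.4 * (z / 100) := by gcongr
      _ = _ := by ring
  have hsum : Chebyshev.theta z ≤ Chebyshev.theta (z / Real.log x) + ∑ q ∈ PS ρ x, Real.log z + Real.log z := by
    set A := (Ioc 0 ⌊z⌋₊).filter Nat.Prime with hA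
    set B := (Ioc 0 ⌊z / Real.log x⌋₊).filter Nat.Prime with hB
    have hsub : A ⊆ (B ∪ PS ρ x) ∪ {⌊z⌋₊} := by
      intro p hp
      rw [hA, mem_filter, mem_Ioc] at hp
      rw [mem_union, mem_union, mem_singleton]
      by_cases h : p ≤ ⌊z / Real.log x⌋₊
      · left; left; rw [hB, mem_filter, mem_Ioc]; exact ⟨⟨hp.1.1, h⟩, hp.2⟩
      · by_cases h' : (p:ℝ) < z
        · left; right
          rw [PS, mem_filter, mem_range]
          refine ⟨by rw [← hz']; omega, hp.2, ?_, h'⟩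
          exact (Nat.floor_lt (by positivity)).1 (not_le.1 h)
        · right
          have : (p:ℝ) ≤ z := (Nat.le_floor_iff hz0.le).1 hp.1.2
          have : z = p := by linarith
          rw [this, Nat.floor_natCast]
    have hnn : ∀ p : ℕ, 0 ≤ Real.log p := fun p => Real.log_natCast_nonneg p
    calc Chebyshev.theta z = ∑ p ∈ A, Real.log p := rfl
      _ ≤ ∑ p ∈ (B ∪ PS ρ x) ∪ {⌊z⌋₊}, Real.log p := sum_le_sum_of_subset_of_nonneg hsub fun p _ _ => hnn p
      _ ≤ ∑ p ∈ B, Real.log p + ∑ p ∈ PS ρ x, Real.log p + ∑ p ∈ ({⌊z⌋₊} : Finset ℕ), Real.log p := by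
          have a1 := sum_union_inter (s₁ := B ∪ PS ρ x) (s₂ := {⌊z⌋₊}) (f := fun p : ℕ => Real.log p)
          have a2 := sum_union_inter (s₁ := B) (s₂ := PS ρ x) (f := fun p : ℕ => Real.log p)
          have a3 : 0 ≤ ∑ p ∈ (B ∪ PS ρ x) ∩ {⌊z⌋₊}, Real.log p := sum_nonneg fun p _ => hnn p
          have a4 : 0 ≤ ∑ p ∈ B ∩ PS ρ x, Real.log p := sum_nonneg fun p _ => hnn p
          linarith
      _ ≤ _ := by
          rw [sum_singleton]
          have b1 : Real.log ⌊z⌋₊ ≤ Real.log z :=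
            Real.log_le_log (by exact_mod_cast Nat.floor_pos.2 (by linarith)) (Nat.floor_le hz0.le)
          have b2 : ∑ p ∈ PS ρ x, Real.log p ≤ ∑ q ∈ PS ρ x, Real.log z := by
            apply sum_le_sum
            intro p hp
            rw [PS, mem_filter] at hp
            exact Real.log_le_log (by exact_mod_cast hp.2.1.pos) hp.2.2.2.le
          have b3 : Chebyshev.theta (z / Real.log x) = ∑ p ∈ B, Real.log p := rfl
          linarith
  rw [sum_const, nsmul_eq_mul] at hsum
  have h2 : w * 125 ≤ z := by rw [← hs4]; nlinarith [pow_pos hw0 3, pow_pos hw0 2, mul_pos hw0 hw0]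
  have h3 : z / 2 ≤ (PS ρ x).card * Real.log x := by
    have : ((PS ρ x).card : ℝ) * Real.log z ≤ (PS ρ x).card * Real.log x := by gcongr
    linarith
  rw [div_le_iff₀ (by positivity)]
  linarith

end BVC

namespace BVC
open Finset MeasureTheory Filter Topology Complex

lemma choose_q {ρ : ℝ} (h0 : 0 < ρ) (h1 : ρ < 1 / 2) :
    ∀ᶠ x : ℝ in atTop, ∀ y : Fin 3 → ℝ, (∀ i, 1 ≤ y i ∧ y i ≤ 3 * x ∧ Real.log (y i) ≤ Real.log x + 1) →
      ∃ q ∈ PS ρ x, ∀ i, ∑ χ ∈ nt q, ‖W (y i) χ‖ ≤ x / (2 * Real.log x ^ 4) := by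
  set ε := (1 / 2 - ρ) / 2 with hε
  have hε0 : 0 < ε := by rw [hε]; linarith
  set η := min ρ (ε / 2) with hη
  have hη0 : 0 < η := by rw [hη]; positivity
  have hη1 : η ≤ ρ := min_le_left _ _
  have hη2 : η ≤ ε / 2 := min_le_right _ _
  filter_upwards [card_PS h0 h1, ev_log 1500000 9 hη0, ev_loglow 2, eventually_gt_atTop 1] with x hcard hlog hl hx1 y hy
  have hx0 : 0 < x := by linarith
  set ℓ := Real.log x with hℓ
  by_contra! hcon
  set Q := ⌊x ^ ρ⌋₊ with hQ
  set U := ⌈x ^ ε⌉₊ with hU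
  have hxe : 1 ≤ x ^ ε := Real.one_le_rpow hx1.le hε0.le
  have hU1 : x ^ ε ≤ U := Nat.le_ceil _
  have hU2 : (U:ℝ) ≤ 2 * x ^ ε := by
    have := Nat.ceil_lt_add_one (show 0 ≤ x ^ ε by linarith)
    linarith
  have hUpos : 1 ≤ U := by
    have : (1:ℝ) ≤ U := by linarith
    exact_mod_cast this
  have hQ1 : (Q:ℝ) ≤ x ^ ρ := Nat.floor_le (by positivity)
  set B := x ^ (1 + ρ - η) with hB
  have hbv : ∀ i, ∑ q ∈ PS ρ x, ∑ χ ∈ nt q, ‖W (y i) χ‖ ≤ 100 * (3 * ℓ) ^ 4 * (15 * B) := by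
    intro i
    obtain ⟨hy1, hy2, hy3⟩ := hy i
    refine (bv_lite (PS ρ x) Q (fun q hq => ?_) U hUpos hy1).trans ?_
    · rw [PS, mem_filter, mem_range] at hq
      exact ⟨hq.2.1, by omega⟩
    have hl0 := Real.log_nonneg hy1
    have t1 : (Q:ℝ) ^ 3 * (U:ℝ) ^ 2 ≤ 4 * B := by
      calc (Q:ℝ) ^ 3 * (U:ℝ) ^ 2 ≤ (x ^ ρ) ^ 3 * (2 * x ^ ε) ^ 2 := by gcongr
        _ = 4 * ((x ^ ρ) ^ 3 * (x ^ ε) ^ 2) := by ring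
        _ = 4 * x ^ (ρ * 3 + ε * 2) := by
            rw [Real.rpow_add hx0, Real.rpow_mul hx0.le, Real.rpow_mul hx0.le]; norm_num
        _ ≤ _ := by
            rw [hB]; gcongr
            · exact hx1.le
            · linarith
    have t2 : y i ≤ 3 * B := by
      refine hy2.trans ?_
      gcongr
      calc x = x ^ (1:ℝ) := (Real.rpow_one x).symm
        _ ≤ _ := by
          rw [hB]
          apply Real.rpow_le_rpow_of_exponent_le hx1.le; linarith
    have t3 : 2 * Q * y i / √U ≤ 6 * B := by
      have hs : x ^ (ε / 2) ≤ √U := by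
        apply Real.le_sqrt_of_sq_le
        refine le_trans (le_of_eq ?_) hU1
        rw [← Real.rpow_natCast, ← Real.rpow_mul hx0.le]; norm_num
      calc 2 * Q * y i / √U ≤ 2 * x ^ ρ * (3 * x) / x ^ (ε / 2) := by gcongr
        _ = 6 * (x ^ (1:ℝ) * x ^ ρ / x ^ (ε / 2)) := by rw [Real.rpow_one]; ring
        _ = 6 * x ^ (1 + ρ - ε / 2) := by rw [Real.rpow_sub hx0, Real.rpow_add hx0]
        _ ≤ _ := by
            rw [hB]; gcongr
            exact hx1.le
    have t4 : (Q:ℝ) ^ 2 * √(y i) ≤ 2 * B := by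
      have hs : √(y i) ≤ 2 * x ^ (1/2:ℝ) := by
        rw [← Real.sqrt_eq_rpow]
        calc √(y i) ≤ √(2 ^ 2 * x) := by apply Real.sqrt_le_sqrt; linarith
          _ = _ := by rw [Real.sqrt_mul (by norm_num), Real.sqrt_sq (by norm_num)]
      calc (Q:ℝ) ^ 2 * √(y i) ≤ (x ^ ρ) ^ 2 * (2 * x ^ (1/2:ℝ)) := by gcongr
        _ = 2 * ((x ^ ρ) ^ 2 * x ^ (1/2:ℝ)) := by ring
        _ = 2 * x ^ (ρ * 2 + 1/2) := by
            rw [Real.rpow_add hx0, Real.rpow_mul hx0.le]; norm_num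
        _ ≤ _ := by
            rw [hB]; gcongr
            · exact hx1.le
            · linarith
    gcongr
    · linarith
    · linarith
  have hsum : ((PS ρ x).card : ℝ) * (x / (2 * ℓ ^ 4)) ≤ 3 * (100 * (3 * ℓ) ^ 4 * (15 * B)) := by
    calc ((PS ρ x).card : ℝ) * (x / (2 * ℓ ^ 4)) = ∑ q ∈ PS ρ x, x / (2 * ℓ ^ 4) := by rw [sum_const, nsmul_eq_mul]
      _ ≤ ∑ q ∈ PS ρ x, ∑ i, ∑ χ ∈ nt q, ‖W (y i) χ‖ := by
          apply sum_le_sum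
          intro q hq
          obtain ⟨i, hi⟩ := hcon q hq
          refine hi.le.trans ?_
          exact single_le_sum (f := fun i => ∑ χ ∈ nt q, ‖W (y i) χ‖) (fun i _ => sum_nonneg fun _ _ => norm_nonneg _) (mem_univ i)
      _ = ∑ i, ∑ q ∈ PS ρ x, ∑ χ ∈ nt q, ‖W (y i) χ‖ := sum_comm
      _ ≤ ∑ i : Fin 3, 100 * (3 * ℓ) ^ 4 * (15 * B) := sum_le_sum fun i _ => hbv i
      _ = _ := by simp
  have hBx : B * x ^ η = x * x ^ ρ := by
    rw [hB, ← Real.rpow_add hx0, sub_add_cancel, Real.rpow_add hx0, Real.rpow_one]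
  have hB0 : 0 < B := by positivity
  have hfin : x ^ ρ / (2 * ℓ) * (x / (2 * ℓ ^ 4)) ≤ 3 * (100 * (3 * ℓ) ^ 4 * (15 * B)) :=
    le_trans (by gcongr) hsum
  have e : x ^ ρ / (2 * ℓ) * (x / (2 * ℓ ^ 4)) = B * x ^ η / (4 * ℓ ^ 5) := by
    rw [hBx]; field_simp; ring
  rw [e, div_le_iff₀ (by positivity)] at hfin
  have h5 : B * (1500000 * ℓ ^ 9) ≤ B * x ^ η := by gcongr
  have h6 : 0 < B * ℓ ^ 9 := by positivity
  nlinarith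

lemma psi_near : ∃ C : ℝ, 0 < C ∧ ∀ᶠ x : ℝ in atTop, |Chebyshev.psi x - x| ≤ C * x / Real.log x ^ 2 := by
  obtain ⟨C, hC, h⟩ := pnt
  refine ⟨4 * C + 2, by positivity, ?_⟩
  filter_upwards [ev_log 4 3 (show (0:ℝ) < 1/2 by norm_num), ev_log 1 2 (show (0:ℝ) < 1 by norm_num), ev_loglow 1, eventually_gt_atTop 1] with x k1 k2 k3 k4
  refine (h x k4).trans ?_
  set ℓ := Real.log x with hℓ
  have hx0 : 0 < x := by linarith
  rw [Real.rpow_one] at k2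
  rw [← Real.sqrt_eq_rpow] at k1
  have a1 : C * x * (1 + ℓ) ^ 2 / ℓ ^ 4 ≤ 4 * C * x / ℓ ^ 2 := by
    calc C * x * (1 + ℓ) ^ 2 / ℓ ^ 4 ≤ C * x * (2 * ℓ) ^ 2 / ℓ ^ 4 := by gcongr; linarith
      _ = _ := by field_simp; ring
  have a2 : 2 * √x * (1 + ℓ) ≤ x / ℓ ^ 2 := by
    rw [le_div_iff₀ (by positivity)]
    calc 2 * √x * (1 + ℓ) * ℓ ^ 2 ≤ 2 * √x * (2 * ℓ) * ℓ ^ 2 := by gcongr; linarith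
      _ = √x * (4 * ℓ ^ 3) := by ring
      _ ≤ √x * √x := by gcongr
      _ = x := Real.mul_self_sqrt hx0.le
  have a3 : 1 ≤ x / ℓ ^ 2 := by
    rw [le_div_iff₀ (by positivity)]; linarith
  have e : (4 * C + 2) * x / ℓ ^ 2 = 4 * C * x / ℓ ^ 2 + x / ℓ ^ 2 + x / ℓ ^ 2 := by ring
  rw [e]; linarith

lemma filter_eq (x : ℝ) (q : ℕ) : (range (⌊x⌋₊ + 1)).filter (fun p => p.Prime ∧ p % q = 1) =
    (Ioc 0 ⌊x⌋₊).filter (fun p => p.Prime ∧ p % q = 1) := by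
  ext p
  simp only [mem_filter, mem_range, mem_Ioc]
  constructor
  · rintro ⟨a, b, c⟩; exact ⟨⟨b.pos, by omega⟩, b, c⟩
  · rintro ⟨⟨_, a⟩, b, c⟩; exact ⟨by omega, b, c⟩

lemma Mfun_eq (x : ℝ) (q : ℕ) : Mfun x q = ∑ n ∈ (Ioc 0 ⌊x⌋₊).filter Nat.Prime, aq q n := by
  rw [Mfun, filter_eq, ← filter_filter, sum_filter]
  apply sum_congr rfl
  intro p hp
  unfold aq
  split_ifs
  · exact (ArithmeticFunction.vonMangoldt_apply_prime (mem_filter.1 hp).2).symm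
  · rfl

lemma Mfun_near {x : ℝ} (hx : 1 ≤ x) (q : ℕ) : Mfun x q ≤ su (aq q) x ∧ su (aq q) x ≤ Mfun x q + 2 * √x * Real.log x := by
  have e : su (aq q) x = Mfun x q + ∑ n ∈ (Ioc 0 ⌊x⌋₊).filter (fun n => ¬ n.Prime), aq q n := by
    rw [Mfun_eq, su, sum_filter_add_sum_filter_not]
  have h1 : 0 ≤ ∑ n ∈ (Ioc 0 ⌊x⌋₊).filter (fun n => ¬ n.Prime), aq q n := sum_nonneg fun n _ => aq_nonneg q n
  have h2 : ∑ n ∈ (Ioc 0 ⌊x⌋₊).filter (fun n => ¬ n.Prime), aq q n ≤ 2 * √x * Real.log x := by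
    refine le_trans ?_ (Chebyshev.psi_sub_theta_le hx)
    rw [Chebyshev.psi_sub_theta_eq_sum_not_prime]
    apply sum_le_sum
    intro n _
    unfold aq
    split_ifs
    · exact le_rfl
    · exact vM_nonneg n
  constructor <;> linarith

lemma Lfun_near {x : ℝ} (hx : 1 < x) (q : ℕ) : Mfun x q ≤ Lfun x q * Real.log x ∧
    Lfun x q * Real.log x ≤ Mfun x q + √x * Real.log x + 2 / Real.log x * sm (aq q) x := by
  have hx0 : 0 < x := by linarith
  have hl : 0 < Real.log x := Real.log_pos hx
  set F := (Ioc 0 ⌊x⌋₊).filter (fun p => p.Prime ∧ p % q = 1) with hF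
  have eM : Mfun x q = ∑ p ∈ F, Real.log p := by rw [Mfun, filter_eq]
  have eL : (Lfun x q : ℝ) * Real.log x = ∑ p ∈ F, Real.log x := by
    rw [Lfun, filter_eq, sum_const, nsmul_eq_mul]
  rw [eM, eL]
  constructor
  · apply sum_le_sum
    intro p hp
    exact log_le_of_mem hx.le (mem_filter.1 hp).1
  · have hterm : ∀ p ∈ F, Real.log x ≤ Real.log p + ((if p ≤ ⌊√x⌋₊ then Real.log x else 0) + 2 / Real.log x * (aq q p * Real.posLog (x / p))) := by
      intro p hp
      rw [hF, mem_filter, mem_Ioc] at hp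
      have hp0 : (0:ℝ) < p := by exact_mod_cast hp.1.1
      have hlp : 0 ≤ Real.log p := Real.log_natCast_nonneg p
      have hpx : (p:ℝ) ≤ x := (Nat.le_floor_iff hx0.le).1 hp.1.2
      have hpl : Real.posLog (x / p) = Real.log x - Real.log p := by
        rw [Real.posLog_eq_log, Real.log_div hx0.ne' hp0.ne']
        rw [abs_of_pos (by positivity), one_le_div hp0]; exact hpx
      have hd : 0 ≤ Real.log x - Real.log p := by
        have := Real.log_le_log hp0 hpx; linarith
      have haq : aq q p = Real.log p := by
        unfold aq; rw [if_pos hp.2.2]; exact ArithmeticFunction.vonMangoldt_apply_prime hp.2.1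
      rw [hpl, haq]
      split_ifs with h
      · have : 0 ≤ 2 / Real.log x * (Real.log p * (Real.log x - Real.log p)) := by positivity
        linarith
      · have h1 : √x < p := (Nat.floor_lt (by positivity)).1 (not_le.1 h)
        have h2 : Real.log x / 2 ≤ Real.log p := by
          rw [← Real.log_sqrt hx0.le]; exact Real.log_le_log (by positivity) h1.le
        have h3 : 1 ≤ 2 / Real.log x * Real.log p := by
          rw [div_mul_eq_mul_div, one_le_div hl]; linarith
        have h4 : 1 * (Real.log x - Real.log p) ≤ 2 / Real.log x * Real.log p * (Real.log x - Real.log p) := by gcongr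
        linarith
    refine (sum_le_sum hterm).trans ?_
    rw [sum_add_distrib, sum_add_distrib, ← mul_sum, add_assoc]
    gcongr
    · rw [← sum_filter]
      calc _ ≤ ∑ k ∈ Ioc 0 ⌊√x⌋₊, Real.log x := by
            apply sum_le_sum_of_subset_of_nonneg
            · intro k hk; simp only [hF, mem_filter, mem_Ioc] at hk ⊢; exact ⟨hk.1.1.1, hk.2⟩
            · intro _ _ _; positivity
        _ = ⌊√x⌋₊ * Real.log x := by simp
        _ ≤ _ := by gcongr; exact Nat.floor_le (by positivity)
    · rw [sm]
      apply sum_le_sum_of_subset_of_nonneg (filter_subset _ _)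
      intro n _ _
      exact mul_nonneg (aq_nonneg q n) Real.posLog_nonneg

set_option maxHeartbeats 2000000 in
theorem main_bvc (ρ : ℝ) (hρ0 : 0 < ρ) (hρ : ρ < 1 / 2) :
    ∃ C > (0 : ℝ), ∃ x₀ : ℝ, ∀ x : ℝ, x₀ ≤ x → ∃ q : ℕ, q.Prime ∧
      x ^ ρ / Real.log x < (q : ℝ) ∧ (q : ℝ) < x ^ ρ ∧
      |(Lfun x q : ℝ) - x / (Nat.totient q * Real.log x)| ≤
        C * x / (Nat.totient q * (Real.log x) ^ 2) ∧
      |Mfun x q - x / Nat.totient q| ≤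
        C * x / (Nat.totient q * (Real.log x) ^ 2) := by
  obtain ⟨C, hC, hpsi⟩ := psi_near
  obtain ⟨K, hK, hsm⟩ := sm_le
  rw [eventually_atTop] at hpsi
  obtain ⟨X0, hpsi⟩ := hpsi
  set C1 := 4 * C + 6 with hC1
  refine ⟨C1 + 2 * K + 3, by positivity, ?_⟩
  rw [← eventually_atTop (p := fun x : ℝ => ∃ q : ℕ, q.Prime ∧
      x ^ ρ / Real.log x < (q : ℝ) ∧ (q : ℝ) < x ^ ρ ∧
      |(Lfun x q : ℝ) - x / (Nat.totient q * Real.log x)| ≤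
        (C1 + 2 * K + 3) * x / (Nat.totient q * (Real.log x) ^ 2) ∧
      |Mfun x q - x / Nat.totient q| ≤
        (C1 + 2 * K + 3) * x / (Nat.totient q * (Real.log x) ^ 2))]
  filter_upwards [choose_q hρ0 hρ, ev_log 24 7 hρ0, ev_log 2 3 (show 0 < 1/2 - ρ by linarith), ev_loglow 4,
    eventually_ge_atTop 6, eventually_ge_atTop (3 * X0)] with x hch hl7 hl3 hl4 hx6 hxX
  have hx0 : 0 < x := by linarith
  set ℓ := Real.log x with hℓ
  have hℓ0 : 0 < ℓ := by linarith
  set h := 1 / ℓ ^ 2 with hh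
  have hh0 : 0 < h := by positivity
  have hhl : h * ℓ ^ 2 = 1 := by rw [hh]; field_simp
  have hh1 : h ≤ 1 / 2 := by nlinarith
  obtain ⟨he1, he2⟩ := exp_h hh0.le (by linarith)
  set yp := x * Real.exp h with hyp
  set ym := x * Real.exp (-h) with hym
  have hyp1 : x ≤ yp := by rw [hyp]; apply le_mul_of_one_le_right hx0.le; rw [Real.one_le_exp_iff]; linarith
  have hyp2 : yp ≤ x + x * (2 * h) := by rw [hyp]; nlinarith
  have hyp3 : yp ≤ 3 * x := by nlinarith
  have hym1 : ym ≤ x := by rw [hym]; apply mul_le_of_le_one_right hx0.le; rw [Real.exp_le_one_iff]; linarith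
  have hym2 : x - x * h ≤ ym := by rw [hym]; nlinarith
  have hym3 : x / 2 ≤ ym := by nlinarith
  have hym0 : 0 < ym := by positivity
  have hlyp : Real.log yp = ℓ + h := by rw [hyp, Real.log_mul hx0.ne' (by positivity), Real.log_exp]
  have hlym : Real.log ym = ℓ - h := by rw [hym, Real.log_mul hx0.ne' (by positivity), Real.log_exp]; ring
  obtain ⟨q, hq, hW⟩ := hch ![x, yp, ym] (by
    intro i
    fin_cases i
    · exact ⟨by simp; linarith, by simp; linarith, by simp [← hℓ]⟩
    · exact ⟨by simp; linarith, by simpa using hyp3, by simp [hlyp]; linarith⟩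
    · exact ⟨by simp; linarith, by simp; linarith, by simp [hlym]; linarith⟩)
  rw [PS, mem_filter] at hq
  obtain ⟨-, hqp, hq1, hq2⟩ := hq
  refine ⟨q, hqp, hq1, hq2, ?_⟩
  set φ : ℝ := (q.totient : ℝ) with hφ
  have hφ0 : 0 < φ := by rw [hφ]; exact_mod_cast Nat.totient_pos.2 hqp.pos
  have hφ1 : φ ≤ x ^ ρ := by
    refine le_trans ?_ hq2.le
    rw [hφ]; exact_mod_cast Nat.totient_le q
  set δ := x / ℓ ^ 4 with hδ
  have hδ0 : 0 < δ := by positivity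
  have hE : ∀ y : ℝ, 1 ≤ y → y ≤ 3 * x → Real.log y ≤ ℓ + 1 → ∑ χ ∈ nt q, ‖W y χ‖ ≤ x / (2 * ℓ ^ 4) →
      |φ * sm (aq q) y - sm vM y| ≤ δ := by
    intro y y1 y2 y3 y4
    refine (char_decomp hqp y1).trans ?_
    have hly := Real.log_nonneg y1
    have b1 : y / q * Real.log y ^ 2 ≤ x / (2 * ℓ ^ 4) := by
      have hxl : 0 < x ^ ρ / ℓ := by positivity
      calc y / q * Real.log y ^ 2 ≤ (3 * x) / (x ^ ρ / ℓ) * (2 * ℓ) ^ 2 := by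
            gcongr
            linarith
        _ = 12 * x * ℓ ^ 3 / x ^ ρ := by field_simp; ring
        _ ≤ 12 * x * ℓ ^ 3 / (24 * ℓ ^ 7) := by gcongr
        _ = _ := by field_simp; ring
    have e : δ = x / (2 * ℓ ^ 4) + x / (2 * ℓ ^ 4) := by rw [hδ]; field_simp; ring
    rw [e]; gcongr
  have E0 := abs_le.1 (hE x (by linarith) (by linarith) (by rw [← hℓ]; linarith) (by simpa using hW 0))
  have E1 := abs_le.1 (hE yp (by linarith) hyp3 (by linarith) (by simpa using hW 1))
  have E2 := abs_le.1 (hE ym (by linarith) (by linarith) (by linarith) (by simpa using hW 2))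
  set s := su (aq q) x with hs
  have hδl : δ * ℓ ^ 2 = x / ℓ ^ 2 := by rw [hδ]; field_simp
  have hxh : x * h = x / ℓ ^ 2 := by rw [hh]; ring
  set u := x / ℓ ^ 2 with hu
  have hu0 : 0 < u := by positivity
  have up : φ * s ≤ x + (4 + 3 * C) * u := by
    have lg : Real.log (yp / x) = h := by rw [Real.log_div (by linarith) hx0.ne', hlyp]; ring
    have a1 := sm_lower (aq q) (aq_nonneg q) hx0 hyp1
    have a2 := sm_upper vM vM_nonneg hx0 hyp1
    rw [lg] at a1 a2
    have a3 : φ * (h * s) ≤ φ * (sm (aq q) yp - sm (aq q) x) := by gcongr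
    have a4 : φ * (h * s) ≤ h * su vM yp + 2 * δ := by linarith
    have a5 := mul_le_mul_of_nonneg_right a4 (show 0 ≤ ℓ ^ 2 by positivity)
    have a6 : φ * (h * s) * ℓ ^ 2 = φ * s * (h * ℓ ^ 2) := by ring
    have a7 : (h * su vM yp + 2 * δ) * ℓ ^ 2 = su vM yp * (h * ℓ ^ 2) + 2 * (δ * ℓ ^ 2) := by ring
    rw [a6, a7, hhl, hδl] at a5
    have a8 := (abs_le.1 (hpsi yp (by linarith))).2
    have a9 : su vM yp = Chebyshev.psi yp := rfl
    have a10 : C * yp / Real.log yp ^ 2 ≤ 3 * C * u := by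
      calc C * yp / Real.log yp ^ 2 ≤ C * (3 * x) / ℓ ^ 2 := by
            gcongr
            rw [hlyp]; linarith
        _ = _ := by rw [hu]; ring
    linarith
  have low : x - (3 + 4 * C) * u ≤ φ * s := by
    have lg : Real.log (x / ym) = h := by rw [Real.log_div hx0.ne' hym0.ne', hlym]; ring
    have a1 := sm_upper (aq q) (aq_nonneg q) hym0 hym1
    have a2 := sm_lower vM vM_nonneg hym0 hym1
    rw [lg] at a1 a2
    have a3 : φ * (sm (aq q) x - sm (aq q) ym) ≤ φ * (h * s) := by gcongr
    have a4 : h * su vM ym - 2 * δ ≤ φ * (h * s) := by linarith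
    have a5 := mul_le_mul_of_nonneg_right a4 (show 0 ≤ ℓ ^ 2 by positivity)
    have a6 : φ * (h * s) * ℓ ^ 2 = φ * s * (h * ℓ ^ 2) := by ring
    have a7 : (h * su vM ym - 2 * δ) * ℓ ^ 2 = su vM ym * (h * ℓ ^ 2) - 2 * (δ * ℓ ^ 2) := by ring
    rw [a6, a7, hhl, hδl] at a5
    have a8 := (abs_le.1 (hpsi ym (by linarith))).1
    have a9 : su vM ym = Chebyshev.psi ym := rfl
    have a10 : C * ym / Real.log ym ^ 2 ≤ 4 * C * u := by
      calc C * ym / Real.log ym ^ 2 ≤ C * x / (ℓ / 2) ^ 2 := by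
            gcongr
            rw [hlym]; linarith
        _ = _ := by rw [hu]; field_simp; ring
    linarith
  have hsq : φ * (2 * √x * ℓ) ≤ u := by
    rw [hu, le_div_iff₀ (by positivity)]
    calc φ * (2 * √x * ℓ) * ℓ ^ 2 ≤ x ^ ρ * (2 * √x * ℓ) * ℓ ^ 2 := by gcongr
      _ = x ^ ρ * √x * (2 * ℓ ^ 3) := by ring
      _ ≤ x ^ ρ * √x * x ^ (1/2 - ρ) := by gcongr
      _ = x := by
        rw [Real.sqrt_eq_rpow, ← Real.rpow_add hx0, ← Real.rpow_add hx0]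
        rw [show ρ + 1/2 + (1/2 - ρ) = 1 by ring, Real.rpow_one]
  obtain ⟨m1, m2⟩ := Mfun_near (show 1 ≤ x by linarith) q
  obtain ⟨l1, l2⟩ := Lfun_near (show 1 < x by linarith) q
  rw [← hℓ] at m2 l1 l2
  have hM : |φ * Mfun x q - x| ≤ C1 * u := by
    have c1 : φ * Mfun x q ≤ φ * s := by gcongr
    have c2 : φ * s ≤ φ * (Mfun x q + 2 * √x * ℓ) := by gcongr
    have : 0 ≤ C * u := by positivity
    rw [abs_le, hC1]; constructor <;> linarith
  have huv : u ≤ x / ℓ := by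
    rw [hu]; gcongr; nlinarith
  have hL : |φ * (Lfun x q * ℓ) - x| ≤ (C1 + 2 * K + 3) * (x / ℓ) := by
    have c1 : φ * Mfun x q ≤ φ * (Lfun x q * ℓ) := by gcongr
    have c2 : φ * (Lfun x q * ℓ) ≤ φ * (Mfun x q + √x * ℓ + 2 / ℓ * sm (aq q) x) := by gcongr
    have c3 : φ * sm (aq q) x ≤ (K + 1) * x := by
      have := hsm x hx0
      have : δ ≤ x := by rw [hδ]; apply div_le_self hx0.le; apply one_le_pow₀; linarith
      linarith
    have c4 : 2 / ℓ * (φ * sm (aq q) x) ≤ 2 / ℓ * ((K + 1) * x) := by gcongr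
    have c5 : 2 / ℓ * ((K + 1) * x) = (2 * K + 2) * (x / ℓ) := by ring
    have c6 : C1 * u ≤ C1 * (x / ℓ) := by gcongr
    have c7 : 0 ≤ K * (x / ℓ) := by positivity
    have c8 : 0 ≤ x / ℓ := by positivity
    have hM' := abs_le.1 hM
    rw [abs_le]; constructor <;> linarith
  constructor
  · have e1 : (Lfun x q : ℝ) - x / (φ * ℓ) = (φ * (Lfun x q * ℓ) - x) / (φ * ℓ) := by field_simp
    rw [e1, abs_div, abs_of_pos (show 0 < φ * ℓ by positivity), div_le_iff₀ (by positivity)]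
    refine hL.trans (le_of_eq ?_)
    field_simp
  · have e1 : Mfun x q - x / φ = (φ * Mfun x q - x) / φ := by field_simp
    rw [e1, abs_div, abs_of_pos hφ0, div_le_iff₀ hφ0]
    refine hM.trans ?_
    have e2 : (C1 + 2 * K + 3) * x / (φ * ℓ ^ 2) * φ = (C1 + 2 * K + 3) * u := by rw [hu]; field_simp
    rw [e2]; gcongr; linarith

end BVC

theorem bombieri_vinogradov_consequence (ρ : ℝ) (hρ0 : 0 < ρ) (hρ : ρ < 1 / 2) :
    ∃ C > (0 : ℝ), ∃ x₀ : ℝ, ∀ x : ℝ, x₀ ≤ x → ∃ q : ℕ, q.Prime ∧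
      x ^ ρ / Real.log x < (q : ℝ) ∧ (q : ℝ) < x ^ ρ ∧
      |(Lfun x q : ℝ) - x / (Nat.totient q * Real.log x)| ≤
        C * x / (Nat.totient q * (Real.log x) ^ 2) ∧
      |Mfun x q - x / Nat.totient q| ≤
        C * x / (Nat.totient q * (Real.log x) ^ 2) := by
  exact BVC.main_bvc ρ hρ0 hρ
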